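/- There exist constants χ′ > 0, C > 0 and ρ₀ ∈ (0,1), depending only on n, λ and Λ, such that for every g ∈ M_{λ,Λ}, every solution u of the Ginzburg–Landau equation −Δ_g u = ε⁻²(1−|u|²)u on B₁, and all 0 < σ ≤ ρ < ρ₀, one has e^{−χ′ρ} ρ^{2−n} ∫_{B_ρ} e_ε(u) dvol_g − e^{−χ′σ} σ^{2−n} ∫_{B_σ} e_ε(u) dvol_g ≤ (1/(1−Cρ)) [ ∫_σ^ρ e^{−χ′s} s^{1−n} ( ∫_{B_s} (1−|u|²)²/(2ε²) dvol_g ) ds + ∫_{B_ρ∖B_σ} e^{−χ′|x|} |x|^{2−n} |∇_r u(x)|² √(det g(x)) dx ]. -/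

import Mathlib

open MeasureTheory Metric

noncomputable section

/-- `n`-dimensional Euclidean space. -/
abbrev Euc (n : ℕ) : Type := EuclideanSpace ℝ (Fin n)

/-- The real inner product of two complex numbers, viewing `ℂ ≅ ℝ²`. -/
def rdot (v w : ℂ) : ℝ := v.re * w.re + v.im * w.im

/-- The `i`-th partial derivative of a function on Euclidean space. -/
def pd {n : ℕ} (u : Euc n → ℂ) (i : Fin n) (x : Euc n) : ℂ :=
  fderiv ℝ u x (EuclideanSpace.single i 1)

/-- `√(det g)`. -/
def sqrtDet {n : ℕ} (g : Euc n → Matrix (Fin n) (Fin n) ℝ) (x : Euc n) : ℝ :=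
  Real.sqrt (g x).det

/-- `g^{ij} ∂_i u · ∂_j u`, the squared norm of the gradient of `u` with respect to `g`. -/
def gradSq {n : ℕ} (g : Euc n → Matrix (Fin n) (Fin n) ℝ) (u : Euc n → ℂ) (x : Euc n) : ℝ :=
  ∑ i, ∑ j, (g x)⁻¹ i j * rdot (pd u i x) (pd u j x)

/-- The Ginzburg–Landau energy density `e_ε(u)`. -/
def eDen {n : ℕ} (g : Euc n → Matrix (Fin n) (Fin n) ℝ) (ε : ℝ) (u : Euc n → ℂ)
    (x : Euc n) : ℝ :=
  gradSq g u x / 2 + (1 - ‖u x‖ ^ 2) ^ 2 / (4 * ε ^ 2)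

/-- The class `M_{λ,Λ}` of Lipschitz metrics on the unit ball: symmetric positive definite,
equal to the identity at `0`, Lipschitz components, and uniformly elliptic. -/
def MemM (n : ℕ) (lam Lam : ℝ) (g : Euc n → Matrix (Fin n) (Fin n) ℝ) : Prop :=
  g 0 = 1 ∧
  (∀ x ∈ ball (0 : Euc n) 1, (g x).IsSymm ∧ (g x).PosDef) ∧
  (∀ i j : Fin n,
    LipschitzOnWith (Real.toNNReal Lam) (fun x => g x i j) (ball (0 : Euc n) 1)) ∧
  (∀ x ∈ ball (0 : Euc n) 1, ∀ ξ : Fin n → ℝ,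
    lam * ∑ i, ξ i ^ 2 ≤ ∑ i, ∑ j, g x i j * ξ i * ξ j ∧
    ∑ i, ∑ j, g x i j * ξ i * ξ j ≤ lam⁻¹ * ∑ i, ξ i ^ 2)

/-- A weak solution `u ∈ W^{1,2}(B₁; ℂ)`, `|u| ≤ 1`, of the Ginzburg–Landau equation
`−Δ_g u = ε⁻²(1−|u|²)u` on the unit ball. -/
def IsGLSol (n : ℕ) (g : Euc n → Matrix (Fin n) (Fin n) ℝ) (ε : ℝ) (u : Euc n → ℂ) : Prop :=
  DifferentiableOn ℝ u (ball (0 : Euc n) 1) ∧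
  (∀ x ∈ ball (0 : Euc n) 1, ‖u x‖ ≤ 1) ∧
  IntegrableOn (fun x => eDen g ε u x * sqrtDet g x) (ball (0 : Euc n) 1) ∧
  ∀ ζ : Euc n → ℂ, ContDiff ℝ 1 ζ → tsupport ζ ⊆ ball (0 : Euc n) 1 →
    ∫ x in ball (0 : Euc n) 1,
      ((∑ i, ∑ j, (g x)⁻¹ i j * rdot (pd u i x) (pd ζ j x))
        - (1 - ‖u x‖ ^ 2) / ε ^ 2 * rdot (u x) (ζ x)) * sqrtDet g x = 0

/-- The radial derivative `∇_r u(x) = g^{ij}(x) (x_i/|x|) ∂_j u(x)`. -/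
def radD {n : ℕ} (g : Euc n → Matrix (Fin n) (Fin n) ℝ) (u : Euc n → ℂ) (x : Euc n) : ℂ :=
  ∑ i, ∑ j, (((g x)⁻¹ i j * (x i / ‖x‖) : ℝ) : ℂ) * pd u j x

open scoped Topology Convolution

/-- Correlations of square integrable functions depend continuously on the shift. -/
lemma continuous_integral_inner_shift {E V : Type*} [NormedAddCommGroup E]
    [InnerProductSpace ℝ E] [FiniteDimensional ℝ E] [MeasurableSpace E] [BorelSpace E]
    [NormedAddCommGroup V] [InnerProductSpace ℝ V] {a G : E → V}
    (ha : MemLp a 2 (volume : Measure E)) (hG : MemLp G 2 (volume : Measure E)) :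
    Continuous fun z : E => ∫ x, inner ℝ (a x) (G (z + x)) := by
  have : Fact ((2 : ENNReal) ≠ ⊤) := ⟨by norm_num⟩
  have h : (fun z : E => ∫ x, inner ℝ (a x) (G (z + x))) =
      fun z => inner ℝ (ha.toLp a) (DomAddAct.mk z +ᵥ hG.toLp G) := by
    funext z
    rw [DomAddAct.mk_vadd_toLp, L2.inner_def]
    refine integral_congr_ae ?_
    filter_upwards [ha.coeFn_toLp, (hG.comp_measurePreserving
      (measurePreserving_vadd z (volume : Measure E))).coeFn_toLp] with x hx hx'
    have hx'' := hx'
    simp only [vadd_eq_add, Function.comp_apply] at hx'' ⊢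
    rw [hx]
    erw [hx'']
  rw [h]
  have h1 : Continuous fun z : E => DomAddAct.mk z :=
    DomAddAct.continuous_mk
  exact continuous_const.inner (h1.vadd continuous_const)

/-- Mollifying one factor of an `L²` pairing recovers the pairing in the limit. -/
lemma tendsto_integral_inner_convolution {E V : Type*} [NormedAddCommGroup E]
    [InnerProductSpace ℝ E] [FiniteDimensional ℝ E] [MeasurableSpace E] [BorelSpace E]
    [NormedAddCommGroup V] [InnerProductSpace ℝ V] [CompleteSpace V] {a G : E → V}
    (ha : MemLp a 2 (volume : Measure E)) (hG : MemLp G 2 (volume : Measure E))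
    (φ : ℕ → ContDiffBump (0 : E))
    (hφ : Filter.Tendsto (fun k => (φ k).rOut) Filter.atTop (𝓝 0)) :
    Filter.Tendsto (fun k => ∫ x, inner ℝ (a x)
        (((φ k).normed volume ⋆[ContinuousLinearMap.lsmul ℝ ℝ, volume] G) x))
      Filter.atTop (𝓝 (∫ x, inner ℝ (a x) (G x))) := by
  have hc := continuous_integral_inner_shift ha hG
  have key : ∀ k, ∫ x, inner ℝ (a x)
        (((φ k).normed volume ⋆[ContinuousLinearMap.lsmul ℝ ℝ, volume] G) x) =
      ((φ k).normed volume ⋆[ContinuousLinearMap.lsmul ℝ ℝ, volume]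
        (fun z : E => ∫ x, inner ℝ (a x) (G (z + x)))) 0 := by
    intro k
    set f : E → ℝ := (φ k).normed volume with hf
    have hfc : Continuous f := (φ k).continuous_normed
    have hfi : Integrable f := (φ k).integrable_normed
    have hf0 : ∀ y, 0 ≤ f y := (φ k).nonneg_normed
    have hsub : Measure.QuasiMeasurePreserving (fun p : E × E => p.1 - p.2)
        (volume.prod volume) volume :=
      quasiMeasurePreserving_sub_of_right_invariant volume volume
    have hint : Integrable (Function.uncurry fun x y => inner ℝ (a x) (f y • G (x - y)))
        (volume.prod volume) := by
      have h1 : Integrable (fun p : E × E => ‖a p.1‖ ^ 2 * f p.2) (volume.prod volume) :=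
        (ha.integrable_norm_pow (by norm_num)).mul_prod hfi
      have h2 : Integrable (fun p : E × E => f p.2 * ‖G (p.1 - p.2)‖ ^ 2)
          (volume.prod volume) := by
        simpa using hfi.convolution_integrand (ContinuousLinearMap.lsmul ℝ ℝ)
          (hG.integrable_norm_pow (by norm_num))
      refine (h1.add h2).mono' ?_ ?_
      · have m1 : AEStronglyMeasurable (fun p : E × E => a p.1) (volume.prod volume) :=
          ha.1.comp_fst
        have m2 : AEStronglyMeasurable (fun p : E × E => G (p.1 - p.2)) (volume.prod volume) :=
          hG.1.comp_quasiMeasurePreserving hsub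
        have m3 : AEStronglyMeasurable (fun p : E × E => f p.2) (volume.prod volume) :=
          (hfc.comp continuous_snd).aestronglyMeasurable
        exact m1.inner (m3.smul m2)
      · refine Filter.Eventually.of_forall fun p => ?_
        simp only [Function.uncurry, Pi.add_apply]
        refine (norm_inner_le_norm _ _).trans ?_
        rw [norm_smul, Real.norm_of_nonneg (hf0 _)]
        nlinarith [hf0 p.2, mul_nonneg (hf0 p.2) (sq_nonneg (‖a p.1‖ - ‖G (p.1 - p.2)‖)),
          mul_nonneg (hf0 p.2) (sq_nonneg (‖a p.1‖ + ‖G (p.1 - p.2)‖))]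
    have hswap := integral_integral_swap hint
    have hGi : ∀ᵐ x : E, Integrable fun y => f y • G (x - y) := by
      have hbdd : ∃ C, ∀ y, ‖f y‖ ≤ C := by
        obtain ⟨C, hC⟩ := (φ k).hasCompactSupport_normed.exists_bound_of_continuous (f := f) hfc
        exact ⟨C, hC⟩
      have hloc : LocallyIntegrable G := hG.locallyIntegrable (by norm_num)
      refine Filter.Eventually.of_forall fun x => ?_
      exact ((φ k).hasCompactSupport_normed.convolutionExists_left
        (ContinuousLinearMap.lsmul ℝ ℝ) hfc hloc x)
    calc ∫ x, inner ℝ (a x) ((f ⋆[ContinuousLinearMap.lsmul ℝ ℝ, volume] G) x)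
        = ∫ x, ∫ y, inner ℝ (a x) (f y • G (x - y)) := by
          refine integral_congr_ae ?_
          filter_upwards [hGi] with x hx
          simp only [convolution, ContinuousLinearMap.lsmul_apply]
          exact (integral_inner hx (a x)).symm
      _ = ∫ y, ∫ x, inner ℝ (a x) (f y • G (x - y)) := hswap
      _ = _ := by
          simp only [convolution, ContinuousLinearMap.lsmul_apply]
          refine integral_congr_ae (Filter.Eventually.of_forall fun y => ?_)
          simp only [inner_smul_right, smul_eq_mul, zero_sub]
          rw [integral_const_mul]
          congr 2
          funext x
          rw [neg_add_eq_sub]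
  simp only [key]
  have := ContDiffBump.convolution_tendsto_right (μ := (volume : Measure E)) (φ := φ)
    (l := Filter.atTop) (x₀ := (0 : E)) (k := fun _ => (0 : E))
    (g := fun _ => fun z : E => ∫ x, inner ℝ (a x) (G (z + x)))
    (z₀ := ∫ x, inner ℝ (a x) (G ((0 : E) + x))) hφ
    (Filter.Eventually.of_forall fun _ => hc.aestronglyMeasurable)
    ((hc.tendsto 0).comp Filter.tendsto_snd) tendsto_const_nhds
  simpa using this

lemma rdot_eq_inner (v w : ℂ) : rdot v w = inner ℝ v w := by
  simp [rdot, Complex.inner]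
  ring

lemma MeasureTheory.MemLp.integrable_inner_two {α V : Type*} [MeasurableSpace α] {μ : Measure α}
    [NormedAddCommGroup V] [InnerProductSpace ℝ V] {f g : α → V} (hf : MemLp f 2 μ)
    (hg : MemLp g 2 μ) : Integrable (fun x => inner ℝ (f x) (g x)) μ :=
  (hf.norm.integrable_mul hg.norm).mono' (hf.1.inner hg.1)
    (Filter.Eventually.of_forall fun _ => norm_inner_le_norm _ _)

/-- Partial derivatives of a mollification are mollifications of partial derivatives, for a
differentiable, not necessarily continuously differentiable, function. -/
lemma pd_convolution {n : ℕ} {f : Euc n → ℝ} {ζ : Euc n → ℂ} (hf : ContDiff ℝ 1 f)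
    (hfc : HasCompactSupport f) (hζ : Differentiable ℝ ζ) (j : Fin n)
    (hζj : LocallyIntegrable (pd ζ j)) (x : Euc n) :
    pd (f ⋆[ContinuousLinearMap.lsmul ℝ ℝ, volume] ζ) j x =
      (f ⋆[ContinuousLinearMap.lsmul ℝ ℝ, volume] (pd ζ j)) x := by
  have hloc : LocallyIntegrable ζ := hζ.continuous.locallyIntegrable
  have h1 := hfc.hasFDerivAt_convolution_left (ContinuousLinearMap.lsmul ℝ ℝ) hf hloc x
  have hex : ConvolutionExistsAt (fderiv ℝ f) ζ x
      ((ContinuousLinearMap.lsmul ℝ ℝ).precompL (Euc n)) volume :=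
    (hfc.fderiv ℝ).convolutionExists_left _ (hf.continuous_fderiv one_ne_zero) hloc x
  have hd : ∀ y, HasFDerivAt (fun y => ζ (x - y)) (-(fderiv ℝ ζ (x - y))) y := by
    intro y
    have := (hζ (x - y)).hasFDerivAt.comp y ((hasFDerivAt_id y).const_sub x)
    simpa [Function.comp_def] using this
  set e : Euc n := EuclideanSpace.single j 1 with he
  have i1 : Integrable fun y => (fderiv ℝ f y e) • ζ (x - y) := by
    have := hex.integrable.apply_continuousLinearMap e
    simpa [Function.comp_def] using this
  have i2 : Integrable fun y => f y • pd ζ j (x - y) :=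
    (hfc.convolutionExists_left (ContinuousLinearMap.lsmul ℝ ℝ) hf.continuous hζj x).integrable
  have i3 : Integrable fun y => f y • ζ (x - y) :=
    (hfc.convolutionExists_left (ContinuousLinearMap.lsmul ℝ ℝ) hf.continuous hloc x).integrable
  have i2' : Integrable fun y => f y • (fderiv ℝ (fun y => ζ (x - y)) y) e := by
    have : (fun y => f y • (fderiv ℝ (fun y => ζ (x - y)) y) e) =
        fun y => -(f y • pd ζ j (x - y)) := by
      funext y
      rw [(hd y).fderiv]
      simp [pd, he]
    rw [this]
    exact i2.neg
  have hparts := integral_smul_fderiv_eq_neg_fderiv_smul_of_integrable i1 i2' i3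
    (fun y _ => (hf.differentiable one_ne_zero) y) (fun y _ => (hd y).differentiableAt)
  rw [pd, h1.fderiv, convolution, ContinuousLinearMap.integral_apply hex]
  simp only [ContinuousLinearMap.precompL_apply, ContinuousLinearMap.lsmul_apply, convolution]
  rw [← neg_eq_iff_eq_neg.mpr hparts, ← integral_neg]
  refine integral_congr_ae (Filter.Eventually.of_forall fun y => ?_)
  simp only
  rw [(hd y).fderiv]
  simp [pd, he]

/-- A weak equation tested against `C¹` functions may be tested against differentiable functions
of compact support with square integrable gradient. -/
lemma weak_form_of_differentiable {n : ℕ} {a : Fin n → Euc n → ℂ} {b : Euc n → ℂ}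
    (ha : ∀ j, MemLp (a j) 2 (volume.restrict (ball (0 : Euc n) 1)))
    (hb : MemLp b 2 (volume.restrict (ball (0 : Euc n) 1)))
    (h : ∀ ζ : Euc n → ℂ, ContDiff ℝ 1 ζ → tsupport ζ ⊆ ball (0 : Euc n) 1 →
      ∫ x in ball (0 : Euc n) 1, ((∑ j, rdot (a j x) (pd ζ j x)) - rdot (b x) (ζ x)) = 0)
    {ζ : Euc n → ℂ} (hζ : Differentiable ℝ ζ) {ρ : ℝ} (hρ : ρ < 1)
    (hsupp : ∀ x, ρ ≤ ‖x‖ → ζ x = 0) (hζ2 : ∀ j, MemLp (pd ζ j) 2 (volume : Measure (Euc n))) :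
    ∫ x in ball (0 : Euc n) 1, ((∑ j, rdot (a j x) (pd ζ j x)) - rdot (b x) (ζ x)) = 0 := by
  have hB : MeasurableSet (ball (0 : Euc n) 1) := measurableSet_ball
  have hsub : Function.support ζ ⊆ closedBall 0 ρ := by
    intro x hx
    rw [mem_closedBall_zero_iff]
    by_contra hx'
    exact hx (hsupp x (not_le.mp hx').le)
  have hcs : HasCompactSupport ζ :=
    HasCompactSupport.of_support_subset_isCompact (isCompact_closedBall 0 ρ) hsub
  have hζL : MemLp ζ 2 (volume : Measure (Euc n)) :=
    hζ.continuous.memLp_of_hasCompactSupport hcs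
  set a' : Fin n → Euc n → ℂ := fun j => (ball (0 : Euc n) 1).indicator (a j) with ha'
  set b' : Euc n → ℂ := (ball (0 : Euc n) 1).indicator b with hb'
  have ha'L : ∀ j, MemLp (a' j) 2 (volume : Measure (Euc n)) := fun j =>
    (memLp_indicator_iff_restrict hB).mpr (ha j)
  have hb'L : MemLp b' 2 (volume : Measure (Euc n)) :=
    (memLp_indicator_iff_restrict hB).mpr hb
  have conv : ∀ ξ : Euc n → ℂ, (∀ j, MemLp (pd ξ j) 2 (volume : Measure (Euc n))) →
      MemLp ξ 2 (volume : Measure (Euc n)) →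
      ∫ x in ball (0 : Euc n) 1, ((∑ j, rdot (a j x) (pd ξ j x)) - rdot (b x) (ξ x)) =
      (∑ j, ∫ x, inner ℝ (a' j x) (pd ξ j x)) - ∫ x, inner ℝ (b' x) (ξ x) := by
    intro ξ h1 h2
    have i1 : ∀ j, Integrable fun x => inner ℝ (a' j x) (pd ξ j x) := fun j =>
      (ha'L j).integrable_inner_two (h1 j)
    have i2 : Integrable fun x => inner ℝ (b' x) (ξ x) := hb'L.integrable_inner_two h2
    rw [← integral_finsetSum _ (fun j _ => i1 j),
      ← integral_sub (integrable_finsetSum _ fun j _ => i1 j) i2, ← integral_indicator hB]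
    refine integral_congr_ae (Filter.Eventually.of_forall fun x => ?_)
    by_cases hx : x ∈ ball (0 : Euc n) 1
    · simp only [ha', hb', Set.indicator_of_mem hx, rdot_eq_inner]
    · simp only [ha', hb', Set.indicator_of_notMem hx, inner_zero_left, Finset.sum_const_zero,
        sub_zero]
  rw [conv ζ hζ2 hζL]
  let φ : ℕ → ContDiffBump (0 : Euc n) := fun k =>
    ⟨(1 - ρ) / 4 / (k + 1), (1 - ρ) / 2 / (k + 1), by have := sub_pos.mpr hρ; positivity, by
      have := sub_pos.mpr hρ
      gcongr
      norm_num⟩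
  have hφ : Filter.Tendsto (fun k => (φ k).rOut) Filter.atTop (𝓝 0) := by
    have := (tendsto_one_div_add_atTop_nhds_zero_nat (𝕜 := ℝ)).const_mul ((1 - ρ) / 2)
    simpa [φ, div_eq_mul_inv] using this
  set f : ℕ → Euc n → ℝ := fun k => (φ k).normed volume with hf
  have hfC : ∀ k, ContDiff ℝ 1 (f k) := fun k => (φ k).contDiff_normed (n := 1)
  have hfs : ∀ k, HasCompactSupport (f k) := fun k => (φ k).hasCompactSupport_normed
  have hζk : ∀ k, ContDiff ℝ 1 (f k ⋆[ContinuousLinearMap.lsmul ℝ ℝ, volume] ζ) := fun k =>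
    (hfs k).contDiff_convolution_left (n := 1) _ (hfC k) hζ.continuous.locallyIntegrable
  have hts : ∀ k, tsupport (f k ⋆[ContinuousLinearMap.lsmul ℝ ℝ, volume] ζ) ⊆
      closedBall (0 : Euc n) ((1 + ρ) / 2) := by
    intro k
    refine closure_minimal ?_ isClosed_closedBall
    refine (support_convolution_subset _).trans ?_
    rintro _ ⟨y, hy, z, hz, rfl⟩
    rw [hf] at hy
    simp only [(φ k).support_normed_eq, mem_ball_zero_iff] at hy
    have hz' := hsub hz
    rw [mem_closedBall_zero_iff] at hz' ⊢
    have hr : (φ k).rOut ≤ (1 - ρ) / 2 := by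
      apply div_le_self
      · linarith
      · have : (0 : ℝ) ≤ k := Nat.cast_nonneg k
        linarith
    have := norm_add_le y z
    simp only
    linarith
  have hball : closedBall (0 : Euc n) ((1 + ρ) / 2) ⊆ ball 0 1 :=
    closedBall_subset_ball (by linarith)
  have hpd : ∀ k j, pd (f k ⋆[ContinuousLinearMap.lsmul ℝ ℝ, volume] ζ) j =
      (f k ⋆[ContinuousLinearMap.lsmul ℝ ℝ, volume] (pd ζ j)) := fun k j => by
    funext x
    exact pd_convolution (hfC k) (hfs k) hζ j ((hζ2 j).locallyIntegrable (by norm_num)) x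
  have hzero : ∀ k, (∑ j, ∫ x, inner ℝ (a' j x)
      ((f k ⋆[ContinuousLinearMap.lsmul ℝ ℝ, volume] (pd ζ j)) x)) -
      ∫ x, inner ℝ (b' x) ((f k ⋆[ContinuousLinearMap.lsmul ℝ ℝ, volume] ζ) x) = 0 := by
    intro k
    have h0 := h _ (hζk k) ((hts k).trans hball)
    have hcsk : HasCompactSupport (f k ⋆[ContinuousLinearMap.lsmul ℝ ℝ, volume] ζ) :=
      (isCompact_closedBall (0 : Euc n) ((1 + ρ) / 2)).of_isClosed_subset
        (isClosed_tsupport _) (hts k)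
    rw [conv _ ?_ ?_] at h0
    · simpa only [hpd] using h0
    · intro j
      have c1 : Continuous (pd (f k ⋆[ContinuousLinearMap.lsmul ℝ ℝ, volume] ζ) j) :=
        ((hζk k).continuous_fderiv one_ne_zero).clm_apply continuous_const
      refine c1.memLp_of_hasCompactSupport ?_
      exact (hcsk.fderiv_apply ℝ _)
    · exact (hζk k).continuous.memLp_of_hasCompactSupport hcsk
  have hlim : Filter.Tendsto (fun k => (∑ j, ∫ x, inner ℝ (a' j x)
      ((f k ⋆[ContinuousLinearMap.lsmul ℝ ℝ, volume] (pd ζ j)) x)) -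
      ∫ x, inner ℝ (b' x) ((f k ⋆[ContinuousLinearMap.lsmul ℝ ℝ, volume] ζ) x))
      Filter.atTop (𝓝 ((∑ j, ∫ x, inner ℝ (a' j x) (pd ζ j x)) - ∫ x, inner ℝ (b' x) (ζ x))) :=
    (tendsto_finsetSum _ fun j _ => tendsto_integral_inner_convolution (ha'L j) (hζ2 j) φ hφ).sub
      (tendsto_integral_inner_convolution hb'L hζL φ hφ)
  simp only [hzero] at hlim
  exact (tendsto_nhds_unique hlim tendsto_const_nhds)

/-- The radial deformation `x ↦ (1 + τ N(|x|²)) x`. -/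
def dil {n : ℕ} (N : ℝ → ℝ) (τ : ℝ) (x : Euc n) : Euc n := (1 + τ * N (‖x‖ ^ 2)) • x

/-- The tangential stretching factor of the radial deformation. -/
def tanFac {n : ℕ} (N : ℝ → ℝ) (τ : ℝ) (x : Euc n) : ℝ := 1 + τ * N (‖x‖ ^ 2)

/-- The radial stretching factor of the radial deformation. -/
def radFac {n : ℕ} (N : ℝ → ℝ) (τ : ℝ) (x : Euc n) : ℝ :=
  1 + τ * N (‖x‖ ^ 2) + 2 * τ * deriv N (‖x‖ ^ 2) * ‖x‖ ^ 2

/-- The differential of the radial deformation. -/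
def dilD {n : ℕ} (N : ℝ → ℝ) (τ : ℝ) (x : Euc n) : Euc n →L[ℝ] Euc n :=
  tanFac N τ x • ContinuousLinearMap.id ℝ (Euc n) +
    (2 * τ * deriv N (‖x‖ ^ 2)) • (innerSL ℝ x).smulRight x

/-- The inverse of the differential of the radial deformation. -/
def dilInv {n : ℕ} (N : ℝ → ℝ) (τ : ℝ) (x : Euc n) : Euc n →L[ℝ] Euc n :=
  (tanFac N τ x)⁻¹ • ContinuousLinearMap.id ℝ (Euc n) -
    (2 * τ * deriv N (‖x‖ ^ 2) / (tanFac N τ x * radFac N τ x)) • (innerSL ℝ x).smulRight x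

lemma hasFDerivAt_dil {n : ℕ} {N : ℝ → ℝ} (hN : ContDiff ℝ 1 N) (τ : ℝ) (x : Euc n) :
    HasFDerivAt (dil N τ) (dilD N τ x) x := by
  have h1 : HasFDerivAt (fun y : Euc n => ‖y‖ ^ 2) (2 • innerSL ℝ x) x :=
    (hasStrictFDerivAt_norm_sq x).hasFDerivAt
  have h2 : HasDerivAt N (deriv N (‖x‖ ^ 2)) (‖x‖ ^ 2) :=
    (hN.differentiable one_ne_zero _).hasDerivAt
  have h3 := ((h2.comp_hasFDerivAt x h1).const_mul τ).const_add 1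
  have h4 := h3.smul (hasFDerivAt_id x)
  refine h4.congr_fderiv ?_
  ext1 v
  simp only [dilD, tanFac, Function.comp_apply, add_apply,
    smul_apply, ContinuousLinearMap.id_apply, innerSL_apply_apply,
    ContinuousLinearMap.smulRight_apply, id_eq, smul_eq_mul, nsmul_eq_mul, smul_smul,
    Nat.cast_ofNat]
  congr 2
  ring

lemma det_dilD {n : ℕ} (hn : 1 ≤ n) (N : ℝ → ℝ) (τ : ℝ) (x : Euc n) (h : tanFac N τ x ≠ 0) :
    (dilD N τ x).det = tanFac N τ x ^ (n - 1) * radFac N τ x := by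
  have h1 : ((dilD N τ x : Euc n →L[ℝ] Euc n) : Euc n →ₗ[ℝ] Euc n) =
      tanFac N τ x • LinearMap.transvection ((innerSL ℝ x : Euc n →L[ℝ] ℝ) : Euc n →ₗ[ℝ] ℝ)
        ((2 * τ * deriv N (‖x‖ ^ 2) / tanFac N τ x) • x) := by
    ext1 v
    simp only [dilD, ContinuousLinearMap.coe_coe, add_apply,
      smul_apply, ContinuousLinearMap.id_apply, innerSL_apply_apply,
      ContinuousLinearMap.smulRight_apply, LinearMap.smul_apply, LinearMap.transvection.apply,
      smul_add, smul_smul]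
    congr 2
    field_simp
  rw [ContinuousLinearMap.det, h1, LinearMap.det_smul, LinearMap.transvection.det]
  obtain ⟨m, rfl⟩ : ∃ m, n = m + 1 := ⟨n - 1, by omega⟩
  have h2 : radFac N τ x = tanFac N τ x + 2 * τ * deriv N (‖x‖ ^ 2) * ‖x‖ ^ 2 := rfl
  simp only [ContinuousLinearMap.coe_coe, innerSL_apply_apply, inner_smul_right,
    real_inner_self_eq_norm_sq, finrank_euclideanSpace, Fintype.card_fin, h2,
    Nat.add_sub_cancel]
  field_simp
  ring

lemma dilD_dilInv {n : ℕ} (N : ℝ → ℝ) (τ : ℝ) (x : Euc n) (h : tanFac N τ x ≠ 0)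
    (h' : radFac N τ x ≠ 0) (v : Euc n) : dilD N τ x (dilInv N τ x v) = v := by
  have h2 : radFac N τ x = tanFac N τ x + 2 * τ * deriv N (‖x‖ ^ 2) * ‖x‖ ^ 2 := rfl
  simp only [dilD, dilInv, add_apply, _root_.sub_apply,
    smul_apply, ContinuousLinearMap.id_apply, innerSL_apply_apply,
    ContinuousLinearMap.smulRight_apply, smul_sub, smul_smul, inner_sub_right, inner_smul_right,
    real_inner_self_eq_norm_sq]
  rw [mul_inv_cancel₀ h, one_smul, sub_add, sub_eq_self, ← sub_smul]
  convert zero_smul ℝ x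
  have : 2 * τ * deriv N (‖x‖ ^ 2) * ‖x‖ ^ 2 = radFac N τ x - tanFac N τ x := by rw [h2]; ring
  field_simp
  linear_combination (-2 * inner ℝ x v * τ * deriv N (‖x‖ ^ 2)) * h2

lemma dilInv_dilD {n : ℕ} (N : ℝ → ℝ) (τ : ℝ) (x : Euc n) (h : tanFac N τ x ≠ 0)
    (h' : radFac N τ x ≠ 0) (v : Euc n) : dilInv N τ x (dilD N τ x v) = v := by
  have h2 : radFac N τ x = tanFac N τ x + 2 * τ * deriv N (‖x‖ ^ 2) * ‖x‖ ^ 2 := rfl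
  simp only [dilD, dilInv, add_apply, _root_.sub_apply,
    smul_apply, ContinuousLinearMap.id_apply, innerSL_apply_apply,
    ContinuousLinearMap.smulRight_apply, smul_add, smul_smul, inner_add_right, inner_smul_right,
    real_inner_self_eq_norm_sq]
  rw [inv_mul_cancel₀ h, one_smul, add_sub_assoc, add_eq_left, ← sub_smul]
  convert zero_smul ℝ x
  field_simp
  linear_combination (2 * inner ℝ x v * τ * deriv N (‖x‖ ^ 2)) * h2

lemma exists_dil_homeomorph (n : ℕ) {N : ℝ → ℝ} (hN : ContDiff ℝ 1 N) {ρ : ℝ}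
    (hN0 : ∀ v, ρ ^ 2 ≤ v → N v = 0) (hρ : 0 ≤ ρ) :
    ∃ τ₀ : ℝ, 0 < τ₀ ∧ ∀ τ : ℝ, 0 ≤ τ → τ ≤ τ₀ →
      ∃ h : Euc n ≃ₜ Euc n, ∀ x, h x = dil N τ x := by
  set X : Euc n → Euc n := fun x => N (‖x‖ ^ 2) • x with hX
  have hXC : ContDiff ℝ 1 X := (hN.comp (contDiff_norm_sq ℝ)).smul contDiff_id
  have hXs : HasCompactSupport X := by
    refine HasCompactSupport.of_support_subset_isCompact (isCompact_closedBall 0 ρ) ?_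
    intro x hx
    rw [mem_closedBall_zero_iff]
    by_contra hlt
    refine hx ?_
    simp only [hX, hN0 (‖x‖ ^ 2) (pow_le_pow_left₀ hρ (not_le.mp hlt).le 2), zero_smul]
  obtain ⟨K, hK⟩ := ContDiff.lipschitzWith_of_hasCompactSupport hXs hXC one_ne_zero
  refine ⟨1 / (2 * (K + 1)), by positivity, fun τ h0 hτ => ?_⟩
  have happ : ApproximatesLinearOn (dil N τ)
      ((ContinuousLinearEquiv.refl ℝ (Euc n) : Euc n ≃L[ℝ] Euc n) : Euc n →L[ℝ] Euc n)
      Set.univ (1 / 2 : NNReal) := by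
    rw [ApproximatesLinearOn.approximatesLinearOn_iff_lipschitzOnWith]
    have : (dil N τ - ⇑((ContinuousLinearEquiv.refl ℝ (Euc n) : Euc n ≃L[ℝ] Euc n) :
        Euc n →L[ℝ] Euc n)) = fun x => τ • X x := by
      funext x
      simp [dil, hX, add_smul, mul_smul]
    rw [this]
    refine LipschitzOnWith.of_dist_le_mul fun x _ y _ => ?_
    have h1 := hK.dist_le_mul x y
    have hτK : τ * K ≤ 1 / 2 := by
      have hK0 : (0 : ℝ) ≤ K := K.2
      calc τ * K ≤ 1 / (2 * (K + 1)) * (K + 1) := by gcongr; linarith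
        _ = 1 / 2 := by field_simp
    rw [dist_eq_norm, ← smul_sub, norm_smul, Real.norm_of_nonneg h0, ← dist_eq_norm]
    calc τ * dist (X x) (X y) ≤ τ * (K * dist x y) := by gcongr
      _ = (τ * K) * dist x y := by ring
      _ ≤ 1 / 2 * dist x y := by gcongr
      _ = _ := by norm_num
  have hc : Subsingleton (Euc n) ∨ (1 / 2 : NNReal) <
      ‖(((ContinuousLinearEquiv.refl ℝ (Euc n)).symm : Euc n ≃L[ℝ] Euc n) :
        Euc n →L[ℝ] Euc n)‖₊⁻¹ := by
    rcases subsingleton_or_nontrivial (Euc n) with h | h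
    · exact Or.inl h
    · right
      have : ‖(((ContinuousLinearEquiv.refl ℝ (Euc n)).symm : Euc n ≃L[ℝ] Euc n) :
        Euc n →L[ℝ] Euc n)‖₊ = 1 := by
        ext
        exact ContinuousLinearMap.norm_id
      rw [this, inv_one]
      exact NNReal.half_lt_self one_ne_zero
  exact ⟨happ.toHomeomorph _ hc, fun x => rfl⟩

lemma hasFDerivAt_dil_symm {n : ℕ} {N : ℝ → ℝ} (hN : ContDiff ℝ 1 N) {τ : ℝ}
    {h : Euc n ≃ₜ Euc n} (hh : ∀ x, h x = dil N τ x) (x : Euc n) (h1 : tanFac N τ x ≠ 0)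
    (h2 : radFac N τ x ≠ 0) : HasFDerivAt h.symm (dilInv N τ x) (h x) := by
  let e : Euc n ≃L[ℝ] Euc n := ContinuousLinearEquiv.equivOfInverse (dilD N τ x) (dilInv N τ x)
    (dilInv_dilD N τ x h1 h2) (dilD_dilInv N τ x h1 h2)
  have hd : HasFDerivAt h (e : Euc n →L[ℝ] Euc n) (h.symm (h x)) := by
    rw [h.symm_apply_apply]
    have : (h : Euc n → Euc n) = dil N τ := funext hh
    rw [this]
    exact hasFDerivAt_dil hN τ x
  exact hd.of_local_left_inverse h.symm.continuous.continuousAt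
    (Filter.Eventually.of_forall h.apply_symm_apply)

/-- A radial deformation that is the identity outside a ball preserves the larger balls. -/
lemma dil_image_ball {n : ℕ} {N : ℝ → ℝ} {ρ : ℝ} (hρ : 0 ≤ ρ) (hN0 : ∀ v, ρ ^ 2 ≤ v → N v = 0)
    {τ : ℝ} {h : Euc n ≃ₜ Euc n} (hh : ∀ x, h x = dil N τ x) {R : ℝ} (hR : ρ ≤ R) :
    h '' ball 0 R = ball 0 R := by
  have hfix : ∀ x : Euc n, ρ ≤ ‖x‖ → h x = x := fun x hx => by
    rw [hh, dil, hN0 _ (pow_le_pow_left₀ hρ hx 2)]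
    simp
  ext y
  constructor
  · rintro ⟨x, hx, rfl⟩
    by_contra hy
    rw [mem_ball_zero_iff, not_lt] at hy
    rw [h.injective (hfix _ (hR.trans hy))] at hy
    rw [mem_ball_zero_iff] at hx
    linarith
  · intro hy
    refine ⟨h.symm y, ?_, h.apply_symm_apply y⟩
    by_contra hx
    rw [mem_ball_zero_iff, not_lt] at hx
    have h1 := hfix _ (hR.trans hx)
    rw [h.apply_symm_apply] at h1
    rw [← h1] at hx
    rw [mem_ball_zero_iff] at hy
    linarith

/-- The bilinear form on `ℂⁿ` induced by a real matrix and the real inner product of `ℂ`. -/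
def bil {n : ℕ} (M : Matrix (Fin n) (Fin n) ℝ) (p q : Fin n → ℂ) : ℝ :=
  ∑ i, ∑ j, M i j * rdot (p i) (q j)

/-- The vector of partial derivatives. -/
def grad {n : ℕ} (u : Euc n → ℂ) (x : Euc n) : Fin n → ℂ := fun i => pd u i x

lemma abs_rdot_le (v w : ℂ) : |rdot v w| ≤ ‖v‖ * ‖w‖ := by
  rw [rdot_eq_inner]
  exact abs_real_inner_le_norm v w

lemma rdot_comm (v w : ℂ) : rdot v w = rdot w v := by
  simp only [rdot]
  ring

lemma abs_bil_le {n : ℕ} {M : Matrix (Fin n) (Fin n) ℝ} {δ : ℝ} (hM : ∀ i j, |M i j| ≤ δ)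
    (p q : Fin n → ℂ) :
    |bil M p q| ≤ n * δ * ((∑ i, ‖p i‖ ^ 2) + ∑ i, ‖q i‖ ^ 2) / 2 := by
  calc |bil M p q| ≤ ∑ i, ∑ j, |M i j * rdot (p i) (q j)| :=
        (Finset.abs_sum_le_sum_abs _ _).trans
          (Finset.sum_le_sum fun i _ => Finset.abs_sum_le_sum_abs _ _)
    _ ≤ ∑ i : Fin n, ∑ j : Fin n, δ * ((‖p i‖ ^ 2 + ‖q j‖ ^ 2) / 2) := by
        refine Finset.sum_le_sum fun i _ => Finset.sum_le_sum fun j _ => ?_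
        rw [abs_mul]
        have h0 : 0 ≤ δ := (abs_nonneg _).trans (hM i j)
        refine mul_le_mul (hM i j) ((abs_rdot_le _ _).trans ?_) (abs_nonneg _) h0
        nlinarith [sq_nonneg (‖p i‖ - ‖q j‖)]
    _ = n * δ * ((∑ i, ‖p i‖ ^ 2) + ∑ i, ‖q i‖ ^ 2) / 2 := by
        simp only [← Finset.mul_sum, ← Finset.sum_div, Finset.sum_add_distrib, Finset.sum_const,
          Finset.card_univ, Fintype.card_fin, nsmul_eq_mul]
        ring

lemma bil_add_right {n : ℕ} (M : Matrix (Fin n) (Fin n) ℝ) (p q r : Fin n → ℂ) :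
    bil M p (q + r) = bil M p q + bil M p r := by
  simp only [bil, ← Finset.sum_add_distrib, ← mul_add]
  refine Finset.sum_congr rfl fun i _ => Finset.sum_congr rfl fun j _ => ?_
  simp only [rdot_eq_inner, Pi.add_apply, inner_add_right]

lemma bil_comm {n : ℕ} {M : Matrix (Fin n) (Fin n) ℝ} (hM : M.IsSymm) (p q : Fin n → ℂ) :
    bil M p q = bil M q p := by
  rw [bil, Finset.sum_comm, bil]
  refine Finset.sum_congr rfl fun i _ => Finset.sum_congr rfl fun j _ => ?_
  rw [hM.apply, rdot_comm]

lemma bil_smul_right {n : ℕ} (M : Matrix (Fin n) (Fin n) ℝ) (c : ℝ) (p q : Fin n → ℂ) :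
    bil M p (c • q) = c * bil M p q := by
  simp only [bil, Finset.mul_sum]
  refine Finset.sum_congr rfl fun i _ => Finset.sum_congr rfl fun j _ => ?_
  simp only [rdot_eq_inner, Pi.smul_apply, inner_smul_right]
  ring

lemma bil_eq_sum_rdot {n : ℕ} (M : Matrix (Fin n) (Fin n) ℝ) (p q : Fin n → ℂ) :
    bil M p q = ∑ j, rdot (∑ i, M i j • p i) (q j) := by
  rw [bil, Finset.sum_comm]
  refine Finset.sum_congr rfl fun j _ => ?_
  simp only [rdot_eq_inner, sum_inner, inner_smul_left]
  simp

/-- Symmetric, uniformly elliptic, Lipschitz coefficients with a Lipschitz weight on the unit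
ball. -/
structure EllipticCoeff (n : ℕ) (A : Euc n → Matrix (Fin n) (Fin n) ℝ) (w : Euc n → ℝ)
    (c L : ℝ) : Prop where
  c_pos : 0 < c
  L_nonneg : 0 ≤ L
  symm : ∀ x ∈ ball (0 : Euc n) 1, (A x).IsSymm
  lower : ∀ x ∈ ball (0 : Euc n) 1, ∀ p : Fin n → ℂ, c * ∑ i, ‖p i‖ ^ 2 ≤ bil (A x) p p
  entry : ∀ x ∈ ball (0 : Euc n) 1, ∀ i j, |A x i j| ≤ c⁻¹
  w_lower : ∀ x ∈ ball (0 : Euc n) 1, c ≤ w x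
  w_upper : ∀ x ∈ ball (0 : Euc n) 1, w x ≤ c⁻¹
  lip : ∀ x ∈ ball (0 : Euc n) 1, ∀ y ∈ ball (0 : Euc n) 1, ∀ i j,
    |A x i j - A y i j| ≤ L * ‖x - y‖
  w_lip : ∀ x ∈ ball (0 : Euc n) 1, ∀ y ∈ ball (0 : Euc n) 1, |w x - w y| ≤ L * ‖x - y‖

/-- The Ginzburg–Landau potential. -/
def potential (ε : ℝ) (z : ℂ) : ℝ := (1 - ‖z‖ ^ 2) ^ 2 / (4 * ε ^ 2)

/-- The energy density with respect to the coefficients `A` and the weight `w`. -/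
def density {n : ℕ} (A : Euc n → Matrix (Fin n) (Fin n) ℝ) (w : Euc n → ℝ) (ε : ℝ)
    (u : Euc n → ℂ) (x : Euc n) : ℝ :=
  bil (A x) (grad u x) (grad u x) / 2 + w x * potential ε (u x)

lemma potential_nonneg (ε : ℝ) (z : ℂ) : 0 ≤ potential ε z := by
  unfold potential
  positivity

lemma potential_le {ε : ℝ} {z : ℂ} (hz : ‖z‖ ≤ 1) : potential ε z ≤ 1 / (4 * ε ^ 2) := by
  unfold potential
  gcongr
  have h1 : ‖z‖ ^ 2 ≤ 1 := pow_le_one₀ (norm_nonneg _) hz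
  have h0 : 0 ≤ ‖z‖ ^ 2 := by positivity
  nlinarith

lemma potential_sub_ge {ε : ℝ} {z ζ : ℂ} (hz : ‖z‖ ≤ 1) :
    -((1 - ‖z‖ ^ 2) / ε ^ 2 * rdot z ζ) - ‖ζ‖ ^ 2 / (2 * ε ^ 2) ≤
      potential ε (z + ζ) - potential ε z := by
  have h1 : ‖z‖ ^ 2 ≤ 1 := pow_le_one₀ (norm_nonneg _) hz
  have h2 : ‖z + ζ‖ ^ 2 = ‖z‖ ^ 2 + 2 * rdot z ζ + ‖ζ‖ ^ 2 := by
    rw [rdot_eq_inner, norm_add_sq_real]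
  unfold potential
  rw [h2]
  have e1 : -((1 - ‖z‖ ^ 2) / ε ^ 2 * rdot z ζ) - ‖ζ‖ ^ 2 / (2 * ε ^ 2) =
      (-4 * (1 - ‖z‖ ^ 2) * rdot z ζ - 2 * ‖ζ‖ ^ 2) / (4 * ε ^ 2) := by
    by_cases hε : ε = 0
    · simp [hε]
    · field_simp
      ring
  rw [e1, ← sub_div]
  refine div_le_div_of_nonneg_right ?_ (by positivity)
  nlinarith [sq_nonneg (2 * rdot z ζ + ‖ζ‖ ^ 2), sq_nonneg ‖ζ‖, sq_nonneg ‖z‖,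
    mul_nonneg (sq_nonneg ‖z‖) (sq_nonneg ‖ζ‖)]

namespace EllipticCoeff

variable {n : ℕ} {A : Euc n → Matrix (Fin n) (Fin n) ℝ} {w : Euc n → ℝ} {c L : ℝ}

lemma bil_nonneg (H : EllipticCoeff n A w c L) {x : Euc n} (hx : x ∈ ball (0 : Euc n) 1)
    (p : Fin n → ℂ) : 0 ≤ bil (A x) p p :=
  (mul_nonneg H.c_pos.le (Finset.sum_nonneg fun _ _ => sq_nonneg _)).trans (H.lower x hx p)

lemma w_pos (H : EllipticCoeff n A w c L) {x : Euc n} (hx : x ∈ ball (0 : Euc n) 1) : 0 < w x :=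
  H.c_pos.trans_le (H.w_lower x hx)

lemma density_nonneg (H : EllipticCoeff n A w c L) {x : Euc n} (hx : x ∈ ball (0 : Euc n) 1)
    (ε : ℝ) (u : Euc n → ℂ) : 0 ≤ density A w ε u x :=
  add_nonneg (div_nonneg (H.bil_nonneg hx _) two_pos.le)
    (mul_nonneg (H.w_pos hx).le (potential_nonneg _ _))

/-- The quadratic forms at nearby points are comparable. -/
lemma bil_le_mul (H : EllipticCoeff n A w c L) {x y : Euc n} (hx : x ∈ ball (0 : Euc n) 1)
    (hy : y ∈ ball (0 : Euc n) 1) (p : Fin n → ℂ) :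
    bil (A y) p p ≤ (1 + n * L / c * ‖y - x‖) * bil (A x) p p := by
  have h1 := abs_bil_le (M := A y - A x) (δ := L * ‖y - x‖)
    (fun i j => by simpa using H.lip y hy x hx i j) p p
  have h2 : bil (A y - A x) p p = bil (A y) p p - bil (A x) p p := by
    simp only [bil, ← Finset.sum_sub_distrib, Matrix.sub_apply, sub_mul]
  have h3 := H.lower x hx p
  have hc := H.c_pos
  have h4 : ∑ i, ‖p i‖ ^ 2 ≤ bil (A x) p p / c := by
    rw [le_div_iff₀ hc]
    linarith
  have h5 := (le_abs_self _).trans h1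
  rw [h2] at h5
  have hL := H.L_nonneg
  have h6 : n * (L * ‖y - x‖) * ∑ i, ‖p i‖ ^ 2 ≤ n * (L * ‖y - x‖) * (bil (A x) p p / c) := by
    gcongr
  have h7 : (1 + n * L / c * ‖y - x‖) * bil (A x) p p =
      bil (A x) p p + n * (L * ‖y - x‖) * (bil (A x) p p / c) := by
    field_simp
  rw [h7]
  linarith

lemma w_le_mul (H : EllipticCoeff n A w c L) (hn : 1 ≤ n) {x y : Euc n}
    (hx : x ∈ ball (0 : Euc n) 1) (hy : y ∈ ball (0 : Euc n) 1) :
    w y ≤ (1 + n * L / c * ‖y - x‖) * w x := by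
  have h1 := (le_abs_self _).trans (H.w_lip y hy x hx)
  have hc := H.c_pos
  have hL := H.L_nonneg
  have hw := H.w_lower x hx
  have hn' : (1 : ℝ) ≤ n := by exact_mod_cast hn
  have h2 : L * ‖y - x‖ ≤ n * L / c * ‖y - x‖ * w x := by
    calc L * ‖y - x‖ = 1 * L / c * ‖y - x‖ * c := by field_simp
      _ ≤ n * L / c * ‖y - x‖ * w x := by gcongr
  linarith

lemma continuousOn_entry (H : EllipticCoeff n A w c L) (i j : Fin n) :
    ContinuousOn (fun x => A x i j) (ball (0 : Euc n) 1) := by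
  refine LipschitzOnWith.continuousOn (K := ⟨L, H.L_nonneg⟩) ?_
  exact LipschitzOnWith.of_dist_le_mul fun x hx y hy => by
    rw [Real.dist_eq, dist_eq_norm]
    exact H.lip x hx y hy i j

lemma continuousOn_w (H : EllipticCoeff n A w c L) : ContinuousOn w (ball (0 : Euc n) 1) := by
  refine LipschitzOnWith.continuousOn (K := ⟨L, H.L_nonneg⟩) ?_
  exact LipschitzOnWith.of_dist_le_mul fun x hx y hy => by
    rw [Real.dist_eq, dist_eq_norm]
    exact H.w_lip x hx y hy

/-- Multiplying an integrable function by a bounded continuous weight. -/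
lemma _root_.MeasureTheory.IntegrableOn.continuousOn_bdd_mul {E : Type*} [TopologicalSpace E]
    [MeasurableSpace E] [OpensMeasurableSpace E] {μ : Measure E} {s : Set E}
    (hs : MeasurableSet s) {f m : E → ℝ} {C : ℝ} (hf : IntegrableOn f s μ)
    (hm : ContinuousOn m s) (hC : ∀ x ∈ s, |m x| ≤ C) :
    IntegrableOn (fun x => m x * f x) s μ :=
  Integrable.bdd_mul (c := C) hf (hm.aestronglyMeasurable hs)
    ((ae_restrict_iff' hs).mpr (Filter.Eventually.of_forall fun x hx => hC x hx))

lemma integrableOn_bil (H : EllipticCoeff n A w c L) {p q : Fin n → Euc n → ℂ}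
    (hp : ∀ i, MemLp (p i) 2 (volume.restrict (ball (0 : Euc n) 1)))
    (hq : ∀ i, MemLp (q i) 2 (volume.restrict (ball (0 : Euc n) 1))) :
    IntegrableOn (fun x => bil (A x) (fun i => p i x) (fun i => q i x))
      (ball (0 : Euc n) 1) := by
  refine integrable_finsetSum _ fun i _ => integrable_finsetSum _ fun j _ => ?_
  refine IntegrableOn.continuousOn_bdd_mul measurableSet_ball ?_ (H.continuousOn_entry i j)
    fun x hx => H.entry x hx i j
  simp only [rdot_eq_inner]
  exact (hp i).integrable_inner_two (hq j)

lemma integrableOn_w_mul (H : EllipticCoeff n A w c L) {f : Euc n → ℝ}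
    (hf : IntegrableOn f (ball (0 : Euc n) 1)) :
    IntegrableOn (fun x => w x * f x) (ball (0 : Euc n) 1) :=
  hf.continuousOn_bdd_mul measurableSet_ball H.continuousOn_w fun x hx => by
    rw [abs_of_pos (H.w_pos hx)]
    exact H.w_upper x hx

lemma integrableOn_density (H : EllipticCoeff n A w c L) (ε : ℝ) {u : Euc n → ℂ}
    (hu : ContinuousOn u (ball (0 : Euc n) 1)) (hu1 : ∀ x ∈ ball (0 : Euc n) 1, ‖u x‖ ≤ 1)
    (hu2 : ∀ i, MemLp (pd u i) 2 (volume.restrict (ball (0 : Euc n) 1))) :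
    IntegrableOn (density A w ε u) (ball (0 : Euc n) 1) := by
  have hc : ContinuousOn (fun x => potential ε (u x)) (ball (0 : Euc n) 1) := by
    unfold potential
    fun_prop
  refine ((H.integrableOn_bil hu2 hu2).div_const 2).add (H.integrableOn_w_mul ?_)
  refine IntegrableOn.of_bound (C := 1 / (4 * ε ^ 2)) measure_ball_lt_top
    (hc.aestronglyMeasurable measurableSet_ball) ?_
  refine (ae_restrict_iff' measurableSet_ball).mpr (Filter.Eventually.of_forall fun x hx => ?_)
  rw [Real.norm_of_nonneg (potential_nonneg _ _)]
  exact potential_le (hu1 x hx)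

end EllipticCoeff

/-- Solutions of the Ginzburg–Landau equation with coefficients `A` and weight `w` in the unit
ball. -/
structure WeakSol (n : ℕ) (A : Euc n → Matrix (Fin n) (Fin n) ℝ) (w : Euc n → ℝ) (ε : ℝ)
    (u : Euc n → ℂ) : Prop where
  diff : DifferentiableOn ℝ u (ball 0 1)
  le_one : ∀ x ∈ ball (0 : Euc n) 1, ‖u x‖ ≤ 1
  memLp : ∀ i, MemLp (pd u i) 2 (volume.restrict (ball 0 1))
  weak : ∀ ζ : Euc n → ℂ, ContDiff ℝ 1 ζ → tsupport ζ ⊆ ball 0 1 →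
    ∫ x in ball 0 1, (bil (A x) (grad u x) (grad ζ x)
      - w x * ((1 - ‖u x‖ ^ 2) / ε ^ 2 * rdot (u x) (ζ x))) = 0

lemma bil_add_self {n : ℕ} {M : Matrix (Fin n) (Fin n) ℝ} (hM : M.IsSymm) (p q : Fin n → ℂ) :
    bil M (p + q) (p + q) = bil M p p + 2 * bil M p q + bil M q q := by
  rw [bil_add_right, bil_comm hM, bil_add_right, bil_comm hM (p + q) q, bil_add_right,
    bil_comm hM q p]
  ring

namespace WeakSol

variable {n : ℕ} {A : Euc n → Matrix (Fin n) (Fin n) ℝ} {w : Euc n → ℝ} {c L ε : ℝ}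
  {u : Euc n → ℂ}

/-- The weak equation tested with a differentiable compactly supported function. -/
lemma weak_of_differentiable (H : EllipticCoeff n A w c L) (hu : WeakSol n A w ε u)
    {ζ : Euc n → ℂ} (hζ : Differentiable ℝ ζ) {ρ : ℝ} (hρ : ρ < 1)
    (hsupp : ∀ x, ρ ≤ ‖x‖ → ζ x = 0) (hζ2 : ∀ j, MemLp (pd ζ j) 2 volume) :
    ∫ x in ball 0 1, (bil (A x) (grad u x) (grad ζ x)
      - w x * ((1 - ‖u x‖ ^ 2) / ε ^ 2 * rdot (u x) (ζ x))) = 0 := by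
  have key : ∀ (ζ : Euc n → ℂ) (x : Euc n),
      bil (A x) (grad u x) (grad ζ x) - w x * ((1 - ‖u x‖ ^ 2) / ε ^ 2 * rdot (u x) (ζ x)) =
      (∑ j, rdot (∑ i, A x i j • pd u i x) (pd ζ j x)) -
        rdot ((w x * ((1 - ‖u x‖ ^ 2) / ε ^ 2)) • u x) (ζ x) := by
    intro ζ x
    rw [bil_eq_sum_rdot]
    simp only [rdot_eq_inner, inner_smul_left, grad]
    simp
    ring
  simp only [key]
  refine weak_form_of_differentiable (a := fun j x => ∑ i, A x i j • pd u i x)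
    (b := fun x => (w x * ((1 - ‖u x‖ ^ 2) / ε ^ 2)) • u x) ?_ ?_ ?_ hζ hρ hsupp hζ2
  · intro j
    refine memLp_finsetSum _ fun i _ => ?_
    refine (hu.memLp i).of_le_mul (c := c⁻¹)
      (((H.continuousOn_entry i j).aestronglyMeasurable measurableSet_ball).smul
        (hu.memLp i).1) ?_
    refine (ae_restrict_iff' measurableSet_ball).mpr (Filter.Eventually.of_forall fun x hx => ?_)
    rw [norm_smul]
    exact mul_le_mul_of_nonneg_right (H.entry x hx i j) (norm_nonneg _)
  · have hc : ContinuousOn (fun x => (w x * ((1 - ‖u x‖ ^ 2) / ε ^ 2)) • u x)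
        (ball (0 : Euc n) 1) := by
      have h1 := hu.diff.continuousOn
      have h2 := H.continuousOn_w
      fun_prop
    have : IsFiniteMeasure (volume.restrict (ball (0 : Euc n) 1)) :=
      ⟨by simpa using measure_ball_lt_top⟩
    refine MemLp.of_bound (hc.aestronglyMeasurable measurableSet_ball) (c⁻¹ * (1 / ε ^ 2)) ?_
    refine (ae_restrict_iff' measurableSet_ball).mpr (Filter.Eventually.of_forall fun x hx => ?_)
    have h1 := hu.le_one x hx
    have h2 : ‖u x‖ ^ 2 ≤ 1 := pow_le_one₀ (norm_nonneg _) h1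
    have h3 := H.w_pos hx
    have h4 := H.w_upper x hx
    rw [norm_smul, norm_mul, norm_div, Real.norm_of_nonneg h3.le,
      Real.norm_of_nonneg (sub_nonneg.mpr h2), Real.norm_of_nonneg (sq_nonneg ε)]
    have h5 : (1 - ‖u x‖ ^ 2) / ε ^ 2 ≤ 1 / ε ^ 2 := by
      refine div_le_div_of_nonneg_right ?_ (sq_nonneg _)
      linarith [sq_nonneg ‖u x‖]
    have h6 : 0 ≤ (1 - ‖u x‖ ^ 2) / ε ^ 2 := div_nonneg (sub_nonneg.mpr h2) (sq_nonneg _)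
    calc w x * ((1 - ‖u x‖ ^ 2) / ε ^ 2) * ‖u x‖ ≤ w x * ((1 - ‖u x‖ ^ 2) / ε ^ 2) * 1 := by
          gcongr
      _ ≤ c⁻¹ * (1 / ε ^ 2) := by
          rw [mul_one]
          gcongr
          exact h3.le.trans h4
  · intro ζ h1 h2
    have := hu.weak ζ h1 h2
    simpa only [key] using this

/-- A solution minimizes the energy, up to a quadratic error, among maps with the same boundary
values. -/
lemma energy_le (H : EllipticCoeff n A w c L) (hu : WeakSol n A w ε u) {v : Euc n → ℂ}
    (hv : DifferentiableOn ℝ v (ball 0 1)) (hv1 : ∀ x ∈ ball (0 : Euc n) 1, ‖v x‖ ≤ 1)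
    (hv2 : ∀ i, MemLp (pd v i) 2 (volume.restrict (ball 0 1)))
    {ρ : ℝ} (hρ : ρ < 1) (huv : ∀ x, ρ ≤ ‖x‖ → v x = u x) :
    (∫ x in ball 0 1, density A w ε u x) - 1 / (2 * ε ^ 2) * ∫ x in ball 0 1, w x * ‖v x - u x‖ ^ 2
      ≤ ∫ x in ball 0 1, density A w ε v x := by
  have hB : ∀ x ∈ ball (0 : Euc n) 1, ball (0 : Euc n) 1 ∈ 𝓝 x := fun x hx =>
    isOpen_ball.mem_nhds hx
  set ζ : Euc n → ℂ := fun x => v x - u x with hζdef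
  have hz0 : ∀ x, ρ < ‖x‖ → ζ =ᶠ[𝓝 x] 0 := by
    intro x hx
    filter_upwards [continuous_norm.continuousAt.eventually (lt_mem_nhds hx)] with y hy
    simp [hζdef, huv y hy.le]
  have hpd : ∀ x ∈ ball (0 : Euc n) 1, ∀ i, pd ζ i x = pd v i x - pd u i x := by
    intro x hx i
    simp only [pd, hζdef]
    rw [fderiv_fun_sub ((hv x hx).differentiableAt (hB x hx))
      ((hu.diff x hx).differentiableAt (hB x hx))]
    rfl
  have hζd : Differentiable ℝ ζ := by
    intro x
    rcases lt_or_ge ρ ‖x‖ with h | h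
    · exact (hz0 x h).differentiableAt_iff.mpr (differentiableAt_const _)
    · have hx : x ∈ ball (0 : Euc n) 1 := by simpa using h.trans_lt hρ
      exact ((hv x hx).differentiableAt (hB x hx)).sub ((hu.diff x hx).differentiableAt (hB x hx))
  have hζ2 : ∀ j, MemLp (pd ζ j) 2 volume := by
    intro j
    have : pd ζ j = (ball (0 : Euc n) 1).indicator (fun x => pd v j x - pd u j x) := by
      funext x
      by_cases hx : x ∈ ball (0 : Euc n) 1
      · rw [Set.indicator_of_mem hx, hpd x hx]
      · rw [Set.indicator_of_notMem hx]
        have h1 : ρ < ‖x‖ := hρ.trans_le (by simpa using hx)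
        rw [pd, (hz0 x h1).fderiv_eq]
        simp
    rw [this, memLp_indicator_iff_restrict measurableSet_ball]
    exact (hv2 j).sub (hu.memLp j)
  have hweak := hu.weak_of_differentiable H hζd hρ
    (fun x hx => by simp [hζdef, huv x hx]) hζ2
  have hcu := hu.diff.continuousOn
  have hcv := hv.continuousOn
  have i1 := H.integrableOn_density ε hcu hu.le_one hu.memLp
  have i2 := H.integrableOn_density ε hcv hv1 hv2
  have hζ1 : ∀ x ∈ ball (0 : Euc n) 1, ‖ζ x‖ ≤ 2 := fun x hx =>
    (norm_sub_le _ _).trans (by linarith [hv1 x hx, hu.le_one x hx])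
  have hζc : ContinuousOn ζ (ball (0 : Euc n) 1) := hζd.continuous.continuousOn
  have i3 : IntegrableOn (fun x => w x * ‖ζ x‖ ^ 2) (ball (0 : Euc n) 1) := by
    refine H.integrableOn_w_mul (IntegrableOn.of_bound (C := 2 ^ 2) measure_ball_lt_top
      ((hζc.norm.pow 2).aestronglyMeasurable measurableSet_ball) ?_)
    refine (ae_restrict_iff' measurableSet_ball).mpr (Filter.Eventually.of_forall fun x hx => ?_)
    rw [norm_pow, norm_norm]
    exact pow_le_pow_left₀ (norm_nonneg _) (hζ1 x hx) 2
  have i4 : IntegrableOn (fun x => bil (A x) (grad u x) (grad ζ x)) (ball (0 : Euc n) 1) :=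
    H.integrableOn_bil hu.memLp fun j => (hζ2 j).restrict _
  have i5 : IntegrableOn (fun x => w x * ((1 - ‖u x‖ ^ 2) / ε ^ 2 * rdot (u x) (ζ x)))
      (ball (0 : Euc n) 1) := by
    refine H.integrableOn_w_mul (IntegrableOn.of_bound (C := 1 / ε ^ 2 * 2) measure_ball_lt_top
      (ContinuousOn.aestronglyMeasurable ?_ measurableSet_ball) ?_)
    · simp only [rdot_eq_inner]
      fun_prop
    refine (ae_restrict_iff' measurableSet_ball).mpr (Filter.Eventually.of_forall fun x hx => ?_)
    have h1 := hu.le_one x hx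
    have h2 : ‖u x‖ ^ 2 ≤ 1 := pow_le_one₀ (norm_nonneg _) h1
    rw [norm_mul, norm_div, Real.norm_of_nonneg (sub_nonneg.mpr h2),
      Real.norm_of_nonneg (sq_nonneg ε)]
    refine mul_le_mul ?_ ?_ (norm_nonneg _) (by positivity)
    · refine div_le_div_of_nonneg_right ?_ (sq_nonneg _)
      linarith [sq_nonneg ‖u x‖]
    · refine (abs_rdot_le _ _).trans ?_
      nlinarith [hζ1 x hx, norm_nonneg (u x), norm_nonneg (ζ x)]
  have hpt : ∀ x ∈ ball (0 : Euc n) 1,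
      density A w ε u x + ((bil (A x) (grad u x) (grad ζ x)
        - w x * ((1 - ‖u x‖ ^ 2) / ε ^ 2 * rdot (u x) (ζ x))) -
        1 / (2 * ε ^ 2) * (w x * ‖ζ x‖ ^ 2)) ≤ density A w ε v x := by
    intro x hx
    have hg : grad v x = grad u x + grad ζ x := by
      funext i
      simp [grad, hpd x hx]
    have hvx : v x = u x + ζ x := by simp [hζdef]
    have h1 := mul_le_mul_of_nonneg_left (potential_sub_ge (ε := ε) (ζ := ζ x) (hu.le_one x hx))
      (H.w_pos hx).le
    have h2 := H.bil_nonneg hx (grad ζ x)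
    rw [density, density, hg, bil_add_self (H.symm x hx), hvx]
    have h3 : w x * (‖ζ x‖ ^ 2 / (2 * ε ^ 2)) = 1 / (2 * ε ^ 2) * (w x * ‖ζ x‖ ^ 2) := by ring
    linarith
  have hint := setIntegral_mono_on (i1.add ((i4.sub i5).sub (i3.const_mul (1 / (2 * ε ^ 2))))) i2
    measurableSet_ball hpt
  have e1 := integral_add i1 ((i4.sub i5).sub (i3.const_mul (1 / (2 * ε ^ 2))))
  have e2 := integral_sub (i4.sub i5) (i3.const_mul (1 / (2 * ε ^ 2)))
  simp only [Pi.add_apply, Pi.sub_apply] at hint e1 e2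
  rw [e1, e2, hweak, integral_const_mul] at hint
  linarith

end WeakSol

/-- A form of the fundamental theorem of calculus without integrability assumptions. -/
lemma enorm_sub_le_lintegral_of_hasDerivAt {E : Type*} [NormedAddCommGroup E] [NormedSpace ℝ E]
    [CompleteSpace E] {f f' : ℝ → E} {τ : ℝ} (hτ : 0 ≤ τ)
    (hf : ∀ s ∈ Set.Icc 0 τ, HasDerivAt f (f' s) s)
    (hm : AEStronglyMeasurable f' (volume.restrict (Set.Ioc 0 τ))) :
    ‖f τ - f 0‖ₑ ≤ ∫⁻ s in Set.Ioc 0 τ, ‖f' s‖ₑ := by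
  by_cases h : ∫⁻ s in Set.Ioc 0 τ, ‖f' s‖ₑ = ⊤
  · rw [h]
    exact le_top
  · have hi : IntervalIntegrable f' volume 0 τ := by
      rw [intervalIntegrable_iff_integrableOn_Ioc_of_le hτ]
      exact ⟨hm, lt_top_iff_ne_top.mpr h⟩
    rw [← intervalIntegral.integral_eq_sub_of_hasDerivAt
      (fun s hs => hf s (by rwa [Set.uIcc_of_le hτ] at hs)) hi,
      intervalIntegral.integral_of_le hτ]
    exact enorm_integral_le_lintegral_enorm _

lemma lintegral_sq_le {α : Type*} [MeasurableSpace α] {μ : Measure α} {f : α → ENNReal}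
    (hf : AEMeasurable f μ) : (∫⁻ a, f a ∂μ) ^ 2 ≤ μ Set.univ * ∫⁻ a, f a ^ 2 ∂μ := by
  have h := ENNReal.lintegral_mul_le_Lp_mul_Lq μ Real.HolderConjugate.two_two
    (aemeasurable_const (b := (1 : ENNReal))) hf
  simp only [Pi.mul_apply, one_mul, ENNReal.one_rpow, lintegral_const] at h
  have h2 := pow_le_pow_left₀ (zero_le) h 2
  rw [mul_pow, ← ENNReal.rpow_natCast, ← ENNReal.rpow_natCast, ← ENNReal.rpow_natCast,
    ← ENNReal.rpow_mul, ← ENNReal.rpow_mul] at h2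
  norm_num at h2
  simpa using h2

/-- A jacobian close to that of the identity is close to one. -/
lemma jacobian_bounds {n : ℕ} (hn : 1 ≤ n) {a b : ℝ} (ha : |a - 1| ≤ 1 / (2 * n))
    (hb : |b - 1| ≤ 1 / (2 * n)) :
    1 / 2 ≤ a ^ (n - 1) * b ∧ a ^ (n - 1) * b ≤ 2 := by
  have hn' : (1 : ℝ) ≤ n := by exact_mod_cast hn
  set δ : ℝ := 1 / (2 * n) with hδ
  have hδ0 : 0 < δ := by positivity
  have hδ1 : δ ≤ 1 / 2 := by
    rw [hδ]
    gcongr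
    linarith
  have hnδ : n * δ = 1 / 2 := by
    rw [hδ]
    field_simp
  rw [abs_le] at ha hb
  have ha0 : 0 ≤ a := by linarith
  have hb0 : 0 ≤ b := by linarith
  have hpow : ∀ z : ℝ, z ^ n = z ^ (n - 1) * z := fun z => by
    rw [← pow_succ, Nat.sub_add_cancel hn]
  constructor
  · have h1 : (1 - δ) ^ n ≤ a ^ (n - 1) * b := by
      rw [hpow]
      have : 0 ≤ 1 - δ := by linarith
      gcongr <;> linarith
    have h2 := one_add_mul_le_pow (a := -δ) (by linarith) n
    have h3 : (1 + -δ) ^ n = (1 - δ) ^ n := by ring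
    linarith [h3 ▸ h2]
  · have h1 : a ^ (n - 1) * b ≤ (1 + δ) ^ n := by
      rw [hpow]
      gcongr <;> linarith
    have h2 : (1 + δ) ^ n ≤ Real.exp δ ^ n := by
      gcongr
      linarith [Real.add_one_le_exp δ]
    rw [← Real.exp_nat_mul, hnδ] at h2
    have h3 : Real.exp (1 / 2) ≤ 2 := by
      have h4 : Real.exp (1 / 2) ^ 2 = Real.exp 1 := by
        rw [← Real.exp_nat_mul]
        norm_num
      nlinarith [Real.exp_one_lt_d9, Real.exp_pos (1 / 2)]
    linarith

lemma exists_profile_bound {N : ℝ → ℝ} (hN : ContDiff ℝ 1 N) :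
    ∃ K : ℝ, 1 ≤ K ∧ ∀ v ∈ Set.Icc (0 : ℝ) 1, |N v| ≤ K ∧ |deriv N v| ≤ K := by
  obtain ⟨a, ha⟩ := isCompact_Icc.exists_bound_of_continuousOn (s := Set.Icc (0 : ℝ) 1)
    hN.continuous.continuousOn
  obtain ⟨b, hb⟩ := isCompact_Icc.exists_bound_of_continuousOn (s := Set.Icc (0 : ℝ) 1)
    (hN.continuous_deriv_one).continuousOn
  refine ⟨max 1 (max a b), le_max_left _ _, fun v hv => ⟨?_, ?_⟩⟩
  · exact (ha v hv).trans ((le_max_left _ _).trans (le_max_right _ _))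
  · exact (hb v hv).trans ((le_max_right _ _).trans (le_max_right _ _))

/-- The data of a small radial deformation of the unit ball. -/
structure SmallDil (n : ℕ) (N : ℝ → ℝ) (τ : ℝ) (h : Euc n ≃ₜ Euc n) : Prop where
  eq_dil : ∀ x, h x = dil N τ x
  image_ball : h '' ball 0 1 = ball 0 1
  tan : ∀ x ∈ ball (0 : Euc n) 1, |tanFac N τ x - 1| ≤ 1 / (2 * n)
  rad : ∀ x ∈ ball (0 : Euc n) 1, |radFac N τ x - 1| ≤ 1 / (2 * n)

lemma exists_smallDil {n : ℕ} (hn : 1 ≤ n) {N : ℝ → ℝ} (hN : ContDiff ℝ 1 N) {ρ : ℝ}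
    (hN0 : ∀ v, ρ ^ 2 ≤ v → N v = 0) (hρ : 0 ≤ ρ) (hρ1 : ρ ≤ 1) :
    ∃ τ₀ : ℝ, 0 < τ₀ ∧ ∀ τ : ℝ, 0 ≤ τ → τ ≤ τ₀ → ∃ h, SmallDil n N τ h := by
  obtain ⟨K, hK1, hK⟩ := exists_profile_bound hN
  obtain ⟨τ₁, hτ₁, hh⟩ := exists_dil_homeomorph n hN hN0 hρ
  have hn' : (1 : ℝ) ≤ n := by exact_mod_cast hn
  refine ⟨min τ₁ (1 / (6 * n * K)), by positivity, fun τ h0 hτ => ?_⟩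
  obtain ⟨h, hh⟩ := hh τ h0 (hτ.trans (min_le_left _ _))
  have hτK : 3 * (τ * K) ≤ 1 / (2 * n) := by
    have h1 : τ * K ≤ 1 / (6 * n * K) * K := by
      gcongr
      exact hτ.trans (min_le_right _ _)
    have h2 : 3 * (1 / (6 * n * K) * K) = 1 / (2 * n) := by
      field_simp
      norm_num
    linarith
  have hv : ∀ x ∈ ball (0 : Euc n) 1, ‖x‖ ^ 2 ∈ Set.Icc (0 : ℝ) 1 := fun x hx =>
    ⟨by positivity, pow_le_one₀ (norm_nonneg _) (mem_ball_zero_iff.mp hx).le⟩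
  have hKτ : 0 ≤ τ * K := by positivity
  refine ⟨h, hh, dil_image_ball hρ hN0 hh hρ1, fun x hx => ?_, fun x hx => ?_⟩
  · have h1 := (hK _ (hv x hx)).1
    rw [tanFac, add_sub_cancel_left, abs_mul, abs_of_nonneg h0]
    nlinarith
  · have h1 := (hK _ (hv x hx)).1
    have h2 := (hK _ (hv x hx)).2
    have h3 : radFac N τ x - 1 = τ * N (‖x‖ ^ 2) + 2 * (τ * deriv N (‖x‖ ^ 2)) * ‖x‖ ^ 2 := by
      rw [radFac]
      ring
    rw [h3]
    refine (abs_add_le _ _).trans ?_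
    rw [abs_mul, abs_mul, abs_mul, abs_mul, abs_of_nonneg h0, abs_two,
      abs_of_nonneg (hv x hx).1]
    have h4 : τ * |deriv N (‖x‖ ^ 2)| * ‖x‖ ^ 2 ≤ τ * K * 1 := by
      gcongr
      exact (hv x hx).2
    have h5 : τ * |N (‖x‖ ^ 2)| ≤ τ * K := by gcongr
    linarith

namespace SmallDil

variable {n : ℕ} {N : ℝ → ℝ} {τ : ℝ} {h : Euc n ≃ₜ Euc n}

lemma tan_pos (S : SmallDil n N τ h) (hn : 1 ≤ n) {x : Euc n} (hx : x ∈ ball (0 : Euc n) 1) :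
    0 < tanFac N τ x := by
  have hn' : (1 : ℝ) ≤ n := by exact_mod_cast hn
  have h1 : (1 : ℝ) / (2 * n) ≤ 1 / 2 := by
    gcongr
    linarith
  linarith [(abs_le.mp (S.tan x hx)).1]

lemma rad_pos (S : SmallDil n N τ h) (hn : 1 ≤ n) {x : Euc n} (hx : x ∈ ball (0 : Euc n) 1) :
    0 < radFac N τ x := by
  have hn' : (1 : ℝ) ≤ n := by exact_mod_cast hn
  have h1 : (1 : ℝ) / (2 * n) ≤ 1 / 2 := by
    gcongr
    linarith
  linarith [(abs_le.mp (S.rad x hx)).1]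

lemma det_eq (S : SmallDil n N τ h) (hn : 1 ≤ n) {x : Euc n} (hx : x ∈ ball (0 : Euc n) 1) :
    |(dilD N τ x).det| = tanFac N τ x ^ (n - 1) * radFac N τ x := by
  have h1 := S.tan_pos hn hx
  have h2 := S.rad_pos hn hx
  rw [det_dilD hn N τ x h1.ne', abs_of_pos (by positivity)]

lemma det_bounds (S : SmallDil n N τ h) (hn : 1 ≤ n) {x : Euc n} (hx : x ∈ ball (0 : Euc n) 1) :
    1 / 2 ≤ |(dilD N τ x).det| ∧ |(dilD N τ x).det| ≤ 2 := by
  rw [S.det_eq hn hx]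
  exact jacobian_bounds hn (S.tan x hx) (S.rad x hx)

lemma hasFDerivAt (S : SmallDil n N τ h) (hN : ContDiff ℝ 1 N) (x : Euc n) :
    HasFDerivAt h (dilD N τ x) x := by
  rw [show (h : Euc n → Euc n) = dil N τ from funext S.eq_dil]
  exact hasFDerivAt_dil hN τ x

lemma map_mem (S : SmallDil n N τ h) {x : Euc n} (hx : x ∈ ball (0 : Euc n) 1) :
    h x ∈ ball (0 : Euc n) 1 := by
  rw [← S.image_ball]
  exact Set.mem_image_of_mem _ hx

lemma lintegral_eq (S : SmallDil n N τ h) (hN : ContDiff ℝ 1 N) (f : Euc n → ENNReal) :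
    ∫⁻ y in ball 0 1, f y = ∫⁻ x in ball 0 1, ENNReal.ofReal |(dilD N τ x).det| * f (h x) := by
  conv_lhs => rw [← S.image_ball]
  exact lintegral_image_eq_lintegral_abs_det_fderiv_mul volume measurableSet_ball
    (fun x _ => (S.hasFDerivAt hN x).hasFDerivWithinAt) h.injective.injOn f

lemma lintegral_comp_le (S : SmallDil n N τ h) (hn : 1 ≤ n) (hN : ContDiff ℝ 1 N)
    (f : Euc n → ENNReal) : ∫⁻ x in ball 0 1, f (h x) ≤ 2 * ∫⁻ y in ball 0 1, f y := by
  rw [S.lintegral_eq hN f, ← lintegral_const_mul' _ _ (by simp)]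
  refine setLIntegral_mono' measurableSet_ball fun x hx => ?_
  rw [← mul_assoc]
  refine le_mul_of_one_le_left zero_le ?_
  have h1 : ENNReal.ofReal 2 * ENNReal.ofReal |(dilD N τ x).det| =
      2 * ENNReal.ofReal |(dilD N τ x).det| := congrArg (· * _) (ENNReal.ofReal_ofNat 2)
  rw [← h1, ← ENNReal.ofReal_mul two_pos.le, ENNReal.one_le_ofReal]
  linarith [(S.det_bounds hn hx).1]

lemma lintegral_le_comp (S : SmallDil n N τ h) (hn : 1 ≤ n) (hN : ContDiff ℝ 1 N)
    (f : Euc n → ENNReal) : ∫⁻ y in ball 0 1, f y ≤ 2 * ∫⁻ x in ball 0 1, f (h x) := by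
  rw [S.lintegral_eq hN f, ← lintegral_const_mul' _ _ (by simp)]
  refine setLIntegral_mono' measurableSet_ball fun x hx => ?_
  gcongr
  exact ENNReal.ofReal_le_of_le_toReal (by simpa using (S.det_bounds hn hx).2)

end SmallDil

lemma ae_restrict_of_forall {E : Type*} [MeasurableSpace E] {μ : Measure E} {s : Set E}
    (hs : MeasurableSet s) {p : E → Prop} (h : ∀ x ∈ s, p x) : ∀ᵐ x ∂μ.restrict s, p x :=
  (ae_restrict_iff' hs).mpr (Filter.Eventually.of_forall h)

/-- A differentiable function with square integrable gradient is close to its composition with a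
small radial deformation. -/
lemma lintegral_comp_symm_sub_le {n : ℕ} (hn : 1 ≤ n) {N : ℝ → ℝ} (hN : ContDiff ℝ 1 N) {τ : ℝ}
    (hτ : 0 ≤ τ) (hS : ∀ s, 0 ≤ s → s ≤ τ → ∃ h, SmallDil n N s h) {h : Euc n ≃ₜ Euc n}
    (S : SmallDil n N τ h) {K : ℝ} (hK : ∀ v ∈ Set.Icc (0 : ℝ) 1, |N v| ≤ K) {u : Euc n → ℂ}
    (hu : DifferentiableOn ℝ u (ball 0 1)) :
    ∫⁻ y in ball 0 1, ‖u (h.symm y) - u y‖ₑ ^ 2 ≤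
      ENNReal.ofReal (4 * K ^ 2 * τ ^ 2) * ∫⁻ x in ball 0 1, ‖fderiv ℝ u x‖ₑ ^ 2 := by
  have hK0 : 0 ≤ K := (abs_nonneg _).trans (hK 0 (by simp))
  have hcont : Continuous fun p : Euc n × ℝ => dil N p.2 p.1 := by
    have := hN.continuous
    unfold dil
    fun_prop
  have hmeas : Measurable fun p : Euc n × ℝ => ‖fderiv ℝ u (dil N p.2 p.1)‖ₑ ^ 2 :=
    ((measurable_fderiv ℝ u).comp hcont.measurable).enorm.pow_const 2
  have hpt : ∀ x ∈ ball (0 : Euc n) 1, ‖u (h.symm (h x)) - u (h x)‖ₑ ^ 2 ≤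
      ENNReal.ofReal (K ^ 2 * τ) *
        ∫⁻ s in Set.Ioc 0 τ, ‖fderiv ℝ u (dil N s x)‖ₑ ^ 2 := by
    intro x hx
    have hx1 := mem_ball_zero_iff.mp hx
    have hmem : ∀ s ∈ Set.Icc 0 τ, dil N s x ∈ ball (0 : Euc n) 1 := by
      intro s hs
      obtain ⟨k, hk⟩ := hS s hs.1 hs.2
      rw [← hk.eq_dil]
      exact hk.map_mem hx
    have hline : ∀ s : ℝ, HasDerivAt (fun s => dil N s x) (N (‖x‖ ^ 2) • x) s := by
      intro s
      have := (((hasDerivAt_id s).mul_const (N (‖x‖ ^ 2))).const_add 1).smul_const x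
      simpa [dil] using this
    have hd : ∀ s ∈ Set.Icc 0 τ, HasDerivAt (fun s => u (dil N s x))
        (fderiv ℝ u (dil N s x) (N (‖x‖ ^ 2) • x)) s := by
      intro s hs
      have h1 := ((hu _ (hmem s hs)).differentiableAt
        (isOpen_ball.mem_nhds (hmem s hs))).hasFDerivAt
      exact h1.comp_hasDerivAt s (hline s)
    have hcx : Continuous fun s : ℝ => dil N s x := by
      unfold dil
      fun_prop
    have hmx : Measurable fun s : ℝ => fderiv ℝ u (dil N s x) (N (‖x‖ ^ 2) • x) :=
      (measurable_fderiv_apply_const ℝ u _).comp hcx.measurable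
    have h1 := enorm_sub_le_lintegral_of_hasDerivAt hτ hd hmx.aestronglyMeasurable
    have h0 : dil N 0 x = x := by simp [dil]
    rw [h0] at h1
    have hXK : ‖N (‖x‖ ^ 2) • x‖ₑ ≤ ENNReal.ofReal K := by
      rw [← ofReal_norm]
      refine ENNReal.ofReal_le_ofReal ?_
      rw [norm_smul]
      have h2 := hK (‖x‖ ^ 2) ⟨by positivity, pow_le_one₀ (norm_nonneg _) hx1.le⟩
      calc ‖N (‖x‖ ^ 2)‖ * ‖x‖ ≤ K * 1 := by
            gcongr
            exact h2
        _ = K := mul_one K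
    rw [h.symm_apply_apply, S.eq_dil, enorm_sub_rev]
    calc ‖u (dil N τ x) - u x‖ₑ ^ 2
        ≤ (∫⁻ s in Set.Ioc 0 τ, ‖fderiv ℝ u (dil N s x) (N (‖x‖ ^ 2) • x)‖ₑ) ^ 2 := by gcongr
      _ ≤ volume.restrict (Set.Ioc 0 τ) Set.univ *
          ∫⁻ s in Set.Ioc 0 τ, ‖fderiv ℝ u (dil N s x) (N (‖x‖ ^ 2) • x)‖ₑ ^ 2 :=
          lintegral_sq_le hmx.enorm.aemeasurable
      _ ≤ ENNReal.ofReal τ * ∫⁻ s in Set.Ioc 0 τ,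
            ENNReal.ofReal (K ^ 2) * ‖fderiv ℝ u (dil N s x)‖ₑ ^ 2 := by
          simp only [Measure.restrict_apply_univ, Real.volume_Ioc, sub_zero]
          gcongr with s
          rw [ENNReal.ofReal_pow hK0, mul_comm, ← mul_pow]
          gcongr
          refine (ContinuousLinearMap.le_opENorm _ _).trans ?_
          gcongr
      _ = _ := by
          rw [lintegral_const_mul' _ _ (by simp), ← mul_assoc, ← ENNReal.ofReal_mul hτ,
            mul_comm τ]
  calc ∫⁻ y in ball 0 1, ‖u (h.symm y) - u y‖ₑ ^ 2
      ≤ 2 * ∫⁻ x in ball 0 1, ‖u (h.symm (h x)) - u (h x)‖ₑ ^ 2 :=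
        S.lintegral_le_comp hn hN fun y => ‖u (h.symm y) - u y‖ₑ ^ 2
    _ ≤ 2 * ∫⁻ x in ball 0 1, ENNReal.ofReal (K ^ 2 * τ) *
        ∫⁻ s in Set.Ioc 0 τ, ‖fderiv ℝ u (dil N s x)‖ₑ ^ 2 := by
        gcongr 2 * ?_
        exact setLIntegral_mono' measurableSet_ball hpt
    _ = 2 * ENNReal.ofReal (K ^ 2 * τ) *
        ∫⁻ s in Set.Ioc 0 τ, ∫⁻ x in ball 0 1, ‖fderiv ℝ u (dil N s x)‖ₑ ^ 2 := by
        rw [lintegral_const_mul' _ _ (by simp), ← mul_assoc]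
        congr 1
        exact lintegral_lintegral_swap hmeas.aemeasurable
    _ ≤ 2 * ENNReal.ofReal (K ^ 2 * τ) *
        ∫⁻ s in Set.Ioc 0 τ, 2 * ∫⁻ x in ball 0 1, ‖fderiv ℝ u x‖ₑ ^ 2 := by
        gcongr 2 * ENNReal.ofReal (K ^ 2 * τ) * ?_
        refine setLIntegral_mono' measurableSet_Ioc fun s hs => ?_
        obtain ⟨k, hk⟩ := hS s hs.1.le hs.2
        simp only [← hk.eq_dil]
        exact hk.lintegral_comp_le hn hN fun y => ‖fderiv ℝ u y‖ₑ ^ 2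
    _ = _ := by
        rw [lintegral_const, Measure.restrict_apply_univ, Real.volume_Ioc, sub_zero]
        have h1 : 4 * K ^ 2 * τ ^ 2 = 2 * (2 * ((K ^ 2 * τ) * τ)) := by ring
        rw [h1, ENNReal.ofReal_mul two_pos.le, ENNReal.ofReal_mul two_pos.le,
          ENNReal.ofReal_mul (by positivity : 0 ≤ K ^ 2 * τ), ENNReal.ofReal_ofNat]
        ring

lemma Real.exp_le_one_add_add_sq {z : ℝ} (hz : |z| ≤ 1) : Real.exp z ≤ 1 + z + z ^ 2 := by
  linarith [(abs_le.mp (Real.abs_exp_sub_one_sub_id_le hz)).2]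

lemma one_add_mul_pow_mul_le_exp {y s b : ℝ} (m : ℕ) (hs : 0 ≤ 1 + s)
    (hb : 0 ≤ 1 + b) : (1 + y) * ((1 + s) ^ m * (1 + b)) ≤ Real.exp (y + (m * s + b)) := by
  rw [Real.exp_add, Real.exp_add, Real.exp_nat_mul]
  have h1 := Real.add_one_le_exp y
  have h2 := Real.add_one_le_exp s
  have h3 := Real.add_one_le_exp b
  gcongr <;> linarith

set_option maxHeartbeats 1000000 in
/-- The second order expansion, in the deformation parameter, of the deformed energy density. -/
lemma deformed_density_le {m : ℕ} {K D τ N N' r β M₁ M₂ M₃ W E : ℝ} (hK : 0 ≤ K) (hτ : 0 ≤ τ)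
    (hτD : τ * (D * (K + m + 10)) ≤ 1) (hr0 : 0 ≤ r) (hr1 : r ≤ 1) (hN0 : 0 ≤ N) (hND : N ≤ D)
    (hN' : |N'| ≤ D) (hβ : β = 1 + τ * N + 2 * τ * N' * r ^ 2) (hβ' : 1 / 2 ≤ β)
    (hM₁ : 0 ≤ M₁) (hM₁E : M₁ ≤ E) (hM₂ : |M₂| ≤ E) (hM₃ : 0 ≤ M₃) (hM₃E : M₃ ≤ E)
    (hW : 0 ≤ W) (hWE : W ≤ E) :
    (1 + K * (τ * N * r)) * ((1 + τ * N) ^ m * β * M₁ / 2 - (2 * τ * N') * (1 + τ * N) ^ m * M₂ +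
        (2 * τ * N') ^ 2 * (1 + τ * N) ^ m / β * M₃ / 2 + (1 + τ * N) ^ (m + 2) * β * W) ≤
      M₁ / 2 + W + τ * (((m + 1 + K * r) * N + 2 * N' * r ^ 2) * (M₁ / 2 + W) + 2 * N * W -
        2 * N' * M₂) +
        τ ^ 2 * ((2 * (D * (K + m + 10)) ^ 2 + 4 * D * (D * (K + m + 10)) + 12 * D ^ 2) * E) := by
  set Γ := D * (K + m + 10) with hΓ
  have hD : 0 ≤ D := hN0.trans hND
  have hm : (0 : ℝ) ≤ m := m.cast_nonneg
  have hΓ0 : 0 ≤ Γ := by positivity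
  set α := (m + 1 + K * r) * N + 2 * N' * r ^ 2 with hα
  have hr2 : r ^ 2 ≤ 1 := pow_le_one₀ hr0 hr1
  have hr2' : 0 ≤ r ^ 2 := sq_nonneg r
  have hN'r : |2 * N' * r ^ 2| ≤ 2 * D := by
    rw [abs_mul, abs_mul, abs_two, abs_of_nonneg hr2']
    nlinarith [abs_nonneg N']
  have hE : 0 ≤ E := hW.trans hWE
  have hKr : 0 ≤ K * r := by positivity
  have hKrK : K * r ≤ K := by nlinarith
  have hKrN : (m + 1 + K * r) * N ≤ (m + 1 + K) * D := by gcongr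
  have hKrN0 : 0 ≤ (m + 1 + K * r) * N := by positivity
  have hαΓ : |α| ≤ Γ := by
    rw [abs_le] at hN'r ⊢
    constructor <;> nlinarith
  have hαΓ' : |α + 2 * N| ≤ Γ := by
    rw [abs_le] at hN'r ⊢
    constructor <;> nlinarith
  have hτα : ∀ z, |z| ≤ Γ → Real.exp (τ * z) ≤ 1 + τ * z + τ ^ 2 * Γ ^ 2 := by
    intro z hz
    have h1 : |τ * z| ≤ 1 := by
      rw [abs_mul, abs_of_nonneg hτ]
      exact (mul_le_mul_of_nonneg_left hz hτ).trans hτD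
    have h2 : z ^ 2 ≤ Γ ^ 2 := by
      rw [← sq_abs z]
      exact pow_le_pow_left₀ (abs_nonneg z) hz 2
    have h3 := Real.exp_le_one_add_add_sq h1
    nlinarith [mul_le_mul_of_nonneg_left h2 (sq_nonneg τ)]
  have hτN : 0 ≤ τ * N := by positivity
  have hy : 0 ≤ K * (τ * N * r) := by positivity
  have e1 : (1 + K * (τ * N * r)) * ((1 + τ * N) ^ m * β) ≤ 1 + τ * α + τ ^ 2 * Γ ^ 2 := by
    have h1 := one_add_mul_pow_mul_le_exp m (y := K * (τ * N * r)) (s := τ * N) (b := β - 1)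
      (by linarith) (by linarith)
    have h2 : K * (τ * N * r) + (m * (τ * N) + (β - 1)) = τ * α := by
      rw [hβ, hα]
      ring
    rw [h2, add_sub_cancel] at h1
    exact h1.trans (hτα α hαΓ)
  have e2 : (1 + K * (τ * N * r)) * ((1 + τ * N) ^ (m + 2) * β) ≤
      1 + τ * (α + 2 * N) + τ ^ 2 * Γ ^ 2 := by
    have h1 := one_add_mul_pow_mul_le_exp (m + 2) (y := K * (τ * N * r)) (s := τ * N) (b := β - 1)
      (by linarith) (by linarith)
    have h2 : K * (τ * N * r) + ((m + 2 : ℕ) * (τ * N) + (β - 1)) = τ * (α + 2 * N) := by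
      rw [hβ, hα]
      push_cast
      ring
    rw [h2, add_sub_cancel] at h1
    exact h1.trans (hτα _ hαΓ')
  set T := (1 + K * (τ * N * r)) * (1 + τ * N) ^ m with hT
  have e3 : 1 ≤ T := by
    exact one_le_mul_of_one_le_of_one_le (by linarith) (one_le_pow₀ (by linarith))
  have e4 : T ≤ 1 + 2 * (τ * Γ) := by
    have h1 := one_add_mul_pow_mul_le_exp m (y := K * (τ * N * r)) (s := τ * N) (b := 0)
      (by linarith) (by linarith)
    have h2 : K * (τ * N * r) + (m * (τ * N) + 0) ≤ τ * Γ := by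
      have : K * (τ * N * r) + (m * (τ * N) + 0) = τ * ((m + K * r) * N) := by ring
      rw [this]
      gcongr
      nlinarith
    have h3 : Real.exp (K * (τ * N * r) + (m * (τ * N) + 0)) ≤ Real.exp (τ * Γ) :=
      Real.exp_le_exp.mpr h2
    have h4 := hτα Γ (abs_of_nonneg hΓ0).le
    have h5 : 0 ≤ τ * Γ := by positivity
    have h6 : τ ^ 2 * Γ ^ 2 ≤ τ * Γ := by
      rw [← mul_pow, sq]
      exact mul_le_of_le_one_left h5 hτD
    rw [add_zero, mul_one] at h1
    linarith
  have f1 : (1 + K * (τ * N * r)) * ((1 + τ * N) ^ m * β * M₁ / 2) ≤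
      M₁ / 2 + τ * α * (M₁ / 2) + τ ^ 2 * Γ ^ 2 * E := by
    have h1 := mul_le_mul_of_nonneg_right e1 (by positivity : 0 ≤ M₁ / 2)
    have h2 : τ ^ 2 * Γ ^ 2 * (M₁ / 2) ≤ τ ^ 2 * Γ ^ 2 * E := by
      gcongr
      linarith
    calc _ = (1 + K * (τ * N * r)) * ((1 + τ * N) ^ m * β) * (M₁ / 2) := by ring
      _ ≤ _ := h1
      _ ≤ _ := by linarith
  have f2 : (1 + K * (τ * N * r)) * ((1 + τ * N) ^ (m + 2) * β * W) ≤
      W + τ * (α + 2 * N) * W + τ ^ 2 * Γ ^ 2 * E := by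
    have h1 := mul_le_mul_of_nonneg_right e2 hW
    have h2 : τ ^ 2 * Γ ^ 2 * W ≤ τ ^ 2 * Γ ^ 2 * E := by gcongr
    calc _ = (1 + K * (τ * N * r)) * ((1 + τ * N) ^ (m + 2) * β) * W := by ring
      _ ≤ _ := h1
      _ ≤ _ := by linarith
  have f3 : -(T * (2 * τ * N') * M₂) ≤ -(2 * τ * N') * M₂ + τ ^ 2 * (4 * D * Γ) * E := by
    have h1 : |(T - 1) * (2 * τ * N') * M₂| ≤ 2 * (τ * Γ) * (2 * τ * D) * E := by
      rw [abs_mul, abs_mul, abs_of_nonneg (sub_nonneg.mpr e3), abs_mul, abs_mul, abs_two,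
        abs_of_nonneg hτ]
      gcongr
      linarith
    have h2 := neg_le_of_abs_le h1
    have h3 := (abs_le.mp h1).1
    linarith
  have f4 : T * (2 * τ * N') ^ 2 / β * M₃ / 2 ≤ τ ^ 2 * (12 * D ^ 2) * E := by
    have h1 : T ≤ 3 := by linarith
    have h2 : N' ^ 2 ≤ D ^ 2 := by
      rw [← sq_abs N']
      exact pow_le_pow_left₀ (abs_nonneg _) hN' 2
    have h3 : β⁻¹ ≤ 2 := by
      rw [inv_le_comm₀ (by linarith) two_pos]
      linarith
    have h4 : 0 ≤ β⁻¹ := inv_nonneg.mpr (by linarith)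
    calc T * (2 * τ * N') ^ 2 / β * M₃ / 2 = T * (4 * τ ^ 2 * N' ^ 2) * β⁻¹ * M₃ / 2 := by
          rw [div_eq_mul_inv _ β]
          ring
      _ ≤ 3 * (4 * τ ^ 2 * D ^ 2) * 2 * E / 2 := by gcongr
      _ = _ := by ring
  have hsum : (1 + K * (τ * N * r)) * ((1 + τ * N) ^ m * β * M₁ / 2 -
      (2 * τ * N') * (1 + τ * N) ^ m * M₂ +
        (2 * τ * N') ^ 2 * (1 + τ * N) ^ m / β * M₃ / 2 + (1 + τ * N) ^ (m + 2) * β * W) =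
      (1 + K * (τ * N * r)) * ((1 + τ * N) ^ m * β * M₁ / 2) + -(T * (2 * τ * N') * M₂) +
      T * (2 * τ * N') ^ 2 / β * M₃ / 2 + (1 + K * (τ * N * r)) * ((1 + τ * N) ^ (m + 2) * β * W)
      := by
    rw [hT]
    ring
  rw [hsum]
  linarith

/-- The matrix `x ⊗ (x · ∇u)`, up to a factor `|x|²` the radial part of the gradient. -/
def radGrad {n : ℕ} (u : Euc n → ℂ) (x : Euc n) : Fin n → ℂ := fun k => x k • fderiv ℝ u x x

lemma inner_single_one_right {n : ℕ} (x : Euc n) (k : Fin n) :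
    inner ℝ x (EuclideanSpace.single k (1 : ℝ)) = x k := by
  rw [EuclideanSpace.inner_single_right]
  simp

lemma measurable_pd {n : ℕ} (u : Euc n → ℂ) (i : Fin n) : Measurable (pd u i) :=
  measurable_fderiv_apply_const ℝ _ _

lemma fderiv_apply_self {n : ℕ} (u : Euc n → ℂ) (x : Euc n) :
    fderiv ℝ u x x = ∑ j, x j • pd u j x := by
  conv_lhs =>
    arg 2
    rw [← (EuclideanSpace.basisFun (Fin n) ℝ).sum_repr x]
  simp [map_sum, pd]

lemma norm_fderiv_apply_self_sq_le {n : ℕ} (u : Euc n → ℂ) (x : Euc n) :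
    ‖fderiv ℝ u x x‖ ^ 2 ≤ ‖x‖ ^ 2 * ∑ j, ‖pd u j x‖ ^ 2 := by
  have h1 : ‖fderiv ℝ u x x‖ ≤ ∑ j, ‖x j‖ * ‖pd u j x‖ := by
    rw [fderiv_apply_self]
    exact (norm_sum_le _ _).trans (Finset.sum_le_sum fun j _ => (norm_smul _ _).le)
  calc ‖fderiv ℝ u x x‖ ^ 2 ≤ (∑ j, ‖x j‖ * ‖pd u j x‖) ^ 2 := by gcongr
    _ ≤ (∑ j, ‖x j‖ ^ 2) * ∑ j, ‖pd u j x‖ ^ 2 := Finset.sum_mul_sq_le_sq_mul_sq _ _ _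
    _ = _ := by rw [EuclideanSpace.norm_sq_eq]

lemma sum_norm_radGrad_sq {n : ℕ} (u : Euc n → ℂ) (x : Euc n) :
    ∑ k, ‖radGrad u x k‖ ^ 2 = ‖x‖ ^ 2 * ‖fderiv ℝ u x x‖ ^ 2 := by
  simp only [radGrad, norm_smul, mul_pow, ← Finset.sum_mul, EuclideanSpace.norm_sq_eq]

lemma sum_norm_radGrad_sq_le {n : ℕ} (u : Euc n → ℂ) {x : Euc n} (hx : ‖x‖ ≤ 1) :
    ∑ k, ‖radGrad u x k‖ ^ 2 ≤ ∑ j, ‖pd u j x‖ ^ 2 := by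
  have h0 : 0 ≤ ∑ j, ‖pd u j x‖ ^ 2 := Finset.sum_nonneg fun _ _ => sq_nonneg _
  have h1 : ‖x‖ ^ 2 ≤ 1 := pow_le_one₀ (norm_nonneg _) hx
  rw [sum_norm_radGrad_sq]
  calc _ ≤ 1 * (1 * ∑ j, ‖pd u j x‖ ^ 2) := by
        gcongr
        exact (norm_fderiv_apply_self_sq_le u x).trans (by gcongr)
    _ = _ := by ring

lemma bil_smul_sub_smul {n : ℕ} {M : Matrix (Fin n) (Fin n) ℝ} (hM : M.IsSymm) (s t : ℝ)
    (p q : Fin n → ℂ) : bil M (s • p - t • q) (s • p - t • q) =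
      s ^ 2 * bil M p p - 2 * s * t * bil M q p + t ^ 2 * bil M q q := by
  have h : s • p - t • q = s • p + (-t) • q := by rw [neg_smul, sub_eq_add_neg]
  have h1 : ∀ (c : ℝ) (p q : Fin n → ℂ), bil M (c • p) q = c * bil M p q := fun c p q => by
    rw [bil_comm hM, bil_smul_right, bil_comm hM]
  rw [h, bil_add_self hM]
  simp only [bil_smul_right, h1]
  rw [bil_comm hM p q]
  ring

lemma integrableOn_continuous_mul {n : ℕ} {m f : Euc n → ℝ} (hm : Continuous m)
    (hf : IntegrableOn f (ball (0 : Euc n) 1)) :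
    IntegrableOn (fun x => m x * f x) (ball (0 : Euc n) 1) := by
  obtain ⟨C, hC⟩ := (isCompact_closedBall (0 : Euc n) 1).exists_bound_of_continuousOn
    hm.continuousOn
  exact hf.continuousOn_bdd_mul measurableSet_ball hm.continuousOn
    fun x hx => hC x (ball_subset_closedBall hx)

namespace WeakSol

variable {n : ℕ} {A : Euc n → Matrix (Fin n) (Fin n) ℝ} {w : Euc n → ℝ} {c L ε : ℝ}
  {u : Euc n → ℂ}

lemma memLp_radGrad (hu : WeakSol n A w ε u) (k : Fin n) :
    MemLp (fun x => radGrad u x k) 2 (volume.restrict (ball 0 1)) := by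
  have h1 : (fun x => radGrad u x k) = fun x => ∑ j, (x k * x j) • pd u j x := by
    funext x
    simp only [radGrad, fderiv_apply_self, Finset.smul_sum, smul_smul]
  rw [h1]
  refine memLp_finsetSum _ fun j _ => ?_
  have hc : Continuous fun x : Euc n => x k * x j := by fun_prop
  refine (hu.memLp j).of_le_mul (c := 1) (hc.aestronglyMeasurable.smul (hu.memLp j).1) ?_
  refine ae_restrict_of_forall measurableSet_ball fun x hx => ?_
  have hx1 := (mem_ball_zero_iff.mp hx).le
  rw [norm_smul, norm_mul]
  gcongr
  exact mul_le_one₀ ((PiLp.norm_apply_le x k).trans hx1) (norm_nonneg _)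
    ((PiLp.norm_apply_le x j).trans hx1)

lemma continuousOn_potential (hu : WeakSol n A w ε u) :
    ContinuousOn (fun x => potential ε (u x)) (ball (0 : Euc n) 1) := by
  have := hu.diff.continuousOn
  unfold potential
  fun_prop

lemma integrableOn_potential (hu : WeakSol n A w ε u) :
    IntegrableOn (fun x => potential ε (u x)) (ball (0 : Euc n) 1) := by
  refine IntegrableOn.of_bound (C := 1 / (4 * ε ^ 2)) measure_ball_lt_top
    (hu.continuousOn_potential.aestronglyMeasurable measurableSet_ball) ?_
  refine ae_restrict_of_forall measurableSet_ball fun x hx => ?_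
  rw [Real.norm_of_nonneg (potential_nonneg _ _)]
  exact potential_le (hu.le_one x hx)

end WeakSol

namespace SmallDil

variable {n : ℕ} {N : ℝ → ℝ} {τ : ℝ} {h : Euc n ≃ₜ Euc n} {u : Euc n → ℂ}

lemma symm_mem (S : SmallDil n N τ h) {y : Euc n} (hy : y ∈ ball (0 : Euc n) 1) :
    h.symm y ∈ ball (0 : Euc n) 1 := by
  rw [← S.image_ball] at hy
  obtain ⟨x, hx, rfl⟩ := hy
  rwa [h.symm_apply_apply]

lemma hasFDerivAt_comp_symm (S : SmallDil n N τ h) (hn : 1 ≤ n) (hN : ContDiff ℝ 1 N)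
    (hu : DifferentiableOn ℝ u (ball 0 1)) {x : Euc n} (hx : x ∈ ball (0 : Euc n) 1) :
    HasFDerivAt (fun y => u (h.symm y)) ((fderiv ℝ u x).comp (dilInv N τ x)) (h x) := by
  have h1 := hasFDerivAt_dil_symm hN S.eq_dil x (S.tan_pos hn hx).ne' (S.rad_pos hn hx).ne'
  have h2 : HasFDerivAt u (fderiv ℝ u x) (h.symm (h x)) := by
    rw [h.symm_apply_apply]
    exact ((hu x hx).differentiableAt (isOpen_ball.mem_nhds hx)).hasFDerivAt
  exact h2.comp (h x) h1

lemma grad_comp_symm (S : SmallDil n N τ h) (hn : 1 ≤ n) (hN : ContDiff ℝ 1 N)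
    (hu : DifferentiableOn ℝ u (ball 0 1)) {x : Euc n} (hx : x ∈ ball (0 : Euc n) 1) :
    grad (fun y => u (h.symm y)) (h x) = (tanFac N τ x)⁻¹ • grad u x -
      (2 * τ * deriv N (‖x‖ ^ 2) / (tanFac N τ x * radFac N τ x)) • radGrad u x := by
  funext k
  rw [grad, pd, (S.hasFDerivAt_comp_symm hn hN hu hx).fderiv]
  simp [dilInv, grad, pd, radGrad, inner_single_one_right]

lemma differentiableOn_comp_symm (S : SmallDil n N τ h) (hn : 1 ≤ n) (hN : ContDiff ℝ 1 N)
    (hu : DifferentiableOn ℝ u (ball 0 1)) :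
    DifferentiableOn ℝ (fun y => u (h.symm y)) (ball 0 1) := by
  intro y hy
  have h1 := S.hasFDerivAt_comp_symm hn hN hu (S.symm_mem hy)
  rw [h.apply_symm_apply] at h1
  exact h1.differentiableAt.differentiableWithinAt

lemma norm_dilInv_single_le (S : SmallDil n N τ h) (hn : 1 ≤ n) {x : Euc n}
    (hx : x ∈ ball (0 : Euc n) 1) (k : Fin n) :
    ‖dilInv N τ x (EuclideanSpace.single k 1)‖ ≤ 6 := by
  have hn' : (1 : ℝ) ≤ n := by exact_mod_cast hn
  have hd : (1 : ℝ) / (2 * n) ≤ 1 / 2 := by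
    gcongr
    linarith
  have ha := abs_le.mp (S.tan x hx)
  have hb := abs_le.mp (S.rad x hx)
  have hab : 2 * τ * deriv N (‖x‖ ^ 2) * ‖x‖ ^ 2 = radFac N τ x - tanFac N τ x := by
    rw [radFac, tanFac]
    ring
  set a := tanFac N τ x
  set b := radFac N τ x
  have ha2 : 1 / 2 ≤ a := by linarith
  have hb2 : 1 / 2 ≤ b := by linarith
  have h1 : ‖(2 * τ * deriv N (‖x‖ ^ 2) / (a * b)) • (x k • x)‖ ≤ 4 := by
    rw [norm_smul, norm_smul]
    calc _ ≤ ‖2 * τ * deriv N (‖x‖ ^ 2) / (a * b)‖ * (‖x‖ * ‖x‖) := by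
          gcongr
          exact PiLp.norm_apply_le x k
      _ = |b - a| / (a * b) := by
          rw [← hab, norm_div, Real.norm_eq_abs, Real.norm_eq_abs, abs_of_pos (a := a * b)
            (by positivity), abs_mul _ (‖x‖ ^ 2), abs_of_nonneg (sq_nonneg ‖x‖)]
          ring
      _ ≤ 4 := by
          rw [div_le_iff₀ (by positivity), abs_le]
          constructor <;> nlinarith
  have h2 : dilInv N τ x (EuclideanSpace.single k 1) = a⁻¹ • EuclideanSpace.single k (1 : ℝ) -
      (2 * τ * deriv N (‖x‖ ^ 2) / (a * b)) • (x k • x) := by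
    simp [dilInv, a, b, inner_single_one_right]
  have h3 : a⁻¹ ≤ 2 := by
    rw [inv_le_comm₀ (by linarith) two_pos]
    linarith
  rw [h2]
  refine (norm_sub_le _ _).trans ?_
  rw [norm_smul, norm_inv, Real.norm_of_nonneg (by linarith : 0 ≤ a), PiLp.norm_single,
    norm_one]
  linarith

end SmallDil

lemma enorm_fderiv_le {n : ℕ} (u : Euc n → ℂ) (x : Euc n) :
    ‖fderiv ℝ u x‖ₑ ≤ ∑ i, ‖pd u i x‖ₑ := by
  have h : ‖fderiv ℝ u x‖ ≤ ∑ i, ‖pd u i x‖ := by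
    refine ContinuousLinearMap.opNorm_le_bound _ (Finset.sum_nonneg fun _ _ => norm_nonneg _)
      fun y => ?_
    have h1 : fderiv ℝ u x y = ∑ j, y j • pd u j x := by
      conv_lhs => rw [← (EuclideanSpace.basisFun (Fin n) ℝ).sum_repr y]
      simp [map_sum, pd]
    rw [h1, Finset.sum_mul]
    refine (norm_sum_le _ _).trans (Finset.sum_le_sum fun j _ => ?_)
    rw [norm_smul, mul_comm]
    gcongr
    exact PiLp.norm_apply_le y j
  rw [← ofReal_norm]
  refine (ENNReal.ofReal_le_ofReal h).trans ?_
  rw [ENNReal.ofReal_sum_of_nonneg fun _ _ => norm_nonneg _]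
  simp only [ofReal_norm, le_refl]

lemma memLp_two_iff_lintegral {α E : Type*} [MeasurableSpace α] [NormedAddCommGroup E]
    {μ : Measure α} {f : α → E} (hf : AEStronglyMeasurable f μ) :
    MemLp f 2 μ ↔ ∫⁻ x, ‖f x‖ₑ ^ 2 ∂μ < ⊤ := by
  have h := eLpNorm_lt_top_iff_lintegral_rpow_enorm_lt_top (f := f) (μ := μ) (p := 2)
    (by simp) (by simp)
  simp only [ENNReal.toReal_ofNat, ENNReal.rpow_ofNat] at h
  rw [← h]
  exact ⟨fun h => h.2, fun h => ⟨hf, h⟩⟩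

lemma lintegral_fderiv_lt_top {n : ℕ} {u : Euc n → ℂ} {s : Set (Euc n)}
    (hu : ∀ i, MemLp (pd u i) 2 (volume.restrict s)) :
    ∫⁻ x in s, ‖fderiv ℝ u x‖ₑ ^ 2 < ⊤ := by
  have h1 : MemLp (fun x => ∑ i, ‖pd u i x‖) 2 (volume.restrict s) :=
    memLp_finsetSum _ fun i _ => (hu i).norm
  rw [memLp_two_iff_lintegral h1.1] at h1
  refine lt_of_le_of_lt (lintegral_mono fun x => ?_) h1
  have h2 := enorm_fderiv_le u x
  have h3 : ‖∑ i, ‖pd u i x‖‖ₑ = ∑ i, ‖pd u i x‖ₑ := by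
    rw [← ofReal_norm, Real.norm_of_nonneg (Finset.sum_nonneg fun _ _ => norm_nonneg _),
      ENNReal.ofReal_sum_of_nonneg fun _ _ => norm_nonneg _]
    simp only [ofReal_norm]
  rw [h3]
  gcongr

lemma SmallDil.memLp_comp_symm {n : ℕ} {N : ℝ → ℝ} {τ : ℝ} {h : Euc n ≃ₜ Euc n} {u : Euc n → ℂ}
    (S : SmallDil n N τ h) (hn : 1 ≤ n) (hN : ContDiff ℝ 1 N)
    (hu : DifferentiableOn ℝ u (ball 0 1))
    (hu2 : ∀ i, MemLp (pd u i) 2 (volume.restrict (ball 0 1))) (k : Fin n) :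
    MemLp (pd (fun y => u (h.symm y)) k) 2 (volume.restrict (ball 0 1)) := by
  rw [memLp_two_iff_lintegral (measurable_pd _ k).aestronglyMeasurable]
  refine lt_of_le_of_lt (S.lintegral_le_comp hn hN _) ?_
  have h1 : ∫⁻ x in ball 0 1, ‖pd (fun y => u (h.symm y)) k (h x)‖ₑ ^ 2 ≤
      6 ^ 2 * ∫⁻ x in ball 0 1, ‖fderiv ℝ u x‖ₑ ^ 2 := by
    rw [← lintegral_const_mul' _ _ (by simp)]
    refine setLIntegral_mono' measurableSet_ball fun x hx => ?_
    rw [← mul_pow, pd, (S.hasFDerivAt_comp_symm hn hN hu hx).fderiv,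
      ContinuousLinearMap.comp_apply, mul_comm]
    gcongr
    refine (ContinuousLinearMap.le_opENorm _ _).trans ?_
    gcongr
    rw [← ofReal_norm]
    exact ENNReal.ofReal_le_of_le_toReal (by simpa using S.norm_dilInv_single_le hn hx k)
  refine lt_of_le_of_lt (mul_le_mul_right h1 2) ?_
  exact ENNReal.mul_lt_top (by simp) (ENNReal.mul_lt_top (by simp) (lintegral_fderiv_lt_top hu2))

section

/-- The integrand of the (one-sided) inner variation associated with the radial field
`N(|x|²) x`; the constant `K` measures the oscillation of the coefficients. -/
def innerVar {n : ℕ} (A : Euc n → Matrix (Fin n) (Fin n) ℝ) (w : Euc n → ℝ) (ε K : ℝ) (N : ℝ → ℝ)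
    (u : Euc n → ℂ) (x : Euc n) : ℝ :=
  ((n - 2 + K * ‖x‖) * N (‖x‖ ^ 2) + 2 * deriv N (‖x‖ ^ 2) * ‖x‖ ^ 2) * density A w ε u x +
    2 * N (‖x‖ ^ 2) * (w x * potential ε (u x)) -
    2 * deriv N (‖x‖ ^ 2) * bil (A x) (radGrad u x) (grad u x)

variable {n : ℕ} {A : Euc n → Matrix (Fin n) (Fin n) ℝ} {w : Euc n → ℝ} {c L ε : ℝ}
  {u : Euc n → ℂ} {N : ℝ → ℝ} {τ : ℝ} {h : Euc n ≃ₜ Euc n}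

lemma SmallDil.det_mul_density_le (S : SmallDil n N τ h) (hn : 3 ≤ n) (hN : ContDiff ℝ 1 N)
    (H : EllipticCoeff n A w c L) (hu : WeakSol n A w ε u) (hτ : 0 ≤ τ) {D : ℝ}
    (hN0 : ∀ v, 0 ≤ N v) (hD : ∀ v ∈ Set.Icc (0 : ℝ) 1, |N v| ≤ D ∧ |deriv N v| ≤ D)
    (hτD : τ * (D * (n * L / c + n + 10)) ≤ 1) {x : Euc n} (hx : x ∈ ball (0 : Euc n) 1) :
    |(dilD N τ x).det| * density A w ε (fun y => u (h.symm y)) (h x) ≤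
      density A w ε u x + τ * innerVar A w ε (n * L / c) N u x +
        τ ^ 2 * ((2 * (D * (n * L / c + n + 10)) ^ 2 + 4 * D * (D * (n * L / c + n + 10)) +
          12 * D ^ 2) * (n * c⁻¹ * (∑ i, ‖pd u i x‖ ^ 2) + c⁻¹ * (1 / (4 * ε ^ 2)))) := by
  obtain ⟨m, rfl⟩ : ∃ m, n = m + 3 := ⟨n - 3, by omega⟩
  have hn1 : 1 ≤ m + 3 := by omega
  have hc := H.c_pos
  have hL := H.L_nonneg
  have hr1 := (mem_ball_zero_iff.mp hx).le
  have hv : ‖x‖ ^ 2 ∈ Set.Icc (0 : ℝ) 1 := ⟨by positivity, pow_le_one₀ (norm_nonneg _) hr1⟩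
  set K : ℝ := (m + 3 : ℕ) * L / c with hK
  have hK0 : 0 ≤ K := by positivity
  have hD0 : 0 ≤ D := (abs_nonneg _).trans (hD _ hv).1
  set s := ∑ i, ‖pd u i x‖ ^ 2 with hs
  have hs0 : 0 ≤ s := Finset.sum_nonneg fun _ _ => sq_nonneg _
  set E := (m + 3 : ℕ) * c⁻¹ * s + c⁻¹ * (1 / (4 * ε ^ 2)) with hE
  have hE1 : 0 ≤ c⁻¹ * (1 / (4 * ε ^ 2)) := by positivity
  have hE2 : 0 ≤ (m + 3 : ℕ) * c⁻¹ * s := by positivity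
  have hrad := sum_norm_radGrad_sq_le u hr1
  have hbil : ∀ p q : Fin (m + 3) → ℂ, (∑ i, ‖p i‖ ^ 2) ≤ s → (∑ i, ‖q i‖ ^ 2) ≤ s →
      |bil (A x) p q| ≤ E := by
    intro p q hp hq
    refine (abs_bil_le (H.entry x hx) p q).trans ?_
    have : (m + 3 : ℕ) * c⁻¹ * ((∑ i, ‖p i‖ ^ 2) + ∑ i, ‖q i‖ ^ 2) ≤ (m + 3 : ℕ) * c⁻¹ * (s + s) := by
      gcongr
    rw [hE]
    linarith
  have hW0 : 0 ≤ w x * potential ε (u x) := mul_nonneg (H.w_pos hx).le (potential_nonneg _ _)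
  have hWE : w x * potential ε (u x) ≤ E := by
    have : w x * potential ε (u x) ≤ c⁻¹ * (1 / (4 * ε ^ 2)) :=
      mul_le_mul (H.w_upper x hx) (potential_le (hu.le_one x hx)) (potential_nonneg _ _)
        (by positivity)
    linarith
  have ha := S.tan_pos hn1 hx
  have hb := S.rad_pos hn1 hx
  have hb2 : 1 / 2 ≤ radFac N τ x := by
    have h1 : (1 : ℝ) / (2 * (m + 3 : ℕ)) ≤ 1 / 2 := by
      gcongr
      have : (1 : ℝ) ≤ (m + 3 : ℕ) := by exact_mod_cast hn1
      linarith
    linarith [(abs_le.mp (S.rad x hx)).1]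
  have key := deformed_density_le (m := m) (K := K) (D := D) (τ := τ) (N := N (‖x‖ ^ 2))
    (N' := deriv N (‖x‖ ^ 2)) (r := ‖x‖) (β := radFac N τ x)
    (M₁ := bil (A x) (grad u x) (grad u x)) (M₂ := bil (A x) (radGrad u x) (grad u x))
    (M₃ := bil (A x) (radGrad u x) (radGrad u x)) (W := w x * potential ε (u x)) (E := E)
    hK0 hτ (by
      refine le_trans ?_ hτD
      gcongr
      linarith) (norm_nonneg _) hr1 (hN0 _)
    ((le_abs_self _).trans (hD _ hv).1) (hD _ hv).2 rfl hb2 (H.bil_nonneg hx _)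
    ((le_abs_self _).trans (hbil _ _ le_rfl le_rfl)) (hbil _ _ hrad le_rfl)
    (H.bil_nonneg hx _) ((le_abs_self _).trans (hbil _ _ hrad hrad)) hW0 hWE
  have hΓ : τ ^ 2 * ((2 * (D * (K + m + 10)) ^ 2 + 4 * D * (D * (K + m + 10)) + 12 * D ^ 2) * E) ≤
      τ ^ 2 * ((2 * (D * (K + (m + 3 : ℕ) + 10)) ^ 2 + 4 * D * (D * (K + (m + 3 : ℕ) + 10)) +
        12 * D ^ 2) * E) := by
    have hE0 : 0 ≤ E := by positivity
    gcongr <;> omega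
  have hdist : ‖h x - x‖ = τ * N (‖x‖ ^ 2) * ‖x‖ := by
    rw [S.eq_dil, dil, add_smul, one_smul, add_sub_cancel_left, norm_smul,
      Real.norm_of_nonneg (mul_nonneg hτ (hN0 _))]
  have hhx := S.map_mem hx
  set P := grad (fun y => u (h.symm y)) (h x) with hP
  have hPeq := S.grad_comp_symm hn1 hN hu.diff hx
  have d1 : density A w ε (fun y => u (h.symm y)) (h x) ≤ (1 + K * (τ * N (‖x‖ ^ 2) * ‖x‖)) *
      (bil (A x) P P / 2 + w x * potential ε (u x)) := by
    have h1 := H.bil_le_mul hx hhx P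
    have h2 := mul_le_mul_of_nonneg_right (H.w_le_mul hn1 hx hhx) (potential_nonneg ε (u x))
    rw [hdist] at h1 h2
    rw [density, h.symm_apply_apply, ← hP]
    linarith
  have d2 : |(dilD N τ x).det| * (bil (A x) P P / 2 + w x * potential ε (u x)) =
      (1 + τ * N (‖x‖ ^ 2)) ^ m * radFac N τ x * bil (A x) (grad u x) (grad u x) / 2 -
        (2 * τ * deriv N (‖x‖ ^ 2)) * (1 + τ * N (‖x‖ ^ 2)) ^ m *
          bil (A x) (radGrad u x) (grad u x) +
        (2 * τ * deriv N (‖x‖ ^ 2)) ^ 2 * (1 + τ * N (‖x‖ ^ 2)) ^ m / radFac N τ x *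
          bil (A x) (radGrad u x) (radGrad u x) / 2 +
        (1 + τ * N (‖x‖ ^ 2)) ^ (m + 2) * radFac N τ x * (w x * potential ε (u x)) := by
    rw [S.det_eq hn1 hx, hP, hPeq, bil_smul_sub_smul (H.symm x hx)]
    have e1 : 1 + τ * N (‖x‖ ^ 2) = tanFac N τ x := rfl
    have e2 : m + 3 - 1 = m + 2 := rfl
    rw [e1, e2]
    generalize tanFac N τ x = a at *
    generalize radFac N τ x = b at *
    field_simp
    ring
  calc |(dilD N τ x).det| * density A w ε (fun y => u (h.symm y)) (h x)
      ≤ |(dilD N τ x).det| * ((1 + K * (τ * N (‖x‖ ^ 2) * ‖x‖)) *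
        (bil (A x) P P / 2 + w x * potential ε (u x))) := by gcongr
    _ = (1 + K * (τ * N (‖x‖ ^ 2) * ‖x‖)) * (|(dilD N τ x).det| *
        (bil (A x) P P / 2 + w x * potential ε (u x))) := by ring
    _ ≤ _ := by
      rw [d2]
      refine key.trans ?_
      have e3 : ((m + 3 : ℕ) : ℝ) - 2 = m + 1 := by
        push_cast
        ring
      rw [innerVar, density, e3]
      linarith

end

section

variable {n : ℕ} {A : Euc n → Matrix (Fin n) (Fin n) ℝ} {w : Euc n → ℝ} {c L ε : ℝ}
  {u : Euc n → ℂ} {N : ℝ → ℝ} {τ : ℝ} {h : Euc n ≃ₜ Euc n}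

lemma SmallDil.integral_w_mul_sub_le (S : SmallDil n N τ h) (hn : 1 ≤ n) (hN : ContDiff ℝ 1 N)
    (hS : ∀ s, 0 ≤ s → s ≤ τ → ∃ h, SmallDil n N s h) (H : EllipticCoeff n A w c L)
    (hu : WeakSol n A w ε u) (hτ : 0 ≤ τ) {K : ℝ} (hK : ∀ v ∈ Set.Icc (0 : ℝ) 1, |N v| ≤ K) :
    ∫ x in ball 0 1, w x * ‖u (h.symm x) - u x‖ ^ 2 ≤
      τ ^ 2 * (c⁻¹ * (4 * K ^ 2 * (∫⁻ x in ball 0 1, ‖fderiv ℝ u x‖ₑ ^ 2).toReal)) := by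
  have hc := H.c_pos
  have hfin := lintegral_fderiv_lt_top hu.memLp
  have hcont : ContinuousOn (fun x => w x * ‖u (h.symm x) - u x‖ ^ 2) (ball (0 : Euc n) 1) := by
    have h1 := H.continuousOn_w
    have h2 := hu.diff.continuousOn
    have h3 := (S.differentiableOn_comp_symm hn hN hu.diff).continuousOn
    exact h1.mul ((h3.sub h2).norm.pow 2)
  rw [integral_eq_lintegral_of_nonneg_ae
    (ae_restrict_of_forall measurableSet_ball fun x hx =>
      mul_nonneg (H.w_pos hx).le (sq_nonneg _))
    (hcont.aestronglyMeasurable measurableSet_ball)]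
  refine ENNReal.toReal_le_of_le_ofReal (by positivity) ?_
  have h1 : ∫⁻ x in ball 0 1, ENNReal.ofReal (w x * ‖u (h.symm x) - u x‖ ^ 2) ≤
      ENNReal.ofReal c⁻¹ * ∫⁻ x in ball 0 1, ‖u (h.symm x) - u x‖ₑ ^ 2 := by
    rw [← lintegral_const_mul' _ _ ENNReal.ofReal_ne_top]
    refine setLIntegral_mono' measurableSet_ball fun x hx => ?_
    rw [ENNReal.ofReal_mul (H.w_pos hx).le, ENNReal.ofReal_pow (norm_nonneg _), ofReal_norm]
    gcongr
    exact H.w_upper x hx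
  refine h1.trans ((mul_le_mul_right
    (lintegral_comp_symm_sub_le hn hN hτ hS S hK hu.diff) _).trans ?_)
  rw [← ENNReal.ofReal_toReal hfin.ne, ← ENNReal.ofReal_mul (by positivity),
    ← ENNReal.ofReal_mul (by positivity), ENNReal.toReal_ofReal ENNReal.toReal_nonneg]
  refine ENNReal.ofReal_le_ofReal (le_of_eq ?_)
  ring

lemma WeakSol.integrableOn_sum_sq (hu : WeakSol n A w ε u) :
    IntegrableOn (fun x => ∑ i, ‖pd u i x‖ ^ 2) (ball (0 : Euc n) 1) := by
  refine integrable_finsetSum _ fun i _ => ?_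
  exact (hu.memLp i).integrable_norm_pow two_ne_zero

lemma WeakSol.integrableOn_innerVar (H : EllipticCoeff n A w c L) (hu : WeakSol n A w ε u)
    (hN : ContDiff ℝ 1 N) (K : ℝ) :
    IntegrableOn (innerVar A w ε K N u) (ball (0 : Euc n) 1) := by
  have h0 := hN.continuous
  have h1 := hN.continuous_deriv_one
  refine ((integrableOn_continuous_mul (by fun_prop)
    (H.integrableOn_density ε hu.diff.continuousOn hu.le_one hu.memLp)).add
    (integrableOn_continuous_mul (by fun_prop)
      (H.integrableOn_w_mul hu.integrableOn_potential))).sub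
    (integrableOn_continuous_mul (by fun_prop) (H.integrableOn_bil hu.memLp_radGrad hu.memLp))

/-- The inner variation of a weak solution is nonnegative for nonnegative profiles. -/
theorem WeakSol.integral_innerVar_nonneg (hn : 3 ≤ n) (H : EllipticCoeff n A w c L)
    (hu : WeakSol n A w ε u) (hN : ContDiff ℝ 1 N) (hN0 : ∀ v, 0 ≤ N v) {ρ : ℝ} (hρ : 0 ≤ ρ)
    (hρ1 : ρ < 1) (hNρ : ∀ v, ρ ^ 2 ≤ v → N v = 0) :
    0 ≤ ∫ x in ball 0 1, innerVar A w ε (n * L / c) N u x := by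
  have hn1 : 1 ≤ n := by omega
  have hc := H.c_pos
  have hL := H.L_nonneg
  obtain ⟨τ₀, hτ₀, hS⟩ := exists_smallDil hn1 hN hNρ hρ hρ1.le
  obtain ⟨D, hD1, hD⟩ := exists_profile_bound hN
  set Q := D * (n * L / c + n + 10) with hQ
  have hQ0 : 0 < Q := by positivity
  set P : Euc n → ℝ := fun x => (2 * Q ^ 2 + 4 * D * Q + 12 * D ^ 2) *
    (n * c⁻¹ * (∑ i, ‖pd u i x‖ ^ 2) + c⁻¹ * (1 / (4 * ε ^ 2))) with hP
  have hPi : IntegrableOn P (ball (0 : Euc n) 1) :=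
    Integrable.const_mul ((hu.integrableOn_sum_sq.const_mul _).add
      (integrableOn_const measure_ball_lt_top.ne)) _
  have hdi := H.integrableOn_density ε hu.diff.continuousOn hu.le_one hu.memLp
  have hii := hu.integrableOn_innerVar H hN (n * L / c)
  set I := ∫ x in ball 0 1, innerVar A w ε (n * L / c) N u x with hI
  set R := 1 / (2 * ε ^ 2) *
    (c⁻¹ * (4 * D ^ 2 * (∫⁻ x in ball 0 1, ‖fderiv ℝ u x‖ₑ ^ 2).toReal)) +
      ∫ x in ball 0 1, P x with hR
  have key : ∀ τ, 0 < τ → τ ≤ min τ₀ (1 / Q) → 0 ≤ I + τ * R := by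
    intro τ hτ hττ
    have hττ₀ := hττ.trans (min_le_left _ _)
    obtain ⟨h, S⟩ := hS τ hτ.le hττ₀
    have hτD : τ * Q ≤ 1 := by
      have := hττ.trans (min_le_right _ _)
      rwa [le_div_iff₀ hQ0] at this
    have hvd := S.differentiableOn_comp_symm hn1 hN hu.diff
    have hv1 : ∀ x ∈ ball (0 : Euc n) 1, ‖u (h.symm x)‖ ≤ 1 := fun x hx =>
      hu.le_one _ (S.symm_mem hx)
    have hv2 := S.memLp_comp_symm hn1 hN hu.diff hu.memLp
    have huv : ∀ x, ρ ≤ ‖x‖ → u (h.symm x) = u x := by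
      intro x hx
      have : h x = x := by
        rw [S.eq_dil, dil, hNρ _ (by gcongr)]
        simp
      rw [h.symm_apply_eq.mpr this.symm]
    have e1 := hu.energy_le H hvd hv1 hv2 hρ1 huv
    have e2 := S.integral_w_mul_sub_le hn1 hN
      (fun s h0 h1 => hS s h0 (h1.trans hττ₀)) H hu hτ.le (fun v hv => (hD v hv).1)
    have hvi := H.integrableOn_density ε hvd.continuousOn hv1 hv2
    have e3 : ∫ x in ball 0 1, density A w ε (fun y => u (h.symm y)) x =
        ∫ x in ball 0 1, |(dilD N τ x).det| * density A w ε (fun y => u (h.symm y)) (h x) := by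
      conv_lhs => rw [← S.image_ball]
      exact integral_image_eq_integral_abs_det_fderiv_smul volume measurableSet_ball
        (fun x _ => (S.hasFDerivAt hN x).hasFDerivWithinAt) h.injective.injOn _
    have e4 : IntegrableOn (fun x => |(dilD N τ x).det| *
        density A w ε (fun y => u (h.symm y)) (h x)) (ball (0 : Euc n) 1) := by
      rw [← S.image_ball] at hvi
      exact (integrableOn_image_iff_integrableOn_abs_det_fderiv_smul volume measurableSet_ball
        (fun x _ => (S.hasFDerivAt hN x).hasFDerivWithinAt) h.injective.injOn _).mp hvi
    have e5 : ∫ x in ball 0 1, |(dilD N τ x).det| *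
        density A w ε (fun y => u (h.symm y)) (h x) ≤
        ∫ x in ball 0 1, (density A w ε u x + τ * innerVar A w ε (n * L / c) N u x +
          τ ^ 2 * P x) :=
      setIntegral_mono_on e4 ((hdi.add (hii.const_mul τ)).add (hPi.const_mul (τ ^ 2)))
        measurableSet_ball fun x hx => S.det_mul_density_le hn hN H hu hτ.le hN0 hD hτD hx
    have e6 : ∫ x in ball 0 1, (density A w ε u x + τ * innerVar A w ε (n * L / c) N u x +
          τ ^ 2 * P x) = (∫ x in ball 0 1, density A w ε u x) + τ * I +
          τ ^ 2 * ∫ x in ball 0 1, P x := by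
      have a1 := integral_add (hdi.add (hii.const_mul τ)) (hPi.const_mul (τ ^ 2))
      have a2 := integral_add hdi (hii.const_mul τ)
      rw [integral_const_mul] at a1 a2
      rw [hI, ← a2]
      exact a1
    have e7 : 1 / (2 * ε ^ 2) * ∫ x in ball 0 1, w x * ‖u (h.symm x) - u x‖ ^ 2 ≤
        1 / (2 * ε ^ 2) * (τ ^ 2 *
          (c⁻¹ * (4 * D ^ 2 * (∫⁻ x in ball 0 1, ‖fderiv ℝ u x‖ₑ ^ 2).toReal))) := by
      gcongr
    have e8 : 0 ≤ τ * (I + τ * R) := by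
      have : τ * (I + τ * R) = τ * I + τ ^ 2 * (∫ x in ball 0 1, P x) +
          1 / (2 * ε ^ 2) * (τ ^ 2 *
          (c⁻¹ * (4 * D ^ 2 * (∫⁻ x in ball 0 1, ‖fderiv ℝ u x‖ₑ ^ 2).toReal))) := by
        rw [hR]
        ring
      rw [this]
      linarith
    exact nonneg_of_mul_nonneg_right e8 hτ
  have hlim : Filter.Tendsto (fun τ : ℝ => I + τ * R) (𝓝[>] 0) (𝓝 (I + 0 * R)) := by
    refine Filter.Tendsto.mono_left (Continuous.tendsto (by fun_prop) _) nhdsWithin_le_nhds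
  rw [zero_mul, add_zero] at hlim
  refine ge_of_tendsto hlim ?_
  filter_upwards [Ioc_mem_nhdsGT (show (0 : ℝ) < min τ₀ (1 / Q) by positivity)] with τ hτ
  exact key τ hτ.1 hτ.2

end

section

lemma ContDiff.matrix_det {E : Type*} [NormedAddCommGroup E] [NormedSpace ℝ E] {n : ℕ}
    {m : WithTop ℕ∞} {B : E → Matrix (Fin n) (Fin n) ℝ}
    (hB : ∀ i j, ContDiff ℝ m fun x => B x i j) : ContDiff ℝ m fun x => (B x).det := by
  simp only [Matrix.det_apply, Units.smul_def, zsmul_eq_mul]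
  exact ContDiff.sum fun σ _ => contDiff_const.mul (contDiff_prod fun i _ => hB _ _)

/-- The quadratic form of a matrix. -/
def quad {n : ℕ} (M : Fin n → Fin n → ℝ) (ξ : Fin n → ℝ) : ℝ := ∑ i, ∑ j, M i j * ξ i * ξ j

/-- Symmetric matrices with spectrum in `[lam, lam⁻¹]`. -/
def ellipticSet (n : ℕ) (lam : ℝ) : Set (Fin n → Fin n → ℝ) :=
  {M | (∀ i j, M i j = M j i) ∧
    ∀ ξ : Fin n → ℝ, lam * ∑ i, ξ i ^ 2 ≤ quad M ξ ∧ quad M ξ ≤ lam⁻¹ * ∑ i, ξ i ^ 2}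

lemma quad_add_smul {n : ℕ} {M : Fin n → Fin n → ℝ} (hM : ∀ i j, M i j = M j i)
    (ξ η : Fin n → ℝ) (t : ℝ) : quad M (ξ + t • η) =
      quad M ξ + 2 * t * (∑ i, ∑ j, M i j * ξ i * η j) + t ^ 2 * quad M η := by
  have h : ∑ i, ∑ j, M i j * ξ i * η j = ∑ i, ∑ j, M i j * η i * ξ j := by
    rw [Finset.sum_comm]
    refine Finset.sum_congr rfl fun i _ => Finset.sum_congr rfl fun j _ => ?_
    rw [hM j i]
    ring
  have h2 : 2 * t * (∑ i, ∑ j, M i j * ξ i * η j) =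
      t * (∑ i, ∑ j, M i j * ξ i * η j) + t * (∑ i, ∑ j, M i j * η i * ξ j) := by
    rw [← h]
    ring
  rw [h2]
  simp only [quad, Finset.mul_sum, ← Finset.sum_add_distrib, Pi.add_apply, Pi.smul_apply,
    smul_eq_mul]
  refine Finset.sum_congr rfl fun i _ => Finset.sum_congr rfl fun j _ => ?_
  ring

lemma convex_ellipticSet (n : ℕ) (lam : ℝ) : Convex ℝ (ellipticSet n lam) := by
  intro M hM M' hM' a b ha hb hab
  have h : ∀ ξ, quad (a • M + b • M') ξ = a * quad M ξ + b * quad M' ξ := by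
    intro ξ
    simp only [quad, Finset.mul_sum, ← Finset.sum_add_distrib, Pi.add_apply, Pi.smul_apply,
      smul_eq_mul]
    refine Finset.sum_congr rfl fun i _ => Finset.sum_congr rfl fun j _ => ?_
    ring
  refine ⟨fun i j => ?_, fun ξ => ?_⟩
  · simp only [Pi.add_apply, Pi.smul_apply, hM.1 i j, hM'.1 i j]
  · rw [h]
    have h1 := hM.2 ξ
    have h2 := hM'.2 ξ
    have h3 : ∀ s : ℝ, s = a * s + b * s := fun s => by rw [← add_mul, hab, one_mul]
    rw [h3 (lam * _), h3 (lam⁻¹ * _)]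
    constructor
    · exact add_le_add (mul_le_mul_of_nonneg_left h1.1 ha) (mul_le_mul_of_nonneg_left h2.1 hb)
    · exact add_le_add (mul_le_mul_of_nonneg_left h1.2 ha) (mul_le_mul_of_nonneg_left h2.2 hb)

lemma abs_entry_le_of_mem_ellipticSet {n : ℕ} {lam : ℝ} (hlam : 0 < lam)
    {M : Fin n → Fin n → ℝ} (hM : M ∈ ellipticSet n lam) (i j : Fin n) :
    |M i j| ≤ 2 * lam⁻¹ := by
  have hs : ∀ k : Fin n, ∑ i, (Pi.single k (1 : ℝ) : Fin n → ℝ) i ^ 2 = 1 := by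
    intro k
    simp [Pi.single_apply]
  have hq : ∑ a, ∑ b, M a b * (Pi.single i (1 : ℝ) : Fin n → ℝ) a *
      (Pi.single j (1 : ℝ) : Fin n → ℝ) b = M i j := by
    simp [Pi.single_apply]
  have hi := (hM.2 (Pi.single i 1)).2
  have hj := (hM.2 (Pi.single j 1)).2
  rw [hs, mul_one] at hi hj
  have hpos : ∀ ξ, 0 ≤ quad M ξ := fun ξ =>
    (mul_nonneg hlam.le (Finset.sum_nonneg fun _ _ => sq_nonneg _)).trans (hM.2 ξ).1
  have h1 := hpos (Pi.single i 1 + (1 : ℝ) • Pi.single j 1)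
  have h2 := hpos (Pi.single i 1 + (-1 : ℝ) • Pi.single j 1)
  rw [quad_add_smul hM.1, hq] at h1 h2
  have : 0 < lam⁻¹ := by positivity
  rw [abs_le]
  constructor <;> linarith

lemma isCompact_ellipticSet (n : ℕ) {lam : ℝ} (hlam : 0 < lam) :
    IsCompact (ellipticSet n lam) := by
  have hq : ∀ ξ, Continuous fun M : Fin n → Fin n → ℝ => quad M ξ := fun ξ => by
    unfold quad
    fun_prop
  refine Metric.isCompact_of_isClosed_isBounded ?_ ?_
  · have : ellipticSet n lam = (⋂ i, ⋂ j, {M | M i j = M j i}) ∩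
        ⋂ ξ : Fin n → ℝ, ({M | lam * ∑ i, ξ i ^ 2 ≤ quad M ξ} ∩
          {M | quad M ξ ≤ lam⁻¹ * ∑ i, ξ i ^ 2}) := by
      ext M
      simp [ellipticSet]
    rw [this]
    refine IsClosed.inter (isClosed_iInter fun i => isClosed_iInter fun j =>
      isClosed_eq (by fun_prop) (by fun_prop)) (isClosed_iInter fun ξ =>
        (isClosed_le continuous_const (hq ξ)).inter (isClosed_le (hq ξ) continuous_const))
  · refine (isBounded_closedBall (x := 0) (r := 2 * lam⁻¹)).subset fun M hM => ?_
    rw [mem_closedBall_zero_iff, pi_norm_le_iff_of_nonneg (by positivity)]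
    intro i
    rw [pi_norm_le_iff_of_nonneg (by positivity)]
    exact fun j => abs_entry_le_of_mem_ellipticSet hlam hM i j

lemma posDef_of_mem_ellipticSet {n : ℕ} {lam : ℝ} (hlam : 0 < lam) {M : Fin n → Fin n → ℝ}
    (hM : M ∈ ellipticSet n lam) : (Matrix.of M).PosDef := by
  refine Matrix.PosDef.of_dotProduct_mulVec_pos ?_ fun ξ hξ => ?_
  · ext i j
    simp [hM.1 j i]
  · have h1 : star ξ ⬝ᵥ (Matrix.of M).mulVec ξ = quad M ξ := by
      simp only [dotProduct, Matrix.mulVec, Pi.star_apply, star_trivial, Matrix.of_apply, quad,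
        Finset.mul_sum]
      refine Finset.sum_congr rfl fun i _ => Finset.sum_congr rfl fun j _ => ?_
      ring
    rw [h1]
    refine lt_of_lt_of_le (mul_pos hlam ?_) (hM.2 ξ).1
    obtain ⟨i, hi⟩ := Function.ne_iff.mp hξ
    exact Finset.sum_pos' (fun _ _ => sq_nonneg _) ⟨i, Finset.mem_univ _, by
      have : ξ i ≠ 0 := hi
      positivity⟩

lemma le_quad_inv {n : ℕ} {lam : ℝ} (hlam : 0 < lam) {M : Fin n → Fin n → ℝ}
    (hM : M ∈ ellipticSet n lam) (η : Fin n → ℝ) :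
    lam * ∑ i, η i ^ 2 ≤ quad ((Matrix.of M)⁻¹ : Matrix (Fin n) (Fin n) ℝ) η := by
  have hdet : IsUnit (Matrix.of M).det := (posDef_of_mem_ellipticSet hlam hM).det_pos.ne'.isUnit
  set ξ := (Matrix.of M)⁻¹.mulVec η with hξ
  have h1 : (Matrix.of M).mulVec ξ = η := by
    rw [hξ, Matrix.mulVec_mulVec, Matrix.mul_nonsing_inv _ hdet, Matrix.one_mulVec]
  have h2 : quad ((Matrix.of M)⁻¹ : Matrix (Fin n) (Fin n) ℝ) η = ∑ i, ξ i * η i := by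
    simp only [quad, hξ, Matrix.mulVec, dotProduct, Finset.sum_mul]
    refine Finset.sum_congr rfl fun i _ => Finset.sum_congr rfl fun j _ => ?_
    ring
  have h3 : ∀ i, ∑ j, M i j * ξ j = η i := fun i => congrFun h1 i
  have h4 : quad M ξ = ∑ i, ξ i * η i := by
    simp only [quad, ← h3, Finset.mul_sum]
    refine Finset.sum_congr rfl fun i _ => Finset.sum_congr rfl fun j _ => ?_
    ring
  have h5 : ∑ i, ∑ j, M i j * ξ i * η j = ∑ i, η i ^ 2 := by
    rw [Finset.sum_comm]
    refine Finset.sum_congr rfl fun i _ => ?_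
    rw [sq]
    nth_rewrite 2 [← h3 i]
    rw [Finset.sum_mul]
    refine Finset.sum_congr rfl fun j _ => ?_
    rw [hM.1 j i]
  have h6 : 0 ≤ quad M (ξ + (-lam) • η) :=
    (mul_nonneg hlam.le (Finset.sum_nonneg fun _ _ => sq_nonneg _)).trans (hM.2 _).1
  rw [quad_add_smul hM.1, h5, h4, ← h2] at h6
  have h7 : lam ^ 2 * quad M η ≤ lam * ∑ i, η i ^ 2 := by
    calc lam ^ 2 * quad M η ≤ lam ^ 2 * (lam⁻¹ * ∑ i, η i ^ 2) := by
          gcongr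
          exact (hM.2 η).2
      _ = lam * ∑ i, η i ^ 2 := by field_simp
  linarith

/-- The volume density, its inverse, the weighted inverse metric and the inverse metric. -/
def metricData {n : ℕ} (M : Fin n → Fin n → ℝ) :
    ℝ × ℝ × (Fin n → Fin n → ℝ) × (Fin n → Fin n → ℝ) :=
  (√(Matrix.of M).det, (√(Matrix.of M).det)⁻¹, fun i j => √(Matrix.of M).det * (Matrix.of M)⁻¹ i j,
    fun i j => (Matrix.of M)⁻¹ i j)

lemma contDiffOn_metricData (n : ℕ) {lam : ℝ} (hlam : 0 < lam) :
    ContDiffOn ℝ 1 (metricData (n := n)) (ellipticSet n lam) := by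
  intro M hM
  have hpos := (posDef_of_mem_ellipticSet hlam hM).det_pos
  have h1 : ContDiffAt ℝ 1 (fun M : Fin n → Fin n → ℝ => (Matrix.of M).det) M := by
    refine (ContDiff.matrix_det fun i j => ?_).contDiffAt
    simp only [Matrix.of_apply]
    fun_prop
  have h2 := h1.sqrt hpos.ne'
  have h3 : ContDiffAt ℝ 1 (fun M : Fin n → Fin n → ℝ => fun i j => (Matrix.of M)⁻¹ i j) M := by
    refine contDiffAt_pi.mpr fun i => contDiffAt_pi.mpr fun j => ?_
    simp only [Matrix.inv_def, Ring.inverse_eq_inv', Matrix.smul_apply, smul_eq_mul,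
      Matrix.adjugate_apply]
    refine (h1.inv hpos.ne').mul (ContDiff.matrix_det fun a b => ?_).contDiffAt
    by_cases h : a = j
    · subst h
      simp only [Matrix.updateRow_self]
      exact contDiff_const
    · simp only [Matrix.updateRow_ne h, Matrix.of_apply]
      fun_prop
  refine ContDiffAt.contDiffWithinAt ?_
  refine h2.prodMk ((h2.inv (Real.sqrt_pos.mpr hpos).ne').prodMk (ContDiffAt.prodMk ?_ h3))
  refine contDiffAt_pi.mpr fun i => contDiffAt_pi.mpr fun j => ?_
  exact h2.mul (contDiffAt_pi.mp (contDiffAt_pi.mp h3 i) j)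

lemma exists_metricData_bound (n : ℕ) {lam : ℝ} (hlam : 0 < lam) :
    ∃ K : ℝ, 0 < K ∧ (∀ M ∈ ellipticSet n lam, ‖metricData M‖ ≤ K) ∧
      ∀ M ∈ ellipticSet n lam, ∀ M' ∈ ellipticSet n lam,
        ‖metricData M - metricData M'‖ ≤ K * ‖M - M'‖ := by
  have hc := contDiffOn_metricData n hlam
  obtain ⟨a, ha⟩ := (isCompact_ellipticSet n hlam).exists_bound_of_continuousOn hc.continuousOn
  obtain ⟨b, hb⟩ := hc.exists_lipschitzOnWith one_ne_zero (convex_ellipticSet n lam)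
    (isCompact_ellipticSet n hlam)
  refine ⟨max 1 (max a b), by positivity, fun M hM => ?_, fun M hM M' hM' => ?_⟩
  · exact (ha M hM).trans ((le_max_left _ _).trans (le_max_right _ _))
  · have := hb.dist_le_mul M hM M' hM'
    rw [dist_eq_norm, dist_eq_norm] at this
    refine this.trans ?_
    gcongr
    exact (le_max_right _ _).trans (le_max_right _ _)

end

section

/-- The inverse metric weighted by the volume density. -/
def metricCoeff {n : ℕ} (g : Euc n → Matrix (Fin n) (Fin n) ℝ) (x : Euc n) :
    Matrix (Fin n) (Fin n) ℝ := sqrtDet g x • (g x)⁻¹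

lemma bil_smul_left {n : ℕ} (a : ℝ) (M : Matrix (Fin n) (Fin n) ℝ) (p q : Fin n → ℂ) :
    bil (a • M) p q = a * bil M p q := by
  simp only [bil, Finset.mul_sum, Matrix.smul_apply, smul_eq_mul, mul_assoc]

lemma bil_self_eq_quad {n : ℕ} (M : Matrix (Fin n) (Fin n) ℝ) (p : Fin n → ℂ) :
    bil M p p = quad M (fun i => (p i).re) + quad M (fun i => (p i).im) := by
  simp only [bil, quad, ← Finset.sum_add_distrib, rdot]
  refine Finset.sum_congr rfl fun i _ => Finset.sum_congr rfl fun j _ => ?_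
  exact (mul_add _ _ _).trans (by rw [mul_assoc, mul_assoc])

lemma mul_sum_le_bil_inv {n : ℕ} {lam : ℝ} (hlam : 0 < lam) {M : Matrix (Fin n) (Fin n) ℝ}
    (hM : (fun i j => M i j) ∈ ellipticSet n lam) (p : Fin n → ℂ) :
    lam * ∑ i, ‖p i‖ ^ 2 ≤ bil M⁻¹ p p := by
  have h1 := le_quad_inv hlam hM fun i => (p i).re
  have h2 := le_quad_inv hlam hM fun i => (p i).im
  have h3 : ∑ i, ‖p i‖ ^ 2 = ∑ i, (p i).re ^ 2 + ∑ i, (p i).im ^ 2 := by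
    rw [← Finset.sum_add_distrib]
    refine Finset.sum_congr rfl fun i _ => ?_
    rw [Complex.sq_norm, Complex.normSq_apply]
    ring
  rw [bil_self_eq_quad, h3, mul_add]
  exact add_le_add h1 h2

lemma MemM.mem_ellipticSet {n : ℕ} {lam Lam : ℝ} {g : Euc n → Matrix (Fin n) (Fin n) ℝ}
    (hg : MemM n lam Lam g) {x : Euc n} (hx : x ∈ ball (0 : Euc n) 1) :
    (fun i j => g x i j) ∈ ellipticSet n lam :=
  ⟨fun i j => (hg.2.1 x hx).1.apply j i, fun ξ => hg.2.2.2 x hx ξ⟩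

lemma MemM.norm_sub_le {n : ℕ} {lam Lam : ℝ} (hLam : 0 < Lam)
    {g : Euc n → Matrix (Fin n) (Fin n) ℝ} (hg : MemM n lam Lam g) {x y : Euc n}
    (hx : x ∈ ball (0 : Euc n) 1) (hy : y ∈ ball (0 : Euc n) 1) :
    ‖(fun i j => g x i j) - fun i j => g y i j‖ ≤ Lam * ‖x - y‖ := by
  rw [pi_norm_le_iff_of_nonneg (by positivity)]
  intro i
  rw [pi_norm_le_iff_of_nonneg (by positivity)]
  intro j
  have := (hg.2.2.1 i j).dist_le_mul x hx y hy
  rw [Real.coe_toNNReal _ hLam.le, dist_eq_norm, dist_eq_norm] at this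
  exact this

lemma abs_entry_le_norm {n : ℕ} (M : Fin n → Fin n → ℝ) (i j : Fin n) : |M i j| ≤ ‖M‖ :=
  (norm_le_pi_norm (M i) j).trans (norm_le_pi_norm M i)

/-- Uniform structural constants of the coefficients attached to the class of metrics. -/
lemma exists_ellipticCoeff (n : ℕ) {lam Lam : ℝ} (hlam : 0 < lam) (hLam : 0 < Lam) :
    ∃ c L : ℝ, 0 < c ∧ 0 ≤ L ∧ ∀ g, MemM n lam Lam g →
      EllipticCoeff n (metricCoeff g) (sqrtDet g) c L ∧
      ∀ x ∈ ball (0 : Euc n) 1, ∀ i j, |(g x)⁻¹ i j - (1 : Matrix (Fin n) (Fin n) ℝ) i j| ≤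
        L * ‖x‖ := by
  obtain ⟨K, hK0, hK, hKL⟩ := exists_metricData_bound n hlam
  set c := K⁻¹ * min 1 lam with hc
  have hc0 : 0 < c := by positivity
  have hcK : c ≤ K⁻¹ := mul_le_of_le_one_right (by positivity) (min_le_left _ _)
  have hKc : K ≤ c⁻¹ := by
    rw [le_inv_comm₀ hK0 hc0]
    exact hcK
  refine ⟨c, K * Lam, hc0, by positivity, fun g hg => ?_⟩
  have hmem := fun {x} hx => hg.mem_ellipticSet (x := x) hx
  have hpos : ∀ x ∈ ball (0 : Euc n) 1, 0 < sqrtDet g x := fun x hx =>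
    Real.sqrt_pos.mpr (hg.2.1 x hx).2.det_pos
  have hlip : ∀ x ∈ ball (0 : Euc n) 1, ∀ y ∈ ball (0 : Euc n) 1,
      ‖metricData (fun i j => g x i j) - metricData (fun i j => g y i j)‖ ≤
        K * Lam * ‖x - y‖ := by
    intro x hx y hy
    refine (hKL _ (hmem hx) _ (hmem hy)).trans ?_
    rw [mul_assoc]
    gcongr
    exact hg.norm_sub_le hLam hx hy
  have hb := fun x hx => hK _ (hmem (x := x) hx)
  have hw : ∀ x ∈ ball (0 : Euc n) 1, K⁻¹ ≤ sqrtDet g x := by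
    intro x hx
    have h1 : ‖(sqrtDet g x)⁻¹‖ ≤ K :=
      (norm_fst_le _).trans ((norm_snd_le _).trans (hb x hx))
    rw [Real.norm_of_nonneg (inv_nonneg.mpr (hpos x hx).le)] at h1
    exact inv_le_of_inv_le₀ (hpos x hx) h1
  refine ⟨⟨hc0, by positivity, fun x hx => ?_, fun x hx p => ?_, fun x hx i j => ?_,
    fun x hx => hcK.trans (hw x hx), fun x hx => ?_, fun x hx y hy i j => ?_,
    fun x hx y hy => ?_⟩, fun x hx i j => ?_⟩
  · have : ((g x)⁻¹).IsSymm := by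
      rw [Matrix.IsSymm, Matrix.transpose_nonsing_inv, (hg.2.1 x hx).1]
    exact this.smul _
  · rw [metricCoeff, bil_smul_left]
    calc c * ∑ i, ‖p i‖ ^ 2 ≤ K⁻¹ * lam * ∑ i, ‖p i‖ ^ 2 := by
          refine mul_le_mul_of_nonneg_right ?_ (Finset.sum_nonneg fun _ _ => sq_nonneg _)
          rw [hc]
          gcongr
          exact min_le_right _ _
      _ = K⁻¹ * (lam * ∑ i, ‖p i‖ ^ 2) := mul_assoc _ _ _
      _ ≤ sqrtDet g x * bil (g x)⁻¹ p p := by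
          have h0 : 0 ≤ lam * ∑ i, ‖p i‖ ^ 2 :=
            mul_nonneg hlam.le (Finset.sum_nonneg fun _ _ => sq_nonneg _)
          exact mul_le_mul (hw x hx) (mul_sum_le_bil_inv hlam (hmem hx) p) h0 (hpos x hx).le
  · refine le_trans ?_ hKc
    refine ((abs_entry_le_norm _ i j).trans
      ((norm_fst_le _).trans ((norm_snd_le _).trans ((norm_snd_le _).trans (hb x hx)))))
  · exact (le_abs_self _).trans (((norm_fst_le _).trans (hb x hx)).trans hKc)
  · exact (abs_entry_le_norm _ i j).trans
      ((norm_fst_le _).trans ((norm_snd_le _).trans ((norm_snd_le _).trans (hlip x hx y hy))))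
  · exact (norm_fst_le _).trans (hlip x hx y hy)
  · have h0 : (0 : Euc n) ∈ ball (0 : Euc n) 1 := by simp
    have h1 := (abs_entry_le_norm _ i j).trans
      ((norm_snd_le _).trans ((norm_snd_le _).trans ((norm_snd_le _).trans (hlip x hx 0 h0))))
    have h2 : (g 0)⁻¹ = 1 := by rw [hg.1, inv_one]
    rw [sub_zero] at h1
    refine le_trans (le_of_eq ?_) h1
    rw [← h2]
    rfl

lemma density_metricCoeff {n : ℕ} (g : Euc n → Matrix (Fin n) (Fin n) ℝ) (ε : ℝ) (u : Euc n → ℂ)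
    (x : Euc n) :
    density (metricCoeff g) (sqrtDet g) ε u x = eDen g ε u x * sqrtDet g x := by
  rw [density, metricCoeff, bil_smul_left, eDen, potential]
  change sqrtDet g x * gradSq g u x / 2 + _ = _
  ring

lemma IsGLSol.weakSol {n : ℕ} {g : Euc n → Matrix (Fin n) (Fin n) ℝ} {ε c L : ℝ} {u : Euc n → ℂ}
    (H : EllipticCoeff n (metricCoeff g) (sqrtDet g) c L) (hu : IsGLSol n g ε u) :
    WeakSol n (metricCoeff g) (sqrtDet g) ε u := by
  obtain ⟨hd, h1, hi, hw⟩ := hu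
  refine ⟨hd, h1, fun i => ?_, fun ζ hζ hζs => ?_⟩
  · have hm := (measurable_pd u i).aestronglyMeasurable (μ := volume.restrict (ball (0 : Euc n) 1))
    rw [memLp_two_iff_integrable_sq_norm hm]
    refine Integrable.mono' (hi.const_mul (2 / c)) (hm.norm.pow 2)
      (ae_restrict_of_forall measurableSet_ball fun x hx => ?_)
    rw [Real.norm_of_nonneg (sq_nonneg _), ← density_metricCoeff, div_mul_eq_mul_div,
      le_div_iff₀ H.c_pos]
    have h2 := H.lower x hx (grad u x)
    have h3 : ‖pd u i x‖ ^ 2 ≤ ∑ k, ‖grad u x k‖ ^ 2 :=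
      Finset.single_le_sum (f := fun k => ‖grad u x k‖ ^ 2) (fun _ _ => sq_nonneg _)
        (Finset.mem_univ i)
    have h4 := mul_nonneg (H.w_pos hx).le (potential_nonneg ε (u x))
    have h5 := mul_le_mul_of_nonneg_left h3 H.c_pos.le
    rw [density]
    linarith
  · rw [← hw ζ hζ hζs]
    refine setIntegral_congr_fun measurableSet_ball fun x hx => ?_
    simp only [metricCoeff, bil_smul_left]
    change sqrtDet g x * bil (g x)⁻¹ (grad u x) (grad ζ x) - _ =
      (bil (g x)⁻¹ (grad u x) (grad ζ x) - _) * sqrtDet g x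
    ring

end

section

variable {n : ℕ} {g : Euc n → Matrix (Fin n) (Fin n) ℝ} {c L ε : ℝ} {u : Euc n → ℂ} {N : ℝ → ℝ}

lemma norm_smul_radD (g : Euc n → Matrix (Fin n) (Fin n) ℝ) (u : Euc n → ℂ) (x : Euc n) :
    ‖x‖ • radD g u x = ∑ i, ∑ j, ((g x)⁻¹ i j * x i) • pd u j x := by
  by_cases hx : x = 0
  · subst hx
    simp
  have hr : ‖x‖ ≠ 0 := norm_ne_zero_iff.mpr hx
  simp only [radD, Finset.smul_sum]
  refine Finset.sum_congr rfl fun i _ => Finset.sum_congr rfl fun j _ => ?_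
  rw [← Complex.real_smul, smul_smul]
  congr 1
  field_simp

lemma norm_smul_radD_sub_le {x : Euc n}
    (hinv : ∀ i j, |(g x)⁻¹ i j - (1 : Matrix (Fin n) (Fin n) ℝ) i j| ≤ L * ‖x‖) :
    ‖‖x‖ • radD g u x - fderiv ℝ u x x‖ ≤ n * L * ‖x‖ ^ 2 * ∑ j, ‖pd u j x‖ := by
  have h1 : fderiv ℝ u x x =
      ∑ i, ∑ j, ((1 : Matrix (Fin n) (Fin n) ℝ) i j * x i) • pd u j x := by
    rw [fderiv_apply_self]
    refine Finset.sum_congr rfl fun i _ => ?_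
    rw [Finset.sum_eq_single i]
    · simp
    · intro j _ hj
      simp [Matrix.one_apply_ne hj.symm]
    · simp
  rw [norm_smul_radD, h1]
  simp only [← Finset.sum_sub_distrib, ← sub_smul, ← sub_mul]
  calc ‖∑ i, ∑ j, (((g x)⁻¹ i j - (1 : Matrix (Fin n) (Fin n) ℝ) i j) * x i) • pd u j x‖
      ≤ ∑ i, ∑ j, ‖(((g x)⁻¹ i j - (1 : Matrix (Fin n) (Fin n) ℝ) i j) * x i) • pd u j x‖ :=
        (norm_sum_le _ _).trans (Finset.sum_le_sum fun i _ => norm_sum_le _ _)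
    _ ≤ ∑ i : Fin n, ∑ j, L * ‖x‖ * ‖x‖ * ‖pd u j x‖ := by
        refine Finset.sum_le_sum fun i _ => Finset.sum_le_sum fun j _ => ?_
        rw [norm_smul, norm_mul]
        have h0 : 0 ≤ L * ‖x‖ := (abs_nonneg _).trans (hinv i j)
        gcongr
        · exact hinv i j
        · exact PiLp.norm_apply_le x i
    _ = n * L * ‖x‖ ^ 2 * ∑ j, ‖pd u j x‖ := by
        simp only [Finset.sum_const, Finset.card_univ, Fintype.card_fin, nsmul_eq_mul,
          ← Finset.mul_sum]
        ring

lemma norm_radD_le (hL : 0 ≤ L) {x : Euc n} (hx : ‖x‖ ≤ 1)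
    (hinv : ∀ i j, |(g x)⁻¹ i j - (1 : Matrix (Fin n) (Fin n) ℝ) i j| ≤ L * ‖x‖) :
    ‖radD g u x‖ ≤ n * (1 + L) * ∑ j, ‖pd u j x‖ := by
  have hentry : ∀ i j, |(g x)⁻¹ i j| ≤ 1 + L := by
    intro i j
    have h1 : |(1 : Matrix (Fin n) (Fin n) ℝ) i j| ≤ 1 := by
      rw [Matrix.one_apply]
      split_ifs <;> simp
    have h2 : L * ‖x‖ ≤ L := mul_le_of_le_one_right hL hx
    have h3 := abs_add_le ((1 : Matrix (Fin n) (Fin n) ℝ) i j)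
      ((g x)⁻¹ i j - (1 : Matrix (Fin n) (Fin n) ℝ) i j)
    rw [add_sub_cancel] at h3
    linarith [hinv i j]
  calc ‖radD g u x‖
      ≤ ∑ i, ∑ j, ‖(((g x)⁻¹ i j * (x i / ‖x‖) : ℝ) : ℂ) * pd u j x‖ :=
        (norm_sum_le _ _).trans (Finset.sum_le_sum fun i _ => norm_sum_le _ _)
    _ ≤ ∑ i : Fin n, ∑ j, (1 + L) * 1 * ‖pd u j x‖ := by
        refine Finset.sum_le_sum fun i _ => Finset.sum_le_sum fun j _ => ?_
        rw [norm_mul, Complex.norm_real, norm_mul]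
        have h0 : 0 ≤ 1 + L := by positivity
        gcongr
        · exact hentry i j
        · rw [norm_div, norm_norm]
          exact div_le_one_of_le₀ (PiLp.norm_apply_le x i) (norm_nonneg _)
    _ = n * (1 + L) * ∑ j, ‖pd u j x‖ := by
        simp only [Finset.sum_const, Finset.card_univ, Fintype.card_fin, nsmul_eq_mul,
          ← Finset.mul_sum]
        ring

lemma bil_radGrad (u : Euc n → ℂ) (x : Euc n) : bil (metricCoeff g x) (radGrad u x) (grad u x) =
    sqrtDet g x * (‖x‖ * rdot (fderiv ℝ u x x) (radD g u x)) := by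
  have h : ‖x‖ * rdot (fderiv ℝ u x x) (radD g u x) =
      rdot (fderiv ℝ u x x) (‖x‖ • radD g u x) := by
    rw [rdot_eq_inner, rdot_eq_inner, inner_smul_right]
  rw [metricCoeff, bil_smul_left, h, norm_smul_radD]
  simp only [bil, rdot_eq_inner, inner_sum, inner_smul_right, radGrad, inner_smul_left, grad]
  simp [mul_assoc]

/-- The radial part of the inner variation is controlled by the radial derivative. -/
lemma bil_radGrad_le (H : EllipticCoeff n (metricCoeff g) (sqrtDet g) c L) {x : Euc n}
    (hx : x ∈ ball (0 : Euc n) 1)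
    (hinv : ∀ i j, |(g x)⁻¹ i j - (1 : Matrix (Fin n) (Fin n) ℝ) i j| ≤ L * ‖x‖) :
    bil (metricCoeff g x) (radGrad u x) (grad u x) ≤
      ‖x‖ ^ 2 * (‖radD g u x‖ ^ 2 * sqrtDet g x) +
        ‖x‖ ^ 2 * (2 * n ^ 3 * L * (1 + L) / c ^ 2 * ‖x‖ *
          density (metricCoeff g) (sqrtDet g) ε u x) := by
  have hc := H.c_pos
  have hL := H.L_nonneg
  have hr1 := (mem_ball_zero_iff.mp hx).le
  have hw := H.w_pos hx
  set S := ∑ j, ‖pd u j x‖ with hS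
  set Q := ∑ j, ‖pd u j x‖ ^ 2 with hQ
  have hS0 : 0 ≤ S := Finset.sum_nonneg fun _ _ => norm_nonneg _
  have hSQ : S ^ 2 ≤ n * Q := by
    have := sq_sum_le_card_mul_sum_sq (s := Finset.univ) (f := fun j => ‖pd u j x‖)
    simpa using this
  have h1 := norm_smul_radD_sub_le (u := u) hinv
  have h2 := norm_radD_le (u := u) hL hr1 hinv
  set R := radD g u x with hR
  set d := fderiv ℝ u x x - ‖x‖ • R with hd
  rw [norm_sub_rev] at h1
  have h3 : rdot (fderiv ℝ u x x) R = ‖x‖ * ‖R‖ ^ 2 + rdot d R := by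
    rw [hd, rdot_eq_inner, rdot_eq_inner, inner_sub_left, inner_smul_left,
      real_inner_self_eq_norm_sq]
    simp
  have h4 : rdot d R ≤ n ^ 3 * L * (1 + L) * ‖x‖ ^ 2 * Q := by
    calc rdot d R ≤ ‖d‖ * ‖R‖ := (le_abs_self _).trans (abs_rdot_le _ _)
      _ ≤ (n * L * ‖x‖ ^ 2 * S) * (n * (1 + L) * S) := by gcongr
      _ = n ^ 2 * L * (1 + L) * ‖x‖ ^ 2 * S ^ 2 := by ring
      _ ≤ n ^ 2 * L * (1 + L) * ‖x‖ ^ 2 * (n * Q) := by gcongr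
      _ = n ^ 3 * L * (1 + L) * ‖x‖ ^ 2 * Q := by ring
  have h5 : Q ≤ 2 * density (metricCoeff g) (sqrtDet g) ε u x / c := by
    rw [le_div_iff₀ hc]
    have h6 := H.lower x hx (grad u x)
    have h7 := mul_nonneg hw.le (potential_nonneg ε (u x))
    have h8 : ∑ i, ‖grad u x i‖ ^ 2 = Q := rfl
    rw [h8] at h6
    rw [density]
    linarith
  have hE := H.density_nonneg hx ε u
  have h6 : sqrtDet g x * Q ≤ c⁻¹ * (2 * density (metricCoeff g) (sqrtDet g) ε u x / c) :=
    mul_le_mul (H.w_upper x hx) h5 (Finset.sum_nonneg fun _ _ => sq_nonneg _) (by positivity)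
  rw [bil_radGrad, ← hR, h3]
  calc sqrtDet g x * (‖x‖ * (‖x‖ * ‖R‖ ^ 2 + rdot d R))
      = ‖x‖ ^ 2 * (‖R‖ ^ 2 * sqrtDet g x) + sqrtDet g x * ‖x‖ * rdot d R := by ring
    _ ≤ ‖x‖ ^ 2 * (‖R‖ ^ 2 * sqrtDet g x) +
        sqrtDet g x * ‖x‖ * (n ^ 3 * L * (1 + L) * ‖x‖ ^ 2 * Q) := by gcongr
    _ = ‖x‖ ^ 2 * (‖R‖ ^ 2 * sqrtDet g x) +
        n ^ 3 * L * (1 + L) * ‖x‖ ^ 3 * (sqrtDet g x * Q) := by ring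
    _ ≤ ‖x‖ ^ 2 * (‖R‖ ^ 2 * sqrtDet g x) + n ^ 3 * L * (1 + L) * ‖x‖ ^ 3 *
        (c⁻¹ * (2 * density (metricCoeff g) (sqrtDet g) ε u x / c)) := by gcongr
    _ = _ := by
        field_simp

lemma memLp_radD (H : EllipticCoeff n (metricCoeff g) (sqrtDet g) c L)
    (hinv : ∀ x ∈ ball (0 : Euc n) 1, ∀ i j,
      |(g x)⁻¹ i j - (1 : Matrix (Fin n) (Fin n) ℝ) i j| ≤ L * ‖x‖)
    (hu : WeakSol n (metricCoeff g) (sqrtDet g) ε u) :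
    MemLp (radD g u) 2 (volume.restrict (ball 0 1)) := by
  have hm : AEStronglyMeasurable (radD g u) (volume.restrict (ball 0 1)) := by
    have hG : ∀ i j, AEMeasurable (fun x => (g x)⁻¹ i j) (volume.restrict (ball 0 1)) := by
      intro i j
      have h1 : ContinuousOn (fun x => (sqrtDet g x)⁻¹ * metricCoeff g x i j)
          (ball (0 : Euc n) 1) :=
        (H.continuousOn_w.inv₀ fun x hx => (H.w_pos hx).ne').mul (H.continuousOn_entry i j)
      refine (h1.congr fun x hx => ?_).aemeasurable measurableSet_ball
      have := (H.w_pos hx).ne'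
      simp only [metricCoeff, Matrix.smul_apply, smul_eq_mul]
      field_simp
    refine AEMeasurable.aestronglyMeasurable ?_
    unfold radD
    refine Finset.aemeasurable_fun_sum _ fun i _ => Finset.aemeasurable_fun_sum _ fun j _ => ?_
    refine AEMeasurable.mul (Complex.measurable_ofReal.comp_aemeasurable
      ((hG i j).mul (Measurable.aemeasurable ?_))) (measurable_pd u j).aemeasurable
    fun_prop
  have hs : MemLp (fun x => ∑ j, ‖pd u j x‖) 2 (volume.restrict (ball 0 1)) :=
    memLp_finsetSum _ fun j _ => (hu.memLp j).norm
  refine hs.of_le_mul (c := n * (1 + L)) hm (ae_restrict_of_forall measurableSet_ball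
    fun x hx => ?_)
  rw [Real.norm_of_nonneg (Finset.sum_nonneg fun _ _ => norm_nonneg _)]
  exact norm_radD_le H.L_nonneg (mem_ball_zero_iff.mp hx).le (hinv x hx)

lemma integrableOn_radD_sq (H : EllipticCoeff n (metricCoeff g) (sqrtDet g) c L)
    (hinv : ∀ x ∈ ball (0 : Euc n) 1, ∀ i j,
      |(g x)⁻¹ i j - (1 : Matrix (Fin n) (Fin n) ℝ) i j| ≤ L * ‖x‖)
    (hu : WeakSol n (metricCoeff g) (sqrtDet g) ε u) :
    IntegrableOn (fun x => ‖radD g u x‖ ^ 2 * sqrtDet g x) (ball (0 : Euc n) 1) := by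
  have h := H.integrableOn_w_mul ((memLp_radD H hinv hu).integrable_norm_pow two_ne_zero)
  simpa only [mul_comm] using h

/-- The inner variation inequality with all coefficient errors absorbed into one constant. -/
theorem integral_profile_le (hn : 3 ≤ n) (H : EllipticCoeff n (metricCoeff g) (sqrtDet g) c L)
    (hinv : ∀ x ∈ ball (0 : Euc n) 1, ∀ i j,
      |(g x)⁻¹ i j - (1 : Matrix (Fin n) (Fin n) ℝ) i j| ≤ L * ‖x‖)
    (hu : WeakSol n (metricCoeff g) (sqrtDet g) ε u) {C : ℝ} (hC1 : n * L / c ≤ C)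
    (hC2 : 2 * n ^ 3 * L * (1 + L) / c ^ 2 ≤ C) (hN : ContDiff ℝ 1 N) (hN0 : ∀ v, 0 ≤ N v)
    (hN1 : ∀ v, deriv N v ≤ 0) {ρ : ℝ} (hρ : 0 ≤ ρ) (hρ1 : ρ < 1)
    (hNρ : ∀ v, ρ ^ 2 ≤ v → N v = 0) :
    ∫ x in ball 0 1, (-2 * ‖x‖ ^ 2 * deriv N (‖x‖ ^ 2)) * (1 - C * ‖x‖) *
        density (metricCoeff g) (sqrtDet g) ε u x ≤
      ∫ x in ball 0 1, (N (‖x‖ ^ 2) * ((n - 2 + C * ‖x‖) *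
        density (metricCoeff g) (sqrtDet g) ε u x + 2 * (sqrtDet g x * potential ε (u x))) +
        (-2 * ‖x‖ ^ 2 * deriv N (‖x‖ ^ 2)) * (‖radD g u x‖ ^ 2 * sqrtDet g x)) := by
  have h0 := hN.continuous
  have h1 := hN.continuous_deriv_one
  have hdi := H.integrableOn_density ε hu.diff.continuousOn hu.le_one hu.memLp
  have hWi := H.integrableOn_w_mul hu.integrableOn_potential
  have hRi := integrableOn_radD_sq H hinv hu
  have hL := integrableOn_continuous_mul
    (m := fun x => (-2 * ‖x‖ ^ 2 * deriv N (‖x‖ ^ 2)) * (1 - C * ‖x‖)) (by fun_prop) hdi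
  have hR := (integrableOn_continuous_mul (m := fun x => N (‖x‖ ^ 2)) (by fun_prop)
    ((integrableOn_continuous_mul (m := fun x => n - 2 + C * ‖x‖) (by fun_prop) hdi).add
      (hWi.const_mul 2))).add (integrableOn_continuous_mul
        (m := fun x => -2 * ‖x‖ ^ 2 * deriv N (‖x‖ ^ 2)) (by fun_prop) hRi)
  rw [← sub_nonneg]
  have e1 := integral_sub hR hL
  refine le_trans (hu.integral_innerVar_nonneg hn H hN hN0 hρ hρ1 hNρ) (le_trans ?_ e1.le)
  refine setIntegral_mono_on (hu.integrableOn_innerVar H hN _) (hR.sub hL) measurableSet_ball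
    fun x hx => ?_
  have hE := H.density_nonneg hx ε u
  have hb := bil_radGrad_le (u := u) (ε := ε) H hx (hinv x hx)
  set E := density (metricCoeff g) (sqrtDet g) ε u x with hEdef
  have hb2 : bil (metricCoeff g x) (radGrad u x) (grad u x) ≤
      ‖x‖ ^ 2 * (‖radD g u x‖ ^ 2 * sqrtDet g x) + ‖x‖ ^ 2 * (C * ‖x‖ * E) := by
    refine hb.trans ?_
    gcongr
  have hb3 := mul_le_mul_of_nonneg_left hb2 (neg_nonneg.mpr (hN1 (‖x‖ ^ 2)))
  have hb4 : N (‖x‖ ^ 2) * (n * L / c * ‖x‖ * E) ≤ N (‖x‖ ^ 2) * (C * ‖x‖ * E) := by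
    have := hN0 (‖x‖ ^ 2)
    gcongr
  simp only [innerVar, Pi.add_apply, ← hEdef]
  linarith

end

section

/-- The inequality obtained from radial inner variations, for the nonincreasing profile `N` as a
function of `‖x‖ ^ 2`: here `e` is the energy density, `V` the potential term and `R` the squared
radial derivative. -/
def ProfileInequality (n : ℕ) (C : ℝ) (e V R : Euc n → ℝ) : Prop :=
  ∀ (N : ℝ → ℝ) (ρ : ℝ), ContDiff ℝ 1 N → (∀ v, 0 ≤ N v) → (∀ v, deriv N v ≤ 0) → 0 ≤ ρ →
    ρ < 1 → (∀ v, ρ ^ 2 ≤ v → N v = 0) →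
    ∫ x in ball 0 1, (-2 * ‖x‖ ^ 2 * deriv N (‖x‖ ^ 2)) * (1 - C * ‖x‖) * e x ≤
      ∫ x in ball 0 1, (N (‖x‖ ^ 2) * ((n - 2 + C * ‖x‖) * e x + V x) +
        (-2 * ‖x‖ ^ 2 * deriv N (‖x‖ ^ 2)) * R x)

/-- A profile with prescribed logarithmic derivative. -/
lemma exists_profile {F : ℝ → ℝ} {σ ρ : ℝ} (hσ : 0 < σ) (hσρ : σ ≤ ρ) (hF : Continuous F)
    (hF0 : ∀ s, 0 ≤ F s) (hFσ : ∀ s ≤ σ, F s = 0) (hFρ : ∀ s, ρ ≤ s → F s = 0) :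
    ∃ N : ℝ → ℝ, ContDiff ℝ 1 N ∧ (∀ v, 0 ≤ N v) ∧ (∀ v, deriv N v ≤ 0) ∧
      (∀ v, ρ ^ 2 ≤ v → N v = 0) ∧
      ∀ r, 0 ≤ r → N (r ^ 2) = ∫ s in r..ρ, F s / s ∧ -2 * r ^ 2 * deriv N (r ^ 2) = F r := by
  set κ : ℝ → ℝ := fun v => F (√v) / (2 * max v (σ ^ 2)) with hκ
  have hmax : ∀ v, 0 < max v (σ ^ 2) := fun v => lt_max_of_lt_right (by positivity)
  have hκc : Continuous κ := by
    refine Continuous.div (by fun_prop) (by fun_prop) fun v => ?_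
    have := hmax v
    positivity
  have hκ0 : ∀ v, 0 ≤ κ v := fun v => div_nonneg (hF0 _) (by have := hmax v; positivity)
  have hκρ : ∀ v, ρ ^ 2 ≤ v → κ v = 0 := fun v hv => by
    rw [hκ]
    simp only
    rw [hFρ _ (Real.le_sqrt_of_sq_le hv), zero_div]
  have hκs : ∀ s, 0 ≤ s → κ (s ^ 2) * (2 * s) = F s / s ∧ 2 * s ^ 2 * κ (s ^ 2) = F s := by
    intro s hs
    have e : κ (s ^ 2) = F s / (2 * max (s ^ 2) (σ ^ 2)) := by rw [hκ]; simp [Real.sqrt_sq hs]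
    rw [e]
    rcases le_or_gt s σ with h | h
    · simp [hFσ s h]
    · have : 0 < s := hσ.trans h
      rw [max_eq_left (by gcongr)]
      constructor <;> field_simp
  have hderiv : ∀ v, HasDerivAt (fun v => ∫ t in v..ρ ^ 2, κ t) (-κ v) v := fun v =>
    intervalIntegral.integral_hasDerivAt_left (hκc.intervalIntegrable _ _)
      (hκc.stronglyMeasurableAtFilter _ _) hκc.continuousAt
  have hd : deriv (fun v => ∫ t in v..ρ ^ 2, κ t) = fun v => -κ v :=
    funext fun v => (hderiv v).deriv
  have hzero : ∀ v, ρ ^ 2 ≤ v → ∫ t in v..ρ ^ 2, κ t = 0 := fun v hv => by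
    refine intervalIntegral.integral_zero_ae (Filter.Eventually.of_forall fun t ht => hκρ t ?_)
    rw [Set.uIoc_of_ge hv] at ht
    exact ht.1.le
  refine ⟨fun v => ∫ t in v..ρ ^ 2, κ t, ?_, fun v => ?_, fun v => ?_, fun v hv => ?_,
    fun r hr => ⟨?_, ?_⟩⟩
  · rw [contDiff_one_iff_deriv, hd]
    exact ⟨fun v => (hderiv v).differentiableAt, hκc.neg⟩
  · rcases le_total v (ρ ^ 2) with h | h
    · exact intervalIntegral.integral_nonneg h fun t _ => hκ0 t
    · exact (hzero v h).ge
  · rw [hd]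
    exact neg_nonpos.mpr (hκ0 v)
  · exact hzero v hv
  · have h1 := intervalIntegral.integral_comp_mul_deriv (a := r) (b := ρ) (f := fun s => s ^ 2)
      (f' := fun s => 2 * s) (g := κ) (fun s _ => by simpa using hasDerivAt_pow 2 s)
      (by fun_prop) hκc
    refine h1.symm.trans (intervalIntegral.integral_congr fun s hs => ?_)
    exact (hκs s ((le_min hr (hσ.le.trans hσρ)).trans hs.1)).1
  · rw [hd]
    have := (hκs r hr).2
    linarith

/-- The profile inequality in terms of the logarithmic derivative of the profile. -/
lemma ProfileInequality.radial {n : ℕ} {C : ℝ} {e V R : Euc n → ℝ}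
    (hP : ProfileInequality n C e V R) {F : ℝ → ℝ} {σ ρ : ℝ} (hσ : 0 < σ) (hσρ : σ ≤ ρ)
    (hρ : ρ < 1) (hF : Continuous F) (hF0 : ∀ s, 0 ≤ F s) (hFσ : ∀ s ≤ σ, F s = 0)
    (hFρ : ∀ s, ρ ≤ s → F s = 0) :
    ∫ x in ball 0 1, F ‖x‖ * (1 - C * ‖x‖) * e x ≤
      ∫ x in ball 0 1, ((∫ s in ‖x‖..ρ, F s / s) * ((n - 2 + C * ‖x‖) * e x + V x) +
        F ‖x‖ * R x) := by
  obtain ⟨N, h1, h2, h3, h4, h5⟩ := exists_profile hσ hσρ hF hF0 hFσ hFρ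
  have h := hP N ρ h1 h2 h3 (hσ.le.trans hσρ) hρ h4
  simpa only [fun x : Euc n => (h5 ‖x‖ (norm_nonneg x)).1,
    fun x : Euc n => (h5 ‖x‖ (norm_nonneg x)).2] using h

end

section

/-- A piecewise affine approximation of the indicator function of `Set.Ioo σ ρ`. -/
def cutoff (σ ρ : ℝ) (j : ℕ) (s : ℝ) : ℝ := min 1 (j * max 0 (min (s - σ) (ρ - s)))

variable {σ ρ : ℝ}

lemma continuous_cutoff (σ ρ : ℝ) (j : ℕ) : Continuous (cutoff σ ρ j) := by
  unfold cutoff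
  fun_prop

lemma cutoff_nonneg (j : ℕ) (s : ℝ) : 0 ≤ cutoff σ ρ j s :=
  le_min zero_le_one (mul_nonneg j.cast_nonneg (le_max_left _ _))

lemma cutoff_le_one (j : ℕ) (s : ℝ) : cutoff σ ρ j s ≤ 1 := min_le_left _ _

lemma cutoff_of_le_left (j : ℕ) {s : ℝ} (hs : s ≤ σ) : cutoff σ ρ j s = 0 := by
  rw [cutoff, max_eq_left ((min_le_left _ _).trans (by linarith))]
  simp

lemma cutoff_of_le_right (j : ℕ) {s : ℝ} (hs : ρ ≤ s) : cutoff σ ρ j s = 0 := by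
  rw [cutoff, max_eq_left ((min_le_right _ _).trans (by linarith))]
  simp

lemma tendsto_cutoff {s : ℝ} (h1 : σ < s) (h2 : s < ρ) :
    Filter.Tendsto (fun j => cutoff σ ρ j s) Filter.atTop (𝓝 1) := by
  have hm : 0 < max 0 (min (s - σ) (ρ - s)) :=
    lt_max_of_lt_right (lt_min (by linarith) (by linarith))
  obtain ⟨k, hk⟩ := exists_nat_ge (max 0 (min (s - σ) (ρ - s)))⁻¹
  refine tendsto_const_nhds.congr' ?_
  filter_upwards [Filter.eventually_ge_atTop k] with j hj
  rw [cutoff, min_eq_left]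
  have hkj : (k : ℝ) ≤ j := by exact_mod_cast hj
  calc (1 : ℝ) = (max 0 (min (s - σ) (ρ - s)))⁻¹ * max 0 (min (s - σ) (ρ - s)) := by field_simp
    _ ≤ j * max 0 (min (s - σ) (ρ - s)) := by gcongr; exact hk.trans hkj

lemma continuous_integral_max {c : ℝ → ℝ} (hσρ : σ ≤ ρ) (hc : ContinuousOn c (Set.Ici σ)) :
    Continuous fun r => ∫ s in max r σ..ρ, c s := by
  have hc' : Continuous fun s => c (max s σ) :=
    hc.comp_continuous (by fun_prop) fun s => le_max_right s σ
  have e : (fun r => ∫ s in max r σ..ρ, c s) = fun r => ∫ s in max r σ..ρ, c (max s σ) := by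
    funext r
    refine intervalIntegral.integral_congr fun s hs => ?_
    have : σ ≤ s := (le_min (le_max_right r σ) hσρ).trans hs.1
    simp [max_eq_left this]
  rw [e]
  have h2 : Continuous fun r => ∫ s in ρ..r, c (max s σ) :=
    intervalIntegral.continuous_primitive (fun _ _ => hc'.intervalIntegrable _ _) ρ
  have h3 : (fun r => ∫ s in max r σ..ρ, c (max s σ)) =
      fun r => -∫ s in ρ..max r σ, c (max s σ) := funext fun r => intervalIntegral.integral_symm _ _
  rw [h3]
  exact (h2.comp (by fun_prop : Continuous fun r => max r σ)).neg

lemma integral_cutoff_mul_nonneg_and_le (hσ : 0 < σ) {G : ℝ → ℝ} (hG : Continuous G)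
    (hG0 : ∀ s, 0 ≤ G s) (j : ℕ) {r : ℝ} (hr : r < ρ) (hσρ : σ ≤ ρ) :
    0 ≤ (∫ s in r..ρ, cutoff σ ρ j s * G s / s) ∧
      (∫ s in r..ρ, cutoff σ ρ j s * G s / s) ≤ ∫ s in max r σ..ρ, G s / s := by
  have hk := continuous_cutoff σ ρ j
  have e : (fun s => cutoff σ ρ j s * G s / s) =
      fun s => cutoff σ ρ j s * (G s / max s σ) := by
    funext s
    rcases le_total s σ with h | h
    · simp [cutoff_of_le_left j h]
    · rw [max_eq_left h, mul_div_assoc]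
  have hmax : ∀ s, 0 < max s σ := fun s => lt_max_of_lt_right hσ
  have hq : Continuous fun s => G s / max s σ :=
    hG.div (by fun_prop) fun s => (hmax s).ne'
  have hq0 : ∀ s, 0 ≤ G s / max s σ := fun s => div_nonneg (hG0 s) (hmax s).le
  have hi : ∀ a b, IntervalIntegrable (fun s => cutoff σ ρ j s * (G s / max s σ)) volume a b :=
    fun a b => (hk.mul hq).intervalIntegrable a b
  have hle : ∀ a, σ ≤ a → a ≤ ρ →
      ∫ s in a..ρ, cutoff σ ρ j s * (G s / max s σ) ≤ ∫ s in a..ρ, G s / s := fun a ha haρ => by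
    have e2 : ∫ s in a..ρ, G s / s = ∫ s in a..ρ, G s / max s σ :=
      intervalIntegral.integral_congr fun s hs => by
        have : σ ≤ s := (le_min ha hσρ).trans hs.1
        simp [max_eq_left this]
    rw [e2]
    exact intervalIntegral.integral_mono_on haρ (hi _ _) (hq.intervalIntegrable _ _) fun s _ =>
      mul_le_of_le_one_left (hq0 s) (cutoff_le_one j s)
  rw [e]
  refine ⟨intervalIntegral.integral_nonneg hr.le fun s _ =>
    mul_nonneg (cutoff_nonneg j s) (hq0 s), ?_⟩
  rcases le_total σ r with h | h
  · rw [max_eq_left h]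
    exact hle r h hr.le
  · rw [max_eq_right h, ← intervalIntegral.integral_add_adjacent_intervals (hi r σ) (hi σ ρ)]
    have hz : ∫ s in r..σ, cutoff σ ρ j s * (G s / max s σ) = 0 :=
      intervalIntegral.integral_zero_ae (Filter.Eventually.of_forall fun s hs => by
        rw [Set.uIoc_of_le h] at hs
        rw [cutoff_of_le_left j hs.2, zero_mul])
    rw [hz, zero_add]
    exact hle σ le_rfl hσρ

/-- The limit of the radial profile inequality along the cutoff functions. -/
lemma ProfileInequality.annulus {n : ℕ} (hn : 2 ≤ n) {C : ℝ} (hC : 0 ≤ C) {e V R : Euc n → ℝ}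
    (hP : ProfileInequality n C e V R) (he : IntegrableOn e (ball 0 1))
    (hV : IntegrableOn V (ball 0 1)) (hR : IntegrableOn R (ball 0 1))
    (he0 : ∀ x ∈ ball (0 : Euc n) 1, 0 ≤ e x) (hV0 : ∀ x ∈ ball (0 : Euc n) 1, 0 ≤ V x)
    (hR0 : ∀ x ∈ ball (0 : Euc n) 1, 0 ≤ R x) (hσ : 0 < σ) (hσρ : σ ≤ ρ)
    (hρ : ρ < 1) {G : ℝ → ℝ} (hG : Continuous G) (hG0 : ∀ s, 0 ≤ G s) :
    ∫ x in ball 0 ρ \ ball 0 σ, G ‖x‖ * (1 - C * ‖x‖) * e x ≤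
      (∫ x in ball 0 ρ, (∫ s in max ‖x‖ σ..ρ, G s / s) * ((n - 2 + C * ‖x‖) * e x + V x)) +
        ∫ x in ball 0 ρ \ ball 0 σ, G ‖x‖ * R x := by
  have hn' : (2 : ℝ) ≤ n := by exact_mod_cast hn
  have hGs : ContinuousOn (fun s => G s / s) (Set.Ici σ) :=
    hG.continuousOn.div continuousOn_id fun s hs => (hσ.trans_le hs).ne'
  have hT := continuous_integral_max hσρ hGs
  have hsub : ball (0 : Euc n) ρ ⊆ ball 0 1 := ball_subset_ball hρ.le
  have hAm : MeasurableSet (ball (0 : Euc n) ρ \ ball 0 σ) :=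
    measurableSet_ball.diff measurableSet_ball
  have hAsub : ball (0 : Euc n) ρ \ ball 0 σ ⊆ ball 0 1 := Set.sdiff_subset.trans hsub
  have hl := integrableOn_continuous_mul (m := fun x => G ‖x‖ * (1 - C * ‖x‖)) (by fun_prop) he
  have hr1 : IntegrableOn (fun x => (∫ s in max ‖x‖ σ..ρ, G s / s) *
      ((n - 2 + C * ‖x‖) * e x + V x)) (ball 0 1) := integrableOn_continuous_mul
    (m := fun x : Euc n => ∫ s in max ‖x‖ σ..ρ, G s / s) (hT.comp continuous_norm)
    ((integrableOn_continuous_mul (m := fun x => n - 2 + C * ‖x‖) (by fun_prop) he).add hV)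
  have hr2 := integrableOn_continuous_mul (m := fun x => G ‖x‖) (by fun_prop) hR
  have hvan : ∀ x : Euc n, x ∉ ball (0 : Euc n) ρ \ ball 0 σ → ∀ j, cutoff σ ρ j ‖x‖ = 0 := by
    intro x hx j
    rw [Set.mem_sdiff, mem_ball_zero_iff, mem_ball_zero_iff, not_lt, not_and_or, not_lt,
      not_le] at hx
    exact hx.elim (fun h => cutoff_of_le_right j h) fun h => cutoff_of_le_left j h.le
  have hlim : Filter.Tendsto (fun j : ℕ => ∫ x in ball (0 : Euc n) 1,
      (cutoff σ ρ j ‖x‖ * G ‖x‖) * (1 - C * ‖x‖) * e x) Filter.atTop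
      (𝓝 (∫ x in ball (0 : Euc n) 1, (ball (0 : Euc n) ρ \ ball 0 σ).indicator
        (fun x => G ‖x‖ * (1 - C * ‖x‖) * e x) x)) := by
    refine tendsto_integral_of_dominated_convergence
      (fun x => ‖G ‖x‖ * (1 - C * ‖x‖) * e x‖) (fun j => ?_) hl.norm (fun j => ?_) ?_
    · have := continuous_cutoff σ ρ j
      exact (integrableOn_continuous_mul
        (m := fun x => (cutoff σ ρ j ‖x‖ * G ‖x‖) * (1 - C * ‖x‖)) (by fun_prop) he).1
    · refine Filter.Eventually.of_forall fun x => ?_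
      rw [mul_assoc, mul_assoc, norm_mul, ← mul_assoc, Real.norm_of_nonneg (cutoff_nonneg _ _)]
      exact mul_le_of_le_one_left (norm_nonneg _) (cutoff_le_one _ _)
    · have hs : ∀ᵐ x : Euc n ∂volume.restrict (ball 0 1), x ∉ sphere (0 : Euc n) σ :=
        ae_restrict_of_ae (measure_eq_zero_iff_ae_notMem.mp
          (Measure.addHaar_sphere_of_ne_zero volume 0 hσ.ne'))
      filter_upwards [hs] with x hx
      rw [mem_sphere_zero_iff_norm] at hx
      by_cases hxA : x ∈ ball (0 : Euc n) ρ \ ball 0 σ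
      · rw [Set.indicator_of_mem hxA]
        rw [Set.mem_sdiff, mem_ball_zero_iff, mem_ball_zero_iff, not_lt] at hxA
        have := tendsto_cutoff (lt_of_le_of_ne hxA.2 (Ne.symm hx)) hxA.1
        simpa using ((this.mul_const (G ‖x‖)).mul_const (1 - C * ‖x‖)).mul_const (e x)
      · rw [Set.indicator_of_notMem hxA]
        simp [hvan x hxA]
  have hset : ∀ {S : Set (Euc n)} (_ : MeasurableSet S) (_ : S ⊆ ball 0 1) (f : Euc n → ℝ),
      ∫ x in ball 0 1, S.indicator f x = ∫ x in S, f x := fun hS hS1 f => by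
    rw [setIntegral_indicator hS, Set.inter_eq_self_of_subset_right hS1]
  rw [hset hAm hAsub] at hlim
  refine le_of_tendsto' hlim fun j => ?_
  have hk := continuous_cutoff σ ρ j
  have hF0 : ∀ s, 0 ≤ cutoff σ ρ j s * G s := fun s => mul_nonneg (cutoff_nonneg j s) (hG0 s)
  refine (hP.radial (F := fun s => cutoff σ ρ j s * G s) hσ hσρ hρ (by fun_prop) hF0
    (fun s hs => by rw [cutoff_of_le_left j hs, zero_mul])
    (fun s hs => by rw [cutoff_of_le_right j hs, zero_mul])).trans ?_
  rw [← hset measurableSet_ball hsub, ← hset hAm hAsub,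
    ← integral_add (hr1.indicator measurableSet_ball) (hr2.indicator hAm)]
  have hB0 : ∀ x ∈ ball (0 : Euc n) 1, 0 ≤ (n - 2 + C * ‖x‖) * e x + V x := fun x hx => by
    have h1 := he0 x hx
    have h2 : 0 ≤ (n : ℝ) - 2 + C * ‖x‖ := by
      have := mul_nonneg hC (norm_nonneg x)
      linarith
    have h3 := hV0 x hx
    positivity
  have hzero : ∀ r, ρ ≤ r → ∫ s in r..ρ, cutoff σ ρ j s * G s / s = 0 := fun r hr =>
    intervalIntegral.integral_zero_ae (Filter.Eventually.of_forall fun s hs => by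
      rw [Set.uIoc_of_ge hr] at hs
      rw [cutoff_of_le_right j hs.1.le, zero_mul, zero_div])
  refine integral_mono_of_nonneg (ae_restrict_of_forall measurableSet_ball fun x hx => ?_)
    ((hr1.indicator measurableSet_ball).add (hr2.indicator hAm))
    (ae_restrict_of_forall measurableSet_ball fun x hx => add_le_add ?_ ?_)
  · refine add_nonneg (mul_nonneg ?_ (hB0 x hx)) (mul_nonneg (hF0 _) (hR0 x hx))
    rcases lt_or_ge ‖x‖ ρ with h | h
    · exact (integral_cutoff_mul_nonneg_and_le hσ hG hG0 j h hσρ).1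
    · exact (hzero _ h).ge
  · rcases lt_or_ge ‖x‖ ρ with h | h
    · rw [Set.indicator_of_mem (mem_ball_zero_iff.mpr h)]
      exact mul_le_mul_of_nonneg_right (integral_cutoff_mul_nonneg_and_le hσ hG hG0 j h hσρ).2
        (hB0 x hx)
    · rw [Set.indicator_of_notMem (by rwa [mem_ball_zero_iff, not_lt]), hzero _ h, zero_mul]
  · by_cases hxA : x ∈ ball (0 : Euc n) ρ \ ball 0 σ
    · rw [Set.indicator_of_mem hxA]
      exact mul_le_mul_of_nonneg_right (mul_le_of_le_one_left (hG0 _) (cutoff_le_one j _))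
        (hR0 x hx)
    · rw [Set.indicator_of_notMem hxA, hvan x hxA j, zero_mul, zero_mul]

end

section

variable {σ ρ : ℝ}

lemma setIntegral_tail_mul {n : ℕ} (hσρ : σ ≤ ρ) {c : ℝ → ℝ}
    (hc : IntegrableOn c (Set.Ioc σ ρ)) {V : Euc n → ℝ} (hV : IntegrableOn V (ball 0 ρ)) :
    ∫ x in ball 0 ρ, (∫ s in max ‖x‖ σ..ρ, c s) * V x =
      ∫ s in σ..ρ, c s * ∫ x in ball 0 s, V x := by
  set S : Set (ℝ × Euc n) := {p | ‖p.2‖ < p.1} with hS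
  have hSm : MeasurableSet S := measurableSet_lt (by fun_prop) (by fun_prop)
  have hi : Integrable (Function.uncurry fun s x => S.indicator (fun p => c p.1 * V p.2) (s, x))
      ((volume.restrict (Set.Ioc σ ρ)).prod (volume.restrict (ball (0 : Euc n) ρ))) :=
    (hc.mul_prod hV).indicator hSm
  rw [intervalIntegral.integral_of_le hσρ]
  have e1 : ∀ s ∈ Set.Ioc σ ρ, c s * ∫ x in ball (0 : Euc n) s, V x =
      ∫ x in ball (0 : Euc n) ρ, S.indicator (fun p => c p.1 * V p.2) (s, x) := fun s hs => by
    have e2 : (fun x => S.indicator (fun p => c p.1 * V p.2) (s, x)) =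
        (ball (0 : Euc n) s).indicator fun x => c s * V x := by
      funext x
      exact Set.indicator_eq_indicator (by simp [hS]) rfl
    rw [e2, setIntegral_indicator measurableSet_ball,
      Set.inter_eq_self_of_subset_right (ball_subset_ball hs.2), integral_const_mul]
  rw [setIntegral_congr_fun measurableSet_Ioc e1, integral_integral_swap hi]
  refine setIntegral_congr_fun measurableSet_ball fun x hx => ?_
  have e3 : (fun s => S.indicator (fun p => c p.1 * V p.2) (s, x)) =
      (Set.Ioi ‖x‖).indicator fun s => c s * V x := by
    funext s
    exact Set.indicator_eq_indicator (by simp [hS]) rfl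
  have hx' : ‖x‖ < ρ := mem_ball_zero_iff.mp hx
  simp only [e3]
  rw [setIntegral_indicator measurableSet_Ioi, Set.Ioc_inter_Ioi, integral_mul_const,
    intervalIntegral.integral_of_le (max_le hx'.le hσρ), max_comm]

/-- The weight `exp (-χ s) * s ^ p`. -/
def radialWeight (χ p s : ℝ) : ℝ := Real.exp (-χ * s) * s ^ p

lemma radialWeight_pos (χ p : ℝ) {s : ℝ} (hs : 0 < s) : 0 < radialWeight χ p s :=
  mul_pos (Real.exp_pos _) (Real.rpow_pos_of_pos hs p)

lemma radialWeight_div (χ p : ℝ) {s : ℝ} (hs : 0 < s) :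
    radialWeight χ p s / s = radialWeight χ (p - 1) s := by
  rw [radialWeight, radialWeight, Real.rpow_sub_one hs.ne', mul_div_assoc]

lemma hasDerivAt_radialWeight (χ p : ℝ) {s : ℝ} (hs : 0 < s) :
    HasDerivAt (radialWeight χ p) (-((-p + χ * s) * radialWeight χ (p - 1) s)) s := by
  have h1 : HasDerivAt (fun s => Real.exp (-χ * s)) (Real.exp (-χ * s) * -χ) s := by
    simpa using ((hasDerivAt_id s).const_mul (-χ)).exp
  have h2 := h1.mul (Real.hasDerivAt_rpow_const (p := p) (Or.inl hs.ne'))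
  refine h2.congr_deriv ?_
  rw [radialWeight, Real.rpow_sub_one hs.ne']
  field_simp
  ring

lemma continuousOn_radialWeight (χ p : ℝ) (hσ : 0 < σ) :
    ContinuousOn (radialWeight χ p) (Set.Ici σ) := fun _ hs =>
  (hasDerivAt_radialWeight χ p (hσ.trans_le hs)).continuousAt.continuousWithinAt

lemma integral_div_mul_le {C χ p : ℝ} (hC : 0 < C) (hp : 0 ≤ p) (hχ : χ = 2 * C * (p + 1))
    {a r : ℝ} (ha : 0 < a) (hra : r ≤ a) (haρ : a ≤ ρ) (hρ : C * ρ < 1 / 2) :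
    (∫ s in a..ρ, radialWeight χ (-p - 1) s / (1 - C * s)) * (p + C * r) ≤
      radialWeight χ (-p) a - radialWeight χ (-p) ρ := by
  have hpos : ∀ s ∈ Set.Icc a ρ, 0 < s ∧ 1 / 2 < 1 - C * s := fun s hs =>
    ⟨ha.trans_le hs.1, by nlinarith [mul_le_mul_of_nonneg_left hs.2 hC.le]⟩
  have hcw : ContinuousOn (radialWeight χ (-p - 1)) (Set.uIcc a ρ) := by
    rw [Set.uIcc_of_le haρ]
    exact (continuousOn_radialWeight χ _ ha).mono fun s hs => hs.1
  have hc1 : ContinuousOn (fun s => radialWeight χ (-p - 1) s / (1 - C * s) * (p + C * r))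
      (Set.uIcc a ρ) := by
    refine (hcw.div (by fun_prop) fun s hs => ?_).mul continuousOn_const
    rw [Set.uIcc_of_le haρ] at hs
    linarith [(hpos s hs).2]
  have hc2 : ContinuousOn (fun s => -((- -p + χ * s) * radialWeight χ (-p - 1) s))
      (Set.uIcc a ρ) := (ContinuousOn.mul (by fun_prop) hcw).neg
  have hftc := intervalIntegral.integral_eq_sub_of_hasDerivAt
    (fun s hs => hasDerivAt_radialWeight χ (-p) (by
      rw [Set.uIcc_of_le haρ] at hs
      exact (hpos s hs).1)) hc2.intervalIntegrable
  rw [← intervalIntegral.integral_mul_const, ← neg_sub (radialWeight χ (-p) ρ), ← hftc, ← intervalIntegral.integral_neg]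
  refine intervalIntegral.integral_mono_on haρ hc1.intervalIntegrable
    hc2.intervalIntegrable.neg fun s hs => ?_
  obtain ⟨hs0, hs1⟩ := hpos s hs
  have hw := radialWeight_pos χ (-p - 1) hs0
  rw [neg_neg, neg_neg, div_mul_eq_mul_div, div_le_iff₀ (by linarith), mul_comm _ (p + C * r),
    mul_right_comm]
  refine mul_le_mul_of_nonneg_right ?_ hw.le
  have h1 : C * r ≤ C * s := mul_le_mul_of_nonneg_left (hra.trans hs.1) hC.le
  have h2 : C * (p + 1) * s ≤ χ * s * (1 - C * s) := by
    have h3 : 0 ≤ C * (p + 1) * s := by positivity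
    rw [hχ]
    nlinarith [mul_le_mul_of_nonneg_left hs1.le h3]
  nlinarith [mul_nonneg hp (mul_nonneg hC.le hs0.le)]

end

section

variable {n : ℕ} {σ ρ C χ p : ℝ} {e V R : Euc n → ℝ}

lemma integral_div_le (hC : 0 ≤ C) {a : ℝ} (ha : 0 < a) (haρ : a ≤ ρ) (hρ : C * ρ < 1) :
    (∫ s in a..ρ, radialWeight χ p s / (1 - C * s)) ≤
      (1 / (1 - C * ρ)) * ∫ s in a..ρ, radialWeight χ p s := by
  have hs1 : ∀ s ∈ Set.Icc a ρ, 1 - C * ρ ≤ 1 - C * s := fun s hs => by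
    linarith [mul_le_mul_of_nonneg_left hs.2 hC]
  have hcw : ContinuousOn (radialWeight χ p) (Set.uIcc a ρ) := by
    rw [Set.uIcc_of_le haρ]
    exact (continuousOn_radialWeight χ _ ha).mono fun s hs => hs.1
  rw [← intervalIntegral.integral_const_mul]
  refine intervalIntegral.integral_mono_on haρ (ContinuousOn.intervalIntegrable ?_)
    (hcw.intervalIntegrable.const_mul _) fun s hs => ?_
  · refine hcw.div (by fun_prop) fun s hs => ?_
    rw [Set.uIcc_of_le haρ] at hs
    linarith [hs1 s hs]
  · rw [one_div, ← div_eq_inv_mul]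
    exact div_le_div_of_nonneg_left (radialWeight_pos χ p (ha.trans_le hs.1)).le (by linarith)
      (hs1 s hs)

/-- The almost monotonicity of the weighted energy implied by the profile inequality. -/
theorem ProfileInequality.monotonicity (hn : 2 ≤ n) (hC : 0 < C)
    (hP : ProfileInequality n C e V R) (he : IntegrableOn e (ball 0 1))
    (hV : IntegrableOn V (ball 0 1)) (hR : IntegrableOn R (ball 0 1))
    (he0 : ∀ x ∈ ball (0 : Euc n) 1, 0 ≤ e x) (hV0 : ∀ x ∈ ball (0 : Euc n) 1, 0 ≤ V x)
    (hR0 : ∀ x ∈ ball (0 : Euc n) 1, 0 ≤ R x) (hp : (n : ℝ) - 2 = p)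
    (hχ : χ = 2 * C * (p + 1)) (hσ : 0 < σ) (hσρ : σ ≤ ρ) (hρ : ρ < 1) (hCρ : C * ρ < 1 / 2) :
    radialWeight χ (-p) ρ * (∫ x in ball 0 ρ, e x) -
        radialWeight χ (-p) σ * (∫ x in ball 0 σ, e x) ≤
      (1 / (1 - C * ρ)) * ((∫ s in σ..ρ, radialWeight χ (-p - 1) s * ∫ x in ball 0 s, V x) +
        ∫ x in ball 0 ρ \ ball 0 σ, radialWeight χ (-p) ‖x‖ * R x) := by
  have hn' : (2 : ℝ) ≤ n := by exact_mod_cast hn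
  have hρ0 : 0 < ρ := hσ.trans_le hσρ
  have hsC : ∀ s ≤ ρ, 1 - C * ρ ≤ 1 - C * s ∧ 1 / 2 < 1 - C * s := fun s hs => by
    constructor <;> linarith [mul_le_mul_of_nonneg_left hs hC.le]
  have hk0 : 0 < 1 - C * ρ := by linarith
  have hcl : Continuous fun s => min (max s σ) ρ := by fun_prop
  have hclσ : ∀ s, σ ≤ min (max s σ) ρ := fun s => le_min (le_max_right _ _) hσρ
  have hclρ : ∀ s, min (max s σ) ρ ≤ ρ := fun s => min_le_right _ _
  have hcle : ∀ s, σ ≤ s → s ≤ ρ → min (max s σ) ρ = s := fun s h1 h2 => by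
    rw [max_eq_left h1, min_eq_left h2]
  set G : ℝ → ℝ := fun s => radialWeight χ (-p) (min (max s σ) ρ) / (1 - C * min (max s σ) ρ)
    with hGdef
  have hwc := continuousOn_radialWeight χ (-p) hσ
  have hG : Continuous G := by
    refine (hwc.comp_continuous hcl hclσ).div (by fun_prop) fun s => ?_
    linarith [(hsC _ (hclρ s)).2]
  have hG0 : ∀ s, 0 ≤ G s := fun s => div_nonneg
    (radialWeight_pos χ _ (hσ.trans_le (hclσ s))).le (by linarith [(hsC _ (hclρ s)).2])
  have hGs : ∀ s, σ ≤ s → s ≤ ρ → G s = radialWeight χ (-p) s / (1 - C * s) := fun s h1 h2 => by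
    simp only [hGdef, hcle s h1 h2]
  have hT : ∀ x ∈ ball (0 : Euc n) ρ, ∫ s in max ‖x‖ σ..ρ, G s / s =
      ∫ s in max ‖x‖ σ..ρ, radialWeight χ (-p - 1) s / (1 - C * s) := fun x hx => by
    refine intervalIntegral.integral_congr fun s hs => ?_
    rw [Set.uIcc_of_le (max_le (mem_ball_zero_iff.mp hx).le hσρ)] at hs
    have hσs := (le_max_right _ _).trans hs.1
    rw [hGs s hσs hs.2, ← radialWeight_div χ (-p) (hσ.trans_le hσs), div_right_comm]
  have hann := hP.annulus hn hC.le he hV hR he0 hV0 hR0 hσ hσρ hρ hG hG0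
  have hsub : ball (0 : Euc n) ρ ⊆ ball 0 1 := ball_subset_ball hρ.le
  have hAm : MeasurableSet (ball (0 : Euc n) ρ \ ball 0 σ) :=
    measurableSet_ball.diff measurableSet_ball
  have hA : ∀ x ∈ ball (0 : Euc n) ρ \ ball 0 σ, σ ≤ ‖x‖ ∧ ‖x‖ < ρ := fun x hx =>
    ⟨not_lt.mp (mt mem_ball_zero_iff.mpr hx.2), mem_ball_zero_iff.mp hx.1⟩
  have hAsub : ball (0 : Euc n) ρ \ ball 0 σ ⊆ ball 0 1 := Set.sdiff_subset.trans hsub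
  -- the energy on the annulus
  have h1 : ∫ x in ball 0 ρ \ ball 0 σ, G ‖x‖ * (1 - C * ‖x‖) * e x =
      ∫ x in ball 0 ρ \ ball 0 σ, radialWeight χ (-p) (max ‖x‖ σ) * e x :=
    setIntegral_congr_fun hAm fun x hx => by
      obtain ⟨h1, h2⟩ := hA x hx
      have := (hsC _ h2.le).2
      rw [hGs _ h1 h2.le, max_eq_left h1, div_mul_cancel₀ _ (by linarith)]
  have hmi : IntegrableOn (fun x : Euc n => radialWeight χ (-p) (max ‖x‖ σ) * e x) (ball 0 1) :=
    integrableOn_continuous_mul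
      (hwc.comp_continuous (f := fun x : Euc n => max ‖x‖ σ) (by fun_prop)
        fun x => le_max_right ‖x‖ σ) he
  have h2 : ∫ x in ball 0 ρ, radialWeight χ (-p) (max ‖x‖ σ) * e x =
      (∫ x in ball 0 ρ \ ball 0 σ, radialWeight χ (-p) (max ‖x‖ σ) * e x) +
        radialWeight χ (-p) σ * ∫ x in ball 0 σ, e x := by
    have e1 : ∫ x in ball (0 : Euc n) σ, radialWeight χ (-p) (max ‖x‖ σ) * e x =
        radialWeight χ (-p) σ * ∫ x in ball 0 σ, e x := by
      rw [← integral_const_mul]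
      refine setIntegral_congr_fun measurableSet_ball fun x hx => ?_
      simp only [max_eq_right (mem_ball_zero_iff.mp hx).le]
    rw [← e1, setIntegral_sdiff measurableSet_ball (hmi.mono_set hsub) (ball_subset_ball hσρ)]
    ring
  -- the potential term
  have hcc := continuousOn_radialWeight χ (-p - 1) hσ
  have hTc := continuous_integral_max hσρ hcc
  have hTi := integrableOn_continuous_mul
    (m := fun x : Euc n => ∫ s in max ‖x‖ σ..ρ, radialWeight χ (-p - 1) s)
    (hTc.comp continuous_norm) hV
  have h3 : (∫ x in ball 0 ρ,
      (∫ s in max ‖x‖ σ..ρ, G s / s) * ((n - 2 + C * ‖x‖) * e x + V x)) ≤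
      ∫ x in ball 0 ρ, (radialWeight χ (-p) (max ‖x‖ σ) * e x - radialWeight χ (-p) ρ * e x +
        (1 / (1 - C * ρ)) * ((∫ s in max ‖x‖ σ..ρ, radialWeight χ (-p - 1) s) * V x)) := by
    refine integral_mono_of_nonneg (ae_restrict_of_forall measurableSet_ball fun x hx => ?_)
      (((hmi.sub (he.const_mul _)).add (hTi.const_mul _)).mono_set hsub)
      (ae_restrict_of_forall measurableSet_ball fun x hx => ?_)
    · have hm := max_le (mem_ball_zero_iff.mp hx).le hσρ
      have a1 := he0 x (hsub hx)
      have a2 := hV0 x (hsub hx)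
      have a3 : 0 ≤ (n : ℝ) - 2 + C * ‖x‖ := by
        have := mul_nonneg hC.le (norm_nonneg x)
        linarith
      refine mul_nonneg (intervalIntegral.integral_nonneg hm fun s hs => ?_) (by positivity)
      exact div_nonneg (hG0 s) (hσ.le.trans ((le_max_right _ _).trans hs.1))
    · have hm := max_le (mem_ball_zero_iff.mp hx).le hσρ
      have hm0 : 0 < max ‖x‖ σ := lt_max_of_lt_right hσ
      have b1 := integral_div_mul_le hC (by linarith) hχ hm0 (le_max_left ‖x‖ σ) hm hCρ
      have b2 := integral_div_le (χ := χ) (p := -p - 1) hC.le hm0 hm (by linarith)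
      have b3 := mul_le_mul_of_nonneg_right b1 (he0 x (hsub hx))
      have b4 := mul_le_mul_of_nonneg_right b2 (hV0 x (hsub hx))
      simp only [hT x hx, hp]
      linarith
  have h4 : ∫ x in ball 0 ρ, (radialWeight χ (-p) (max ‖x‖ σ) * e x -
        radialWeight χ (-p) ρ * e x +
        (1 / (1 - C * ρ)) * ((∫ s in max ‖x‖ σ..ρ, radialWeight χ (-p - 1) s) * V x)) =
      (∫ x in ball 0 ρ, radialWeight χ (-p) (max ‖x‖ σ) * e x) -
        radialWeight χ (-p) ρ * (∫ x in ball 0 ρ, e x) +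
        (1 / (1 - C * ρ)) * ∫ s in σ..ρ, radialWeight χ (-p - 1) s * ∫ x in ball 0 s, V x := by
    rw [← setIntegral_tail_mul hσρ 
        ((hcc.mono Set.Icc_subset_Ici_self).integrableOn_Icc.mono_set Set.Ioc_subset_Icc_self)
        (hV.mono_set hsub), ← integral_const_mul, ← integral_const_mul,
      ← integral_sub (hmi.mono_set hsub) ((he.mono_set hsub).const_mul _)]
    exact integral_add ((hmi.mono_set hsub).sub ((he.mono_set hsub).const_mul _))
      ((hTi.mono_set hsub).const_mul _)
  -- the radial derivative
  have h5 : ∫ x in ball 0 ρ \ ball 0 σ, G ‖x‖ * R x ≤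
      (1 / (1 - C * ρ)) * ∫ x in ball 0 ρ \ ball 0 σ, radialWeight χ (-p) ‖x‖ * R x := by
    rw [← integral_const_mul]
    have hRi : IntegrableOn (fun x : Euc n => radialWeight χ (-p) (max ‖x‖ σ) * R x) (ball 0 1) :=
      integrableOn_continuous_mul
        (hwc.comp_continuous (f := fun x : Euc n => max ‖x‖ σ) (by fun_prop)
          fun x => le_max_right ‖x‖ σ) hR
    refine setIntegral_mono_on ((integrableOn_continuous_mul (m := fun x => G ‖x‖)
      (by fun_prop) hR).mono_set hAsub) (((hRi.mono_set hAsub).congr_fun (fun x hx => ?_)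
        hAm).const_mul _) hAm fun x hx => ?_
    · simp only [max_eq_left (hA x hx).1]
    · obtain ⟨h1, h2⟩ := hA x hx
      have hw := radialWeight_pos χ (-p) (hσ.trans_le h1)
      have hr := hR0 x (hAsub hx)
      rw [hGs _ h1 h2.le, ← mul_assoc, one_div, ← div_eq_inv_mul]
      gcongr
  linarith

end

/-- reverse monotonicity formula for the Ginzburg–Landau energy. -/
theorem stmt3 (n : ℕ) (hn : 3 ≤ n) (lam Lam : ℝ) (hlam : 0 < lam) (hLam : 0 < Lam) :
    ∃ χ' C ρ₀ : ℝ, 0 < χ' ∧ 0 < C ∧ 0 < ρ₀ ∧ ρ₀ < 1 ∧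
      ∀ (g : Euc n → Matrix (Fin n) (Fin n) ℝ) (ε : ℝ) (u : Euc n → ℂ),
        0 < ε → MemM n lam Lam g → IsGLSol n g ε u →
        ∀ σ ρ : ℝ, 0 < σ → σ ≤ ρ → ρ < ρ₀ →
          Real.exp (-χ' * ρ) * ρ ^ ((2 : ℝ) - n) *
              (∫ x in ball (0 : Euc n) ρ, eDen g ε u x * sqrtDet g x)
            - Real.exp (-χ' * σ) * σ ^ ((2 : ℝ) - n) *
              (∫ x in ball (0 : Euc n) σ, eDen g ε u x * sqrtDet g x)
          ≤ (1 / (1 - C * ρ)) *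
            ((∫ s in σ..ρ, Real.exp (-χ' * s) * s ^ ((1 : ℝ) - n) *
                ∫ x in ball (0 : Euc n) s,
                  (1 - ‖u x‖ ^ 2) ^ 2 / (2 * ε ^ 2) * sqrtDet g x)
              + ∫ x in ball (0 : Euc n) ρ \ ball (0 : Euc n) σ,
                  Real.exp (-χ' * ‖x‖) * ‖x‖ ^ ((2 : ℝ) - n) * ‖radD g u x‖ ^ 2
                    * sqrtDet g x) := by
  obtain ⟨c, L, hc, hL, hcoeff⟩ := exists_ellipticCoeff n hlam hLam
  obtain ⟨C, hC1, hC2, hC⟩ : ∃ C : ℝ, n * L / c ≤ C ∧ 2 * n ^ 3 * L * (1 + L) / c ^ 2 ≤ C ∧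
      1 ≤ C :=
    ⟨max (n * L / c) (max (2 * n ^ 3 * L * (1 + L) / c ^ 2) 1), le_max_left _ _,
      (le_max_left _ _).trans (le_max_right _ _), (le_max_right _ _).trans (le_max_right _ _)⟩
  have hn' : (3 : ℝ) ≤ n := by exact_mod_cast hn
  have hC0 : 0 < C := by linarith
  refine ⟨2 * C * ((n : ℝ) - 2 + 1), C, 1 / (2 * C), by
    have : 0 < (n : ℝ) - 2 + 1 := by linarith
    positivity, hC0, by positivity, ?_, fun g ε u _ hg hu σ ρ hσ hσρ hρ => ?_⟩
  · rw [div_lt_one (by positivity)]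
    linarith
  obtain ⟨H, hinv⟩ := hcoeff g hg
  have hw := hu.weakSol H
  have hCρ : C * ρ < 1 / 2 := by
    rw [lt_div_iff₀ (by positivity)] at hρ
    linarith
  have hρ1 : ρ < 1 := by nlinarith
  have hP : ProfileInequality n C (density (metricCoeff g) (sqrtDet g) ε u)
      (fun x => 2 * (sqrtDet g x * potential ε (u x)))
      (fun x => ‖radD g u x‖ ^ 2 * sqrtDet g x) := fun N r hN hN0 hN1 hr hr1 hNr =>
    integral_profile_le hn H hinv hw hC1 hC2 hN hN0 hN1 hr hr1 hNr
  have h := hP.monotonicity (by omega) hC0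
    (H.integrableOn_density ε hw.diff.continuousOn hw.le_one hw.memLp)
    ((H.integrableOn_w_mul hw.integrableOn_potential).const_mul 2)
    (integrableOn_radD_sq H hinv hw) (fun x hx => H.density_nonneg hx ε u)
    (fun x hx => mul_nonneg zero_le_two (mul_nonneg (H.w_pos hx).le (potential_nonneg _ _)))
    (fun x hx => mul_nonneg (sq_nonneg _) (H.w_pos hx).le) rfl rfl hσ hσρ hρ1 hCρ
  have e1 : -((n : ℝ) - 2) = 2 - n := by ring
  have e2 : (2 : ℝ) - n - 1 = 1 - n := by ring
  have e3 : ∀ x, 2 * (sqrtDet g x * potential ε (u x)) =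
      (1 - ‖u x‖ ^ 2) ^ 2 / (2 * ε ^ 2) * sqrtDet g x := fun x => by
    rw [potential]
    ring
  simpa only [density_metricCoeff, e1, e2, e3, radialWeight, ← mul_assoc] using h
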